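/- Quantum reverse Shannon theorem with entanglement assistance (achievability): Let V : ℂ^{d_A} → ℂ^{d_B} ⊗ ℂ^{d_E} be an isometry (V†V = I) defining the quantum channel N(ρ) = Tr_E(VρV†), let |ψ_RA⟩ ∈ ℂ^{d_R} ⊗ ℂ^{d_A} be a unit vector with reduced density matrix ρ_A on the A factor, and let |ψ_RBE⟩ = (I_R ⊗ V)|ψ_RA⟩. Then for every δ > 0 and ε > 0 and all sufficiently large n there exist: a maximally entangled pure state Φ_k = (1/√k) Σ_{i=1}^k |i⟩|i⟩ shared between Alice and Bob with k ≤ 2^{n(I(E;B)_ψ/2 + δ)}; a CPTP map (Alice's encoder) from the n-fold A system together with Alice's half of Φ_k to a quantum system Q of dimension at most 2^{n(I(R;B)_ψ/2 + δ)}; and a CPTP map (Bob's decoder) from Q together with Bob's half of Φ_k to (ℂ^{d_B})^{⊗n}; such that, denoting by 𝒮 the composed simulated channel from (ℂ^{d_A})^{⊗n} to (ℂ^{d_B})^{⊗n}, the trace norm ‖(id_{R^n} ⊗ 𝒮)(ψ_RA^{⊗n}) − (id_{R^n} ⊗ N^{⊗n})(ψ_RA^{⊗n})‖₁ is at most ε,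 where I(E;B)_ψ and I(R;B)_ψ are quantum mutual informations of the pure state ψ_RBE. -/

import Mathlib

open Matrix
open scoped BigOperators ComplexConjugate

/-- Von Neumann entropy (base 2) of a matrix, via its eigenvalues (0 if not Hermitian). -/
noncomputable def vnEnt {m : Type*} [Fintype m] [DecidableEq m] (ρ : Matrix m m ℂ) : ℝ :=
  if h : ρ.IsHermitian then ∑ i, -(h.eigenvalues i * Real.logb 2 (h.eigenvalues i)) else 0

/-- Trace norm of a matrix: the sum of the absolute values of the eigenvalues
(defined for Hermitian matrices; 0 otherwise). -/
noncomputable def traceNorm {m : Type*} [Fintype m] [DecidableEq m] (M : Matrix m m ℂ) : ℝ :=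
  if h : M.IsHermitian then ∑ i, |h.eigenvalues i| else 0

/-- The pure state `|ψ_RBE⟩ = (I_R ⊗ V)|ψ_RA⟩`. -/
noncomputable def stateRBE {dA dB dE dR : ℕ}
    (V : Matrix (Fin dB × Fin dE) (Fin dA) ℂ)
    (ψ : Fin dR × Fin dA → ℂ) : Fin dR × Fin dB × Fin dE → ℂ :=
  fun z => ∑ a, V (z.2.1, z.2.2) a * ψ (z.1, a)

/-- Quantum mutual information `I(E;B)_ψ` of the pure state `ψ_RBE`. -/
noncomputable def mutEB {dA dB dE dR : ℕ}
    (V : Matrix (Fin dB × Fin dE) (Fin dA) ℂ)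
    (ψ : Fin dR × Fin dA → ℂ) : ℝ :=
  let w := stateRBE V ψ
  vnEnt (Matrix.of fun e e' : Fin dE =>
      ∑ r, ∑ b, w (r, b, e) * conj (w (r, b, e'))) +
    vnEnt (Matrix.of fun b b' : Fin dB =>
      ∑ r, ∑ e, w (r, b, e) * conj (w (r, b', e))) -
    vnEnt (Matrix.of fun x y : Fin dB × Fin dE =>
      ∑ r, w (r, x.1, x.2) * conj (w (r, y.1, y.2)))

/-- Quantum mutual information `I(R;B)_ψ` of the pure state `ψ_RBE`. -/
noncomputable def mutRB {dA dB dE dR : ℕ}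
    (V : Matrix (Fin dB × Fin dE) (Fin dA) ℂ)
    (ψ : Fin dR × Fin dA → ℂ) : ℝ :=
  let w := stateRBE V ψ
  vnEnt (Matrix.of fun r r' : Fin dR =>
      ∑ b, ∑ e, w (r, b, e) * conj (w (r', b, e))) +
    vnEnt (Matrix.of fun b b' : Fin dB =>
      ∑ r, ∑ e, w (r, b, e) * conj (w (r, b', e))) -
    vnEnt (Matrix.of fun x y : Fin dR × Fin dB =>
      ∑ e, w (x.1, x.2, e) * conj (w (y.1, y.2, e)))

section mainDev
open scoped ComplexOrder
/-- Squared Frobenius norm. -/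
noncomputable def fsq {m n : Type*} [Fintype m] [Fintype n] (M : Matrix m n ℂ) : ℝ :=
  ∑ i, ∑ j, Complex.normSq (M i j)

section fro
variable {m n p : Type*} [Fintype m] [Fintype n] [Fintype p]

lemma fsq_nonneg (M : Matrix m n ℂ) : 0 ≤ fsq M :=
  Finset.sum_nonneg fun _ _ => Finset.sum_nonneg fun _ _ => Complex.normSq_nonneg _

lemma fsq_trace (M : Matrix m n ℂ) : ((fsq M : ℝ) : ℂ) = (Mᴴ * M).trace := by
  simp only [fsq, Matrix.trace, Matrix.diag, Matrix.mul_apply, Matrix.conjTranspose_apply]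
  rw [Finset.sum_comm]
  push_cast
  refine Finset.sum_congr rfl fun i _ => Finset.sum_congr rfl fun j _ => ?_
  rw [Complex.normSq_eq_conj_mul_self]; rfl

lemma fsq_trace' (M : Matrix m n ℂ) : ((fsq M : ℝ) : ℂ) = (M * Mᴴ).trace := by
  rw [fsq_trace, Matrix.trace_mul_comm]

lemma normSq_add_le (a b : ℂ) :
    Complex.normSq (a + b) ≤ 2 * Complex.normSq a + 2 * Complex.normSq b := by
  simp only [Complex.normSq_apply, Complex.add_re, Complex.add_im]
  nlinarith [sq_nonneg (a.re - b.re), sq_nonneg (a.im - b.im)]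

lemma fsq_add_le (M N : Matrix m n ℂ) : fsq (M + N) ≤ 2 * fsq M + 2 * fsq N := by
  simp only [fsq, Finset.mul_sum, ← Finset.sum_add_distrib]
  exact Finset.sum_le_sum fun i _ => Finset.sum_le_sum fun j _ => normSq_add_le _ _

lemma fsq_conjTranspose (M : Matrix m n ℂ) : fsq Mᴴ = fsq M := by
  simp only [fsq]
  rw [Finset.sum_comm]
  refine Finset.sum_congr rfl fun i _ => Finset.sum_congr rfl fun j _ => ?_
  simp [Matrix.conjTranspose_apply]

lemma fsq_mul_le [DecidableEq n] (C : Matrix m n ℂ) (M : Matrix n p ℂ)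
    (hC : (1 - Cᴴ * C).PosSemidef) : fsq (C * M) ≤ fsq M := by
  have h := (hC.conjTranspose_mul_mul_same M).trace_nonneg
  have e : (Mᴴ * (1 - Cᴴ * C) * M).trace = ((fsq M - fsq (C * M) : ℝ) : ℂ) := by
    push_cast
    rw [fsq_trace, fsq_trace, ← Matrix.trace_sub]
    congr 1
    rw [Matrix.conjTranspose_mul]
    simp only [Matrix.mul_sub, Matrix.sub_mul, Matrix.mul_one, Matrix.mul_assoc]
  rw [e] at h
  have := Complex.zero_le_real.mp h
  linarith

lemma fsq_mul_le' [DecidableEq n] (M : Matrix m n ℂ) (C : Matrix n p ℂ)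
    (hC : (1 - C * Cᴴ).PosSemidef) : fsq (M * C) ≤ fsq M := by
  rw [← fsq_conjTranspose (M * C), ← fsq_conjTranspose M, Matrix.conjTranspose_mul]
  apply fsq_mul_le
  simpa using hC

lemma psd_of_isometry [DecidableEq n] (C : Matrix m n ℂ) (h : Cᴴ * C = 1) :
    (1 - Cᴴ * C).PosSemidef := by
  rw [h, sub_self]; exact Matrix.PosSemidef.zero

lemma psd_mul [DecidableEq n] [DecidableEq p] (A : Matrix m n ℂ) (B : Matrix n p ℂ)
    (hA : (1 - Aᴴ * A).PosSemidef) (hB : (1 - Bᴴ * B).PosSemidef) :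
    (1 - (A * B)ᴴ * (A * B)).PosSemidef := by
  have e : 1 - (A * B)ᴴ * (A * B) = (1 - Bᴴ * B) + Bᴴ * (1 - Aᴴ * A) * B := by
    rw [Matrix.conjTranspose_mul]
    simp only [Matrix.mul_sub, Matrix.sub_mul, Matrix.mul_one, Matrix.mul_assoc]
    abel
  rw [e]
  exact hB.add (hA.conjTranspose_mul_mul_same B)

lemma psd_of_idem [DecidableEq n] (T : Matrix n n ℂ) (h1 : Tᴴ = T) (h2 : T * T = T) :
    (1 - T).PosSemidef := by
  have : 1 - T = (1 - T)ᴴ * (1 - T) := by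
    rw [Matrix.conjTranspose_sub, h1, Matrix.conjTranspose_one]
    simp only [Matrix.mul_sub, Matrix.sub_mul, Matrix.mul_one, Matrix.one_mul, h2]
    abel
  rw [this]
  exact Matrix.posSemidef_conjTranspose_mul_self _

/-- spectral form -/
lemma spec [DecidableEq n] (A : Matrix n n ℂ) (hA : A.IsHermitian) :
    ∃ U : Matrix n n ℂ, Uᴴ * U = 1 ∧ U * Uᴴ = 1 ∧
      A = U * diagonal (fun i => (hA.eigenvalues i : ℂ)) * Uᴴ := by
  refine ⟨(hA.eigenvectorUnitary : Matrix n n ℂ), ?_, ?_, ?_⟩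
  · exact Unitary.coe_star_mul_self hA.eigenvectorUnitary
  · exact Unitary.coe_mul_star_self hA.eigenvectorUnitary
  · have := hA.spectral_theorem
    rw [Unitary.conjStarAlgAut_apply] at this
    exact this

end fro

section polar
variable {m n p : Type*} [Fintype m] [Fintype n] [Fintype p] [DecidableEq m] [DecidableEq n]
  [DecidableEq p]

lemma polar (X : Matrix m n ℂ) : ∃ (a : Matrix m m ℂ) (V : Matrix m n ℂ),
    a.PosSemidef ∧ a * a = X * Xᴴ ∧ X = a * V ∧ a * (V * Vᴴ) = a ∧
      (1 - Vᴴ * V).PosSemidef ∧ (1 - V * Vᴴ).PosSemidef := by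
  have hS : (X * Xᴴ).PosSemidef := Matrix.posSemidef_self_mul_conjTranspose X
  obtain ⟨U, hU1, hU2, hU3⟩ := spec (X * Xᴴ) hS.1
  set l := hS.1.eigenvalues with hl
  have hl0 : ∀ i, 0 ≤ l i := fun i => hS.eigenvalues_nonneg i
  let f : m → ℂ := fun i => ((Real.sqrt (l i) : ℝ) : ℂ)
  let g : m → ℂ := fun i => (((Real.sqrt (l i))⁻¹ : ℝ) : ℂ)
  let h : m → ℂ := fun i => if l i = 0 then 0 else 1
  have key : ∀ (u v : m → ℂ), (U * diagonal u * Uᴴ) * (U * diagonal v * Uᴴ) =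
      U * diagonal (fun i => u i * v i) * Uᴴ := by
    intro u v
    calc _ = U * diagonal u * (Uᴴ * U) * diagonal v * Uᴴ := by simp only [Matrix.mul_assoc]
      _ = _ := by
        rw [hU1, Matrix.mul_one, Matrix.mul_assoc U, Matrix.diagonal_mul_diagonal]
  have keyH : ∀ (u : m → ℂ), (∀ i, star (u i) = u i) →
      (U * diagonal u * Uᴴ)ᴴ = U * diagonal u * Uᴴ := by
    intro u hu
    rw [Matrix.conjTranspose_mul, Matrix.conjTranspose_mul, Matrix.diagonal_conjTranspose,
      Matrix.conjTranspose_conjTranspose, Matrix.mul_assoc]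
    congr 3
    funext i; exact hu i
  have hfr : ∀ i, star (f i) = f i := fun i => Complex.conj_ofReal _
  have hgr : ∀ i, star (g i) = g i := fun i => Complex.conj_ofReal _
  have hhr : ∀ i, star (h i) = h i := fun i => by simp only [h]; split_ifs <;> simp
  have hff : ∀ i, f i * f i = (l i : ℂ) := fun i => by
    simp only [f]; rw [← Complex.ofReal_mul, Real.mul_self_sqrt (hl0 i)]
  have hfg : ∀ i, f i * g i = h i := fun i => by
    simp only [f, g, h]; rw [← Complex.ofReal_mul]
    split_ifs with h0
    · simp [h0]
    · rw [mul_inv_cancel₀, Complex.ofReal_one]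
      exact (Real.sqrt_pos.mpr (lt_of_le_of_ne (hl0 i) (Ne.symm h0))).ne'
  have hfh : ∀ i, f i * h i = f i := fun i => by
    simp only [f, h]; split_ifs with h0 <;> simp [h0]
  have hhh : ∀ i, h i * h i = h i := fun i => by
    simp only [h]; split_ifs with h0 <;> simp
  have hglg : ∀ i, g i * (l i : ℂ) * g i = h i := fun i => by
    rw [← hff, ← hfg, show g i * (f i * f i) * g i = (f i * g i) * (f i * g i) by ring, hfg, hhh]
  have hlh : ∀ i, (l i : ℂ) * (1 - h i) = 0 := fun i => by
    simp only [h]; split_ifs with h0 <;> simp [h0]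
  have hPH := keyH h hhr
  set P := U * diagonal h * Uᴴ with hP
  have hone : (1 : Matrix m m ℂ) - P = U * diagonal (fun i => 1 - h i) * Uᴴ := by
    have : (1 : Matrix m m ℂ) = U * diagonal (fun _ => (1:ℂ)) * Uᴴ := by simp [hU2]
    rw [this, hP, ← Matrix.sub_mul, ← Matrix.mul_sub, Matrix.diagonal_sub]
  have hPX : P * X = X := by
    have h0 : ((1 - P) * X) * ((1 - P) * X)ᴴ = 0 := by
      rw [Matrix.conjTranspose_mul, show (1 - P) * X * (Xᴴ * (1 - P)ᴴ) =
        (1 - P) * ((X * Xᴴ) * (1 - P)ᴴ) by simp only [Matrix.mul_assoc], Matrix.conjTranspose_sub,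
        hPH, Matrix.conjTranspose_one, hone, hU3, key]
      simp [hlh]
    have := Matrix.self_mul_conjTranspose_eq_zero.mp h0
    rw [Matrix.sub_mul, Matrix.one_mul, sub_eq_zero] at this
    exact this.symm
  set B := U * diagonal g * Uᴴ with hB
  have hBH := keyH g hgr
  have hVV : (B * X) * (B * X)ᴴ = P := by
    rw [Matrix.conjTranspose_mul, show B * X * (Xᴴ * Bᴴ) =
        (B * (X * Xᴴ)) * Bᴴ by simp only [Matrix.mul_assoc], hBH, hU3, hB, key, key]
    simp [hglg, hP]
  have hPP : P * P = P := by rw [hP, key]; simp [hhh]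
  have hPB : P * B = B := by
    rw [hP, hB, key]; congr 3; funext i
    simp only [g, h]; split_ifs with h0 <;> simp [h0]
  refine ⟨U * diagonal f * Uᴴ, B * X, ?_, ?_, ?_, ?_, ?_, ?_⟩
  · apply Matrix.PosSemidef.mul_mul_conjTranspose_same
    apply Matrix.PosSemidef.diagonal
    intro i
    simp only [f, Pi.zero_apply]
    exact Complex.zero_le_real.mpr (Real.sqrt_nonneg _)
  · rw [key, hU3]; simp [hff]
  · rw [← Matrix.mul_assoc, hB, key]
    simp only [hfg]
    exact hPX.symm
  · rw [hVV, hP, key]; simp [hfh]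
  · apply psd_of_idem
    · simp [Matrix.conjTranspose_mul, Matrix.mul_assoc]
    · calc _ = (B * X)ᴴ * (((B * X) * (B * X)ᴴ) * (B * X)) := by simp only [Matrix.mul_assoc]
        _ = _ := by rw [hVV, ← Matrix.mul_assoc P, hPB]
  · rw [hVV]; exact psd_of_idem P hPH hPP

/-- Powers–Størmer type inequality. -/
lemma powers_stormer (a b : Matrix m m ℂ) (ha : a.PosSemidef) (hb : b.PosSemidef) :
    fsq (a - b) ^ 2 ≤ Fintype.card m * fsq (a * a - b * b) := by
  have hD : (a - b).IsHermitian := ha.1.sub hb.1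
  obtain ⟨U, hU1, hU2, hU3⟩ := spec (a - b) hD
  set l := hD.eigenvalues
  set a' := Uᴴ * a * U
  set b' := Uᴴ * b * U
  have ha' : a'.PosSemidef := ha.conjTranspose_mul_mul_same U
  have hb' : b'.PosSemidef := hb.conjTranspose_mul_mul_same U
  have hd : a' - b' = diagonal (fun i => (l i : ℂ)) := by
    calc a' - b' = Uᴴ * (a - b) * U := by simp only [a', b', Matrix.mul_sub, Matrix.sub_mul]
      _ = (Uᴴ * U) * diagonal (fun i => (l i : ℂ)) * (Uᴴ * U) := by
        rw [hU3]; simp only [Matrix.mul_assoc]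
      _ = _ := by rw [hU1]; simp
  have hM : a' * a' - b' * b' = Uᴴ * (a * a - b * b) * U := by
    have h1 : ∀ c : Matrix m m ℂ, (Uᴴ * c * U) * (Uᴴ * c * U) = Uᴴ * (c * c) * U := fun c => by
      calc _ = Uᴴ * c * (U * Uᴴ) * c * U := by simp only [Matrix.mul_assoc]
        _ = _ := by rw [hU2]; simp [Matrix.mul_assoc]
    rw [h1, h1]; simp only [Matrix.mul_sub, Matrix.sub_mul]
  have hinv : fsq (a * a - b * b) ≥ fsq (a' * a' - b' * b') := by
    rw [hM]
    refine (fsq_mul_le' _ _ (by rw [hU2, sub_self]; exact Matrix.PosSemidef.zero)).trans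
      (fsq_mul_le _ _ (by rw [Matrix.conjTranspose_conjTranspose, hU2, sub_self]
                          exact Matrix.PosSemidef.zero))
  have hfd : fsq (a - b) = ∑ i, l i ^ 2 := by
    have : ((fsq (a - b) : ℝ) : ℂ) = ((∑ i, l i ^ 2 : ℝ) : ℂ) := by
      rw [fsq_trace, hD.eq, hU3, show U * diagonal (fun i => (l i : ℂ)) * Uᴴ *
        (U * diagonal (fun i => (l i : ℂ)) * Uᴴ) = U * (diagonal (fun i => (l i : ℂ)) * ((Uᴴ * U) *
        diagonal (fun i => (l i : ℂ)))) * Uᴴ by simp only [Matrix.mul_assoc], hU1, Matrix.one_mul,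
        Matrix.trace_mul_comm, ← Matrix.mul_assoc, hU1, Matrix.one_mul,
        Matrix.diagonal_mul_diagonal, Matrix.trace_diagonal]
      push_cast
      exact Finset.sum_congr rfl fun i _ => by ring
    exact_mod_cast this
  set M := a' * a' - b' * b' with hMdef
  have hdiag : ∀ i, M i i = (l i : ℂ) * (a' i i + b' i i) := by
    intro i
    have e : M + M = (a' - b') * (a' + b') + (a' + b') * (a' - b') := by
      simp only [hMdef, Matrix.mul_sub, Matrix.sub_mul, Matrix.mul_add, Matrix.add_mul]; abel
    have := congrFun (congrFun e i) i
    rw [hd] at this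
    simp only [Matrix.add_apply, Matrix.diagonal_mul, Matrix.mul_diagonal] at this
    linear_combination this / 2
  have hle : ∀ i, l i ^ 2 ≤ ‖M i i‖ := by
    intro i
    have h1 := ha'.diag_nonneg (i := i)
    have h2 := hb'.diag_nonneg (i := i)
    have h3 : a' i i - b' i i = l i := by
      have := congrFun (congrFun hd i) i
      simpa using this
    obtain ⟨x, hx⟩ : ∃ x : ℝ, a' i i = x := ⟨_, (Complex.eq_re_of_ofReal_le h1)⟩
    obtain ⟨y, hy⟩ : ∃ y : ℝ, b' i i = y := ⟨_, (Complex.eq_re_of_ofReal_le h2)⟩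
    rw [hx] at h1 h3; rw [hy] at h2 h3
    have h1' := Complex.zero_le_real.mp h1
    have h2' := Complex.zero_le_real.mp h2
    have h3' : x - y = l i := by exact_mod_cast h3
    rw [hdiag, hx, hy, ← Complex.ofReal_add, ← Complex.ofReal_mul, Complex.norm_real,
      Real.norm_eq_abs, abs_mul, abs_of_nonneg (add_nonneg h1' h2'), ← sq_abs, sq]
    apply mul_le_mul_of_nonneg_left _ (abs_nonneg _)
    rw [← h3', abs_le]; constructor <;> linarith
  calc fsq (a - b) ^ 2 ≤ (∑ i, 1 * ‖M i i‖) ^ 2 := by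
        rw [hfd]
        apply pow_le_pow_left₀ (Finset.sum_nonneg fun i _ => sq_nonneg _)
        exact Finset.sum_le_sum fun i _ => by rw [one_mul]; exact hle i
    _ ≤ (∑ i : m, 1 ^ 2) * (∑ i, ‖M i i‖ ^ 2) := Finset.sum_mul_sq_le_sq_mul_sq _ _ _
    _ = Fintype.card m * (∑ i, ‖M i i‖ ^ 2) := by simp
    _ ≤ Fintype.card m * fsq M := by
        apply mul_le_mul_of_nonneg_left _ (Nat.cast_nonneg _)
        refine Finset.sum_le_sum fun i _ => ?_
        rw [Complex.sq_norm]
        exact Finset.single_le_sum (f := fun j => Complex.normSq (M i j))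
          (fun j _ => Complex.normSq_nonneg _) (Finset.mem_univ i)
    _ ≤ _ := by
        apply mul_le_mul_of_nonneg_left hinv (Nat.cast_nonneg _)

/-- Uhlmann-type lemma. -/
lemma uhlmann (X : Matrix m n ℂ) (Y : Matrix m p ℂ) :
    ∃ W : Matrix p n ℂ, (1 - W * Wᴴ).PosSemidef ∧
      fsq (Y * W - X) ^ 2 ≤ Fintype.card m * fsq (Y * Yᴴ - X * Xᴴ) := by
  obtain ⟨a, V, ha, haa, hX, haV, hV1, hV2⟩ := polar X
  obtain ⟨b, V', hb, hbb, hY, hbV, hV1', hV2'⟩ := polar Y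
  refine ⟨V'ᴴ * V, ?_, ?_⟩
  · have := psd_mul Vᴴ V' (by simpa using hV2) hV1'
    simpa [Matrix.conjTranspose_mul, Matrix.mul_assoc] using this
  · have e : Y * (V'ᴴ * V) - X = (b - a) * V := by
      rw [Matrix.sub_mul, ← hX, ← Matrix.mul_assoc]
      congr 1
      conv_lhs => rw [hY]
      rw [Matrix.mul_assoc b, hbV]
    rw [e, ← haa, ← hbb]
    refine le_trans ?_ (powers_stormer b a hb ha)
    exact pow_le_pow_left₀ (fsq_nonneg _) (fsq_mul_le' _ _ hV2) 2
end polar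

lemma traceNorm_le {m J : Type*} [Fintype m] [DecidableEq m] [Fintype J] [DecidableEq J]
    (X Y : Matrix m J ℂ) (hX : fsq X ≤ 1) (hY : fsq Y ≤ 1) :
    traceNorm (X * Xᴴ - Y * Yᴴ) ^ 2 ≤ 4 * fsq (X - Y) := by
  have hH : (X * Xᴴ - Y * Yᴴ).IsHermitian :=
    (Matrix.isHermitian_mul_conjTranspose_self X).sub (Matrix.isHermitian_mul_conjTranspose_self Y)
  rw [traceNorm, dif_pos hH]
  obtain ⟨U, hU1, hU2, hU3⟩ := spec _ hH
  set l := hH.eigenvalues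
  set X' := Uᴴ * X
  set Y' := Uᴴ * Y
  have hc : (1 - Uᴴᴴ * Uᴴ).PosSemidef := by
    rw [Matrix.conjTranspose_conjTranspose, hU2, sub_self]; exact Matrix.PosSemidef.zero
  have hX' : fsq X' ≤ 1 := (fsq_mul_le _ _ hc).trans hX
  have hY' : fsq Y' ≤ 1 := (fsq_mul_le _ _ hc).trans hY
  have hXY : fsq (X' - Y') ≤ fsq (X - Y) := by
    rw [← Matrix.mul_sub]; exact fsq_mul_le _ _ hc
  have hd : X' * X'ᴴ - Y' * Y'ᴴ = diagonal (fun i => (l i : ℂ)) := by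
    calc X' * X'ᴴ - Y' * Y'ᴴ = Uᴴ * (X * Xᴴ - Y * Yᴴ) * U := by
          simp only [X', Y', Matrix.mul_sub, Matrix.sub_mul, Matrix.conjTranspose_mul,
            Matrix.conjTranspose_conjTranspose, Matrix.mul_assoc]
      _ = (Uᴴ * U) * diagonal (fun i => (l i : ℂ)) * (Uᴴ * U) := by
        rw [hU3]; simp only [Matrix.mul_assoc]
      _ = _ := by rw [hU1]; simp
  have hl : ∀ i, l i = ∑ j, (Complex.normSq (X' i j) - Complex.normSq (Y' i j)) := by
    intro i
    have := congrFun (congrFun hd i) i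
    rw [Matrix.sub_apply, Matrix.mul_apply, Matrix.mul_apply, Matrix.diagonal_apply_eq] at this
    have h2 : ((l i : ℝ) : ℂ) =
        ((∑ j, (Complex.normSq (X' i j) - Complex.normSq (Y' i j)) : ℝ) : ℂ) := by
      rw [← this]
      push_cast
      rw [Finset.sum_sub_distrib]
      congr 1 <;> exact Finset.sum_congr rfl fun j _ => by rw [← Complex.mul_conj]; rfl
    exact_mod_cast h2
  have hab : ∀ a b : ℂ, |Complex.normSq a - Complex.normSq b| ≤ ‖a - b‖ * (‖a‖ + ‖b‖) := by
    intro a b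
    rw [Complex.normSq_eq_norm_sq, Complex.normSq_eq_norm_sq, sq_sub_sq, abs_mul, mul_comm,
      abs_of_nonneg (add_nonneg (norm_nonneg a) (norm_nonneg b))]
    exact mul_le_mul_of_nonneg_right (abs_norm_sub_norm_le a b) (by positivity)
  have h1 : ∑ i, |l i| ≤ ∑ z : m × J, ‖X' z.1 z.2 - Y' z.1 z.2‖ * (‖X' z.1 z.2‖ + ‖Y' z.1 z.2‖) := by
    rw [Fintype.sum_prod_type]
    refine Finset.sum_le_sum fun i _ => ?_
    rw [hl]
    exact (Finset.abs_sum_le_sum_abs _ _).trans (Finset.sum_le_sum fun j _ => hab _ _)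
  calc (∑ i, |l i|) ^ 2 ≤ _ := pow_le_pow_left₀ (Finset.sum_nonneg fun i _ => abs_nonneg _) h1 2
    _ ≤ (∑ z : m × J, ‖X' z.1 z.2 - Y' z.1 z.2‖ ^ 2) *
        (∑ z : m × J, (‖X' z.1 z.2‖ + ‖Y' z.1 z.2‖) ^ 2) := Finset.sum_mul_sq_le_sq_mul_sq _ _ _
    _ ≤ fsq (X' - Y') * 4 := by
        apply mul_le_mul
        · rw [Fintype.sum_prod_type, fsq]
          simp only [Complex.normSq_eq_norm_sq, Matrix.sub_apply]
          exact le_refl _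
        · calc _ ≤ ∑ z : m × J, (2 * ‖X' z.1 z.2‖ ^ 2 + 2 * ‖Y' z.1 z.2‖ ^ 2) :=
                Finset.sum_le_sum fun z _ => by
                  nlinarith [sq_nonneg (‖X' z.1 z.2‖ - ‖Y' z.1 z.2‖)]
            _ = 2 * fsq X' + 2 * fsq Y' := by
                rw [Finset.sum_add_distrib, ← Finset.mul_sum, ← Finset.mul_sum,
                  Fintype.sum_prod_type, Fintype.sum_prod_type]
                simp only [fsq, Complex.normSq_eq_norm_sq]
            _ ≤ 4 := by linarith
        · positivity
        · exact fsq_nonneg _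
    _ ≤ 4 * fsq (X - Y) := by linarith

lemma psd_sqrt {i : Type*} [Fintype i] [DecidableEq i] (A : Matrix i i ℂ) (hA : A.PosSemidef) :
    ∃ S : Matrix i i ℂ, Sᴴ * S = A := by
  obtain ⟨U, hU1, hU2, hU3⟩ := spec A hA.1
  refine ⟨diagonal (fun j => ((Real.sqrt (hA.1.eigenvalues j) : ℝ) : ℂ)) * Uᴴ, ?_⟩
  conv_rhs => rw [hU3]
  rw [Matrix.conjTranspose_mul, Matrix.conjTranspose_conjTranspose, Matrix.diagonal_conjTranspose,
    Matrix.mul_assoc, ← Matrix.mul_assoc (diagonal _) (diagonal _), Matrix.diagonal_mul_diagonal,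
    ← Matrix.mul_assoc]
  congr 3
  funext j
  simp only [Pi.star_apply, Complex.star_def, Complex.conj_ofReal]
  rw [← Complex.ofReal_mul, Real.mul_self_sqrt (hA.eigenvalues_nonneg j)]

lemma complete {J o i : Type*} [Fintype J] [Fintype o] [Fintype i] [DecidableEq o] [DecidableEq i]
    (o0 : o) (C : J → Matrix o i ℂ) (hC : (1 - ∑ j, (C j)ᴴ * C j).PosSemidef) :
    ∃ L : i → Matrix o i ℂ, ∑ j : J ⊕ i, (Sum.elim C L j)ᴴ * (Sum.elim C L j) = 1 := by
  obtain ⟨S, hS⟩ := psd_sqrt _ hC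
  refine ⟨fun l => Matrix.of fun o' i' => if o' = o0 then S l i' else 0, ?_⟩
  rw [Fintype.sum_sum_type]
  simp only [Sum.elim_inl, Sum.elim_inr]
  have h : ∑ l : i, (Matrix.of fun (o' : o) (i' : i) => if o' = o0 then S l i' else 0)ᴴ *
      (Matrix.of fun (o' : o) (i' : i) => if o' = o0 then S l i' else 0) = Sᴴ * S := by
    ext a b
    rw [Matrix.sum_apply, Matrix.mul_apply]
    refine Finset.sum_congr rfl fun l _ => ?_
    rw [Matrix.mul_apply, Finset.sum_eq_single o0]
    · simp [Matrix.conjTranspose_apply]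
    · intro x _ hx; simp [hx]
    · intro hx; exact absurd (Finset.mem_univ _) hx
  rw [h, hS]
  abel

lemma kraus_norm {J o i : Type*} [Fintype J] [Fintype o] [Fintype i] [DecidableEq i]
    (K : J → Matrix o i ℂ) (hK : ∑ j, (K j)ᴴ * K j = 1) (v : i → ℂ) :
    ∑ j, ∑ a, Complex.normSq (∑ b, K j a b * v b) = ∑ b, Complex.normSq (v b) := by
  have h1 : ∀ j, ∑ a, Complex.normSq (∑ b, K j a b * v b) =
      fsq (K j * Matrix.of fun b (_ : Unit) => v b) := by
    intro j
    simp [fsq, Matrix.mul_apply]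
  have h2 : ∑ b, Complex.normSq (v b) = fsq (Matrix.of fun b (_ : Unit) => v b) := by
    simp [fsq]
  rw [h2]
  simp only [h1]
  have : ((∑ j, fsq (K j * Matrix.of fun b (_ : Unit) => v b) : ℝ) : ℂ) =
      ((fsq (Matrix.of fun b (_ : Unit) => v b) : ℝ) : ℂ) := by
    push_cast
    simp only [fsq_trace]
    rw [← Matrix.trace_sum]
    congr 1
    calc _ = (Matrix.of fun b (_ : Unit) => v b)ᴴ * (∑ j, (K j)ᴴ * K j) *
          (Matrix.of fun b (_ : Unit) => v b) := by
          rw [Matrix.mul_sum, Matrix.sum_mul]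
          refine Finset.sum_congr rfl fun j _ => ?_
          rw [Matrix.conjTranspose_mul]; simp only [Matrix.mul_assoc]
      _ = _ := by rw [hK, Matrix.mul_one]
  exact_mod_cast this

lemma good_bad {m J : Type*} [Fintype m] [Fintype J] (X Y : Matrix m J ℂ) (g : J → Prop)
    [DecidablePred g] (hb : ∀ j, ¬ g j → ∀ z, Y z j = 0) (hX : fsq X ≤ 1) (hY : fsq Y = 1)
    (γ t : ℝ) (ht : 0 < t)
    (hγ : ∑ z, ∑ j, (if g j then Complex.normSq (X z j - Y z j) else 0) ≤ γ) :
    fsq (X - Y) ≤ t + (2 + 1 / t) * γ := by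
  have hp : ∀ z j, Complex.normSq (X z j - Y z j) ≤ (1 + t) * Complex.normSq (X z j)
      - Complex.normSq (Y z j) +
      (2 + 1 / t) * (if g j then Complex.normSq (X z j - Y z j) else 0) := by
    intro z j
    split_ifs with h
    · have key : ∀ a b : ℝ, b ^ 2 ≤ (1 + t) * a ^ 2 + (1 + 1 / t) * (a - b) ^ 2 := by
        intro a b
        have : (1 + t) * a ^ 2 + (1 + 1 / t) * (a - b) ^ 2 - b ^ 2 =
            (t * a + (a - b)) ^ 2 / t := by
          field_simp; ring
        have h0 : 0 ≤ (t * a + (a - b)) ^ 2 / t := by positivity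
        linarith
      have k1 := key (X z j).re (Y z j).re
      have k2 := key (X z j).im (Y z j).im
      simp only [Complex.normSq_apply, Complex.sub_re, Complex.sub_im]
      nlinarith
    · rw [hb j h z]
      have := Complex.normSq_nonneg (X z j)
      simp
      nlinarith
  have : fsq (X - Y) ≤ (1 + t) * fsq X - fsq Y +
      (2 + 1 / t) * ∑ z, ∑ j, (if g j then Complex.normSq (X z j - Y z j) else 0) := by
    simp only [fsq, Finset.mul_sum, ← Finset.sum_sub_distrib, ← Finset.sum_add_distrib,
      Matrix.sub_apply]
    exact Finset.sum_le_sum fun z _ => Finset.sum_le_sum fun j _ => hp z j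
  have h3 : (2 + 1 / t) * ∑ z, ∑ j, (if g j then Complex.normSq (X z j - Y z j) else 0) ≤
      (2 + 1 / t) * γ := mul_le_mul_of_nonneg_left hγ (by positivity)
  nlinarith

/-- Output vector. -/
noncomputable def xv {Rn Bn An Qn Kn : Type*} [Fintype An] [Fintype Qn] [Fintype Kn]
    (c : ℂ) (D : Matrix Bn (Qn × Kn) ℂ) (E : Matrix Qn (An × Kn) ℂ) (ψ : Rn → An → ℂ)
    (z : Rn × Bn) : ℂ :=
  ∑ a, c * (∑ qq, ∑ i, D z.2 (qq, i) * E qq (a, i)) * ψ z.1 a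

lemma xv_eq {Rn Bn An Qn Kn : Type*} [Fintype An] [Fintype Qn] [Fintype Kn]
    (c : ℂ) (D : Matrix Bn (Qn × Kn) ℂ) (E : Matrix Qn (An × Kn) ℂ) (ψ : Rn → An → ℂ)
    (r : Rn) (b : Bn) : xv c D E ψ (r, b) =
      ∑ x : Qn × Kn, D b x * (c * ∑ a, E x.1 (a, x.2) * ψ r a) := by
  simp only [xv, Fintype.sum_prod_type, Finset.mul_sum, Finset.sum_mul]
  rw [Finset.sum_comm]
  refine Finset.sum_congr rfl fun q _ => ?_
  rw [Finset.sum_comm]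
  refine Finset.sum_congr rfl fun i _ => ?_
  refine Finset.sum_congr rfl fun a _ => ?_
  ring

lemma xv_norm {Rn Bn An JE JD : Type*} [Fintype Rn] [Fintype Bn] [Fintype An] [DecidableEq An]
    [Fintype JE] [Fintype JD] {q k : ℕ} (hk : 0 < k)
    (E : JE → Matrix (Fin q) (An × Fin k) ℂ) (D : JD → Matrix Bn (Fin q × Fin k) ℂ)
    (hE : ∑ j, (E j)ᴴ * E j = 1) (hD : ∑ j, (D j)ᴴ * D j = 1)
    (ψ : Rn → An → ℂ) (hψ : ∑ r, ∑ a, Complex.normSq (ψ r a) = 1) :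
    ∑ z : Rn × Bn, ∑ j : JE × JD,
      Complex.normSq (xv (((Real.sqrt k)⁻¹ : ℝ) : ℂ) (D j.2) (E j.1) ψ z) = 1 := by
  set c : ℂ := (((Real.sqrt k)⁻¹ : ℝ) : ℂ) with hc
  have hck : Complex.normSq c = (k : ℝ)⁻¹ := by
    rw [hc, Complex.normSq_ofReal, ← mul_inv, Real.mul_self_sqrt (Nat.cast_nonneg k)]
  have h1 : ∀ r, ∑ b, ∑ j : JE × JD, Complex.normSq (xv c (D j.2) (E j.1) ψ (r, b)) =
      ∑ a, Complex.normSq (ψ r a) := by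
    intro r
    rw [Finset.sum_comm, Fintype.sum_prod_type]
    simp only [xv_eq]
    have h2 : ∀ j1, ∑ j2, ∑ b, Complex.normSq (∑ x : Fin q × Fin k, D j2 b x *
        (c * ∑ a, E j1 x.1 (a, x.2) * ψ r a)) =
        ∑ x : Fin q × Fin k, Complex.normSq (c * ∑ a, E j1 x.1 (a, x.2) * ψ r a) :=
      fun j1 => kraus_norm D hD _
    rw [Finset.sum_congr rfl fun j1 _ => h2 j1]
    simp only [Complex.normSq_mul, hck, Fintype.sum_prod_type_right]
    rw [Finset.sum_comm]
    have h3 : ∀ i : Fin k, ∑ j1, ∑ qq, (k : ℝ)⁻¹ *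
        Complex.normSq (∑ a, E j1 qq (a, i) * ψ r a) =
        (k : ℝ)⁻¹ * ∑ a, Complex.normSq (ψ r a) := by
      intro i
      simp only [← Finset.mul_sum]
      congr 1
      have := kraus_norm E hE (fun x => if x.2 = i then ψ r x.1 else 0)
      simp only [Fintype.sum_prod_type, mul_ite, mul_zero, Finset.sum_ite_eq', Finset.mem_univ,
        if_true, apply_ite Complex.normSq, map_zero] at this
      exact this
    rw [Finset.sum_congr rfl fun i _ => h3 i]
    simp only [Finset.sum_const, Finset.card_univ, Fintype.card_fin, nsmul_eq_mul]
    rw [← mul_assoc, mul_inv_cancel₀ (by exact_mod_cast hk.ne'), one_mul]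
  rw [Fintype.sum_prod_type]
  simp only [h1, hψ]

/-- Assemble a protocol out of contractions. -/
lemma assemble {Rn Bn An En : Type} [Fintype Rn] [Fintype Bn] [Fintype An] [Fintype En]
    [DecidableEq Rn] [DecidableEq Bn] [DecidableEq An] [DecidableEq En] [Nonempty Bn]
    {q k : ℕ} (hk : 0 < k) (hq : 0 < q)
    (E0 : En → Matrix (Fin q) (An × Fin k) ℂ) (D0 : Matrix Bn (Fin q × Fin k) ℂ)
    (hE : (1 - ∑ j, (E0 j)ᴴ * E0 j).PosSemidef) (hD : (1 - D0ᴴ * D0).PosSemidef)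
    (ψ : Rn → An → ℂ) (hψ : ∑ r, ∑ a, Complex.normSq (ψ r a) = 1)
    (w : Rn × Bn → En → ℂ) (hw : ∑ z, ∑ e, Complex.normSq (w z e) = 1) (γ t : ℝ) (ht : 0 < t)
    (hγ : ∑ z, ∑ e, Complex.normSq (xv (((Real.sqrt k)⁻¹ : ℝ) : ℂ) D0 (E0 e) ψ z - w z e) ≤ γ) :
    ∃ (JE JD : Type) (_ : Fintype JE) (_ : Fintype JD)
      (E : JE → Matrix (Fin q) (An × Fin k) ℂ)
      (D : JD → Matrix Bn (Fin q × Fin k) ℂ),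
      (∑ j, (E j)ᴴ * E j = 1) ∧ (∑ j, (D j)ᴴ * D j = 1) ∧
      traceNorm (Matrix.of fun z z' : Rn × Bn =>
        (∑ j1 : JE, ∑ j2 : JD, xv (((Real.sqrt k)⁻¹ : ℝ) : ℂ) (D j2) (E j1) ψ z *
          conj (xv (((Real.sqrt k)⁻¹ : ℝ) : ℂ) (D j2) (E j1) ψ z')) -
        ∑ e, w z e * conj (w z' e)) ^ 2 ≤ 4 * (t + (2 + 1 / t) * γ) := by
  obtain ⟨L, hL⟩ := complete (⟨0, hq⟩ : Fin q) E0 hE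
  obtain ⟨L', hL'⟩ := complete (Classical.arbitrary Bn) (fun _ : Unit => D0) (by simpa using hD)
  refine ⟨En ⊕ (An × Fin k), Unit ⊕ (Fin q × Fin k), inferInstance, inferInstance,
    Sum.elim E0 L, Sum.elim (fun _ : Unit => D0) L', hL, hL', ?_⟩
  set E := Sum.elim E0 L
  set D := Sum.elim (fun _ : Unit => D0) L'
  set c : ℂ := (((Real.sqrt k)⁻¹ : ℝ) : ℂ)
  let X : Matrix (Rn × Bn) ((En ⊕ (An × Fin k)) × (Unit ⊕ (Fin q × Fin k))) ℂ :=
    Matrix.of fun z j => xv c (D j.2) (E j.1) ψ z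
  let Y : Matrix (Rn × Bn) ((En ⊕ (An × Fin k)) × (Unit ⊕ (Fin q × Fin k))) ℂ :=
    Matrix.of fun z j => Sum.elim (fun e => Sum.elim (fun _ => w z e) (fun _ => 0) j.2)
      (fun _ => 0) j.1
  let g : ((En ⊕ (An × Fin k)) × (Unit ⊕ (Fin q × Fin k))) → Prop :=
    fun j => j.1.isLeft = true ∧ j.2.isLeft = true
  have hX : fsq X = 1 := xv_norm hk E D hL hL' ψ hψ
  have hY : fsq Y = 1 := by
    simp only [fsq, Y, Matrix.of_apply, Fintype.sum_prod_type (f := fun j :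
      ((En ⊕ (An × Fin k)) × (Unit ⊕ (Fin q × Fin k))) => _), Fintype.sum_sum_type, Sum.elim_inl,
      Sum.elim_inr]
    simpa using hw
  have hgb := good_bad X Y g (by
      rintro ⟨j1 | j1, j2 | j2⟩ h z <;> simp [g, Y] at h ⊢) hX.le hY γ t ht (by
      refine le_trans (le_of_eq ?_) hγ
      refine Finset.sum_congr rfl fun z _ => ?_
      rw [Fintype.sum_prod_type]
      simp [Fintype.sum_sum_type, g, X, Y, E, D])
  have := traceNorm_le X Y hX.le hY.le
  have hM : (Matrix.of fun z z' : Rn × Bn =>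
        (∑ j1, ∑ j2, xv c (D j2) (E j1) ψ z * conj (xv c (D j2) (E j1) ψ z')) -
        ∑ e, w z e * conj (w z' e)) = X * Xᴴ - Y * Yᴴ := by
    ext z z'
    rw [Matrix.sub_apply, Matrix.mul_apply, Matrix.mul_apply, Fintype.sum_prod_type,
      Fintype.sum_prod_type]
    simp only [Matrix.of_apply, X, Matrix.conjTranspose_apply]
    congr 1
    simp [Fintype.sum_sum_type, Y]
  rw [hM]
  refine this.trans ?_
  linarith

section phases
variable {X : Type*} [Fintype X] [DecidableEq X]

/-- random cubic phases -/
noncomputable def ph (s : X → ZMod 3) (x : X) : ℂ := ZMod.stdAddChar (s x)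

lemma ph_conj (s : X → ZMod 3) (x : X) : ph s x * conj (ph s x) = 1 := by
  simp only [ph]
  rw [← AddChar.map_neg_eq_conj, ← AddChar.map_add_eq_mul, add_neg_cancel, AddChar.map_zero_eq_one]

lemma phase_sum (x y x' y' : X) :
    ∑ s : X → ZMod 3, (ph s x * conj (ph s y)) * conj (ph s x' * conj (ph s y')) =
      if (x = y ∧ x' = y') ∨ (x = x' ∧ y = y') then (Fintype.card (X → ZMod 3) : ℂ) else 0 := by
  let φ : (X → ZMod 3) →+ ZMod 3 :=
    { toFun := fun s => s x - s y - (s x' - s y')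
      map_zero' := by simp
      map_add' := fun s t => by simp only [Pi.add_apply]; ring }
  have h1 : ∀ s : X → ZMod 3, (ph s x * conj (ph s y)) * conj (ph s x' * conj (ph s y')) =
      (ZMod.stdAddChar (N := 3)).compAddMonoidHom φ s := by
    intro s
    simp only [ph, AddChar.compAddMonoidHom_apply, map_mul, Complex.conj_conj,
      ← AddChar.map_neg_eq_conj, ← AddChar.map_add_eq_mul]
    congr 1
    simp only [φ, AddMonoidHom.coe_mk, ZeroHom.coe_mk]
    ring
  simp only [h1]
  split_ifs with h
  · have h2 : ∀ s, (ZMod.stdAddChar (N := 3)).compAddMonoidHom φ s = 1 := by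
      intro s
      rw [AddChar.compAddMonoidHom_apply]
      have : φ s = 0 := by
        simp only [φ, AddMonoidHom.coe_mk, ZeroHom.coe_mk]
        rcases h with ⟨rfl, rfl⟩ | ⟨rfl, rfl⟩ <;> ring
      rw [this, AddChar.map_zero_eq_one]
    simp [h2]
  · apply AddChar.sum_eq_zero_of_ne_one
    intro hone
    have h3 : ∀ s, φ s = 0 := by
      intro s
      have := DFunLike.congr_fun hone s
      rw [AddChar.compAddMonoidHom_apply, AddChar.one_apply] at this
      exact ZMod.injective_stdAddChar (this.trans (AddChar.map_zero_eq_one _).symm)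
    have e1 := h3 (Pi.single x 1)
    have e2 := h3 (Pi.single y 1)
    have e3 := h3 (Pi.single x' 1)
    simp only [φ, AddMonoidHom.coe_mk, ZeroHom.coe_mk, Pi.single_apply] at e1 e2 e3
    have d1 : (1 : ZMod 3) ≠ 0 := by decide
    have d2 : (1 : ZMod 3) + 1 ≠ 0 := by decide
    by_cases a : x = y
    · subst a
      have b : x' ≠ y' := fun b => h (Or.inl ⟨rfl, b⟩)
      simp [Ne.symm b] at e3
    · by_cases b : x = x'
      · subst b
        have c : y ≠ y' := fun c => h (Or.inr ⟨rfl, c⟩)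
        simp [Ne.symm a, Ne.symm c] at e2
      · by_cases c : y' = x
        · simp [Ne.symm a, Ne.symm b, c, d2] at e1
        · simp [Ne.symm a, Ne.symm b, c] at e1

lemma phase_moment (M : X → X → ℂ) :
    ∑ s : X → ZMod 3, Complex.normSq (∑ x, ∑ y, ph s x * conj (ph s y) * M x y) =
      (Fintype.card (X → ZMod 3) : ℝ) * (Complex.normSq (∑ x, M x x) +
        ∑ x, ∑ y, if x = y then 0 else Complex.normSq (M x y)) := by
  have main : ((∑ s : X → ZMod 3, Complex.normSq (∑ x, ∑ y, ph s x * conj (ph s y) * M x y) : ℝ) : ℂ)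
     = (((Fintype.card (X → ZMod 3) : ℝ) * (Complex.normSq (∑ x, M x x) +
        ∑ x, ∑ y, if x = y then 0 else Complex.normSq (M x y)) : ℝ) : ℂ) := by
    set N : ℂ := (Fintype.card (X → ZMod 3) : ℂ) with hN
    calc _ = ∑ s : X → ZMod 3, (∑ p : X × X, ph s p.1 * conj (ph s p.2) * M p.1 p.2) *
          conj (∑ p : X × X, ph s p.1 * conj (ph s p.2) * M p.1 p.2) := by
          push_cast
          refine Finset.sum_congr rfl fun s _ => ?_
          rw [← Complex.mul_conj, Fintype.sum_prod_type]
      _ = ∑ p : X × X, ∑ p' : X × X, (M p.1 p.2 * conj (M p'.1 p'.2)) *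
          ∑ s : X → ZMod 3, (ph s p.1 * conj (ph s p.2)) * conj (ph s p'.1 * conj (ph s p'.2)) := by
          simp only [map_sum, Finset.sum_mul_sum]
          simp only [Finset.mul_sum]
          rw [Finset.sum_comm]
          refine Finset.sum_congr rfl fun p _ => ?_
          rw [Finset.sum_comm]
          refine Finset.sum_congr rfl fun p' _ => ?_
          refine Finset.sum_congr rfl fun s _ => ?_
          simp only [map_mul]
          ring
      _ = ∑ p : X × X, ∑ p' : X × X, N * (((if p.1 = p.2 then M p.1 p.2 else 0) *
            conj (if p'.1 = p'.2 then M p'.1 p'.2 else 0)) +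
            (if p' = p then (if p.1 = p.2 then 0 else M p.1 p.2 * conj (M p.1 p.2)) else 0)) := by
          refine Finset.sum_congr rfl fun p _ => Finset.sum_congr rfl fun p' _ => ?_
          rw [phase_sum, ← hN]
          clear_value N
          obtain ⟨x, y⟩ := p
          obtain ⟨x', y'⟩ := p'
          simp only [Prod.mk.injEq]
          by_cases a : x = y
          · subst a
            by_cases b : x' = y'
            · subst b
              simp [mul_comm]
            · have : ¬ (x = x' ∧ x = y') := fun h => b (h.1.symm.trans h.2)
              simp [b, this]
          · by_cases b : x = x' ∧ y = y'
            · obtain ⟨rfl, rfl⟩ := b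
              simp [a, mul_comm]
            · have : ¬ (x' = x ∧ y' = y) := fun h => b ⟨h.1.symm, h.2.symm⟩
              simp [a, b, this]
      _ = N * ((∑ p : X × X, if p.1 = p.2 then M p.1 p.2 else 0) *
            conj (∑ p : X × X, if p.1 = p.2 then M p.1 p.2 else 0) +
            ∑ p : X × X, (if p.1 = p.2 then 0 else M p.1 p.2 * conj (M p.1 p.2))) := by
          simp only [← Finset.mul_sum, Finset.sum_add_distrib, map_sum, Finset.sum_mul_sum,
            Finset.sum_ite_eq', Finset.mem_univ, if_true]
      _ = _ := by
          simp only [Fintype.sum_prod_type, Finset.sum_ite_eq, Finset.mem_univ, if_true,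
            Complex.mul_conj]
          push_cast
          rw [hN]
          congr 2
          refine Finset.sum_congr rfl fun x _ => Finset.sum_congr rfl fun y _ => ?_
          split_ifs <;> simp
  exact_mod_cast main

lemma two_trans (x y x' y' : X) (h : x ≠ y) (h' : x' ≠ y') :
    ∃ τ : Equiv.Perm X, τ x = x' ∧ τ y = y' := by
  have hy : Equiv.swap x x' y ≠ x' := fun e => h (by
    have := (Equiv.swap x x').injective (e.trans (Equiv.swap_apply_left x x').symm); exact this.symm)
  refine ⟨(Equiv.swap x x').trans (Equiv.swap (Equiv.swap x x' y) y'), ?_, ?_⟩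
  · simp only [Equiv.trans_apply, Equiv.swap_apply_left]
    exact Equiv.swap_apply_of_ne_of_ne (Ne.symm hy) h'
  · simp only [Equiv.trans_apply, Equiv.swap_apply_left]

lemma perm_sum_two (f : X → X → ℂ) (x y : X) (h : x ≠ y) :
    ((Fintype.card X : ℂ) * (Fintype.card X - 1)) * ∑ π : Equiv.Perm X, f (π x) (π y) =
      (Fintype.card (Equiv.Perm X) : ℂ) * ∑ u, ∑ v, if u = v then 0 else f u v := by
  have h1 : ∀ u v : X, u ≠ v → ∑ π : Equiv.Perm X, f (π u) (π v) =
      ∑ π : Equiv.Perm X, f (π x) (π y) := by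
    intro u v huv
    obtain ⟨τ, h1, h2⟩ := two_trans x y u v h huv
    refine Fintype.sum_equiv (Equiv.mulRight τ) _ _ fun π => ?_
    simp [h1, h2]
  have h2 : ∑ u, ∑ v, (if u = v then 0 else ∑ π : Equiv.Perm X, f (π u) (π v)) =
      ((Fintype.card X : ℂ) * (Fintype.card X - 1)) * ∑ π : Equiv.Perm X, f (π x) (π y) := by
    have : ∀ u v : X, (if u = v then 0 else ∑ π : Equiv.Perm X, f (π u) (π v)) =
        (∑ π : Equiv.Perm X, f (π x) (π y)) -
          (if u = v then ∑ π : Equiv.Perm X, f (π x) (π y) else 0) := by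
      intro u v
      split_ifs with e
      · simp
      · rw [h1 u v e, sub_zero]
    simp only [this, Finset.sum_sub_distrib, Finset.sum_ite_eq, Finset.mem_univ, if_true,
      Finset.sum_const, Finset.card_univ, nsmul_eq_mul]
    ring
  rw [← h2]
  have h3 : ∀ u v : X, (if u = v then 0 else ∑ π : Equiv.Perm X, f (π u) (π v)) =
      ∑ π : Equiv.Perm X, (if π u = π v then 0 else f (π u) (π v)) := by
    intro u v
    split_ifs with e
    · simp [e]
    · refine Finset.sum_congr rfl fun π _ => ?_
      rw [if_neg (fun e' => e (π.injective e'))]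
  simp only [h3]
  have h4 : ∀ u, ∑ v, ∑ π : Equiv.Perm X, (if π u = π v then 0 else f (π u) (π v)) =
      ∑ π : Equiv.Perm X, ∑ v, (if π u = v then 0 else f (π u) v) := by
    intro u
    rw [Finset.sum_comm]
    exact Finset.sum_congr rfl fun π _ => Equiv.sum_comp π (fun v => if π u = v then 0 else f (π u) v)
  simp only [h4]
  rw [Finset.sum_comm]
  have h5 : ∀ π : Equiv.Perm X, ∑ u, ∑ v, (if π u = v then 0 else f (π u) v) =
      ∑ u, ∑ v, (if u = v then 0 else f u v) := fun π =>
    Equiv.sum_comp π (fun u => ∑ v, if u = v then 0 else f u v)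
  simp [h5]

lemma perm_sum_one (f : X → ℂ) (x : X) :
    (Fintype.card X : ℂ) * ∑ π : Equiv.Perm X, f (π x) =
      (Fintype.card (Equiv.Perm X) : ℂ) * ∑ u, f u := by
  have h1 : ∀ u : X, ∑ π : Equiv.Perm X, f (π u) = ∑ π : Equiv.Perm X, f (π x) := by
    intro u
    refine Fintype.sum_equiv (Equiv.mulRight (Equiv.swap x u)) _ _ fun π => ?_
    simp
  have h2 : ∑ u, ∑ π : Equiv.Perm X, f (π u) =
      (Fintype.card X : ℂ) * ∑ π : Equiv.Perm X, f (π x) := by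
    simp [h1]
  rw [← h2, Finset.sum_comm]
  have h5 : ∀ π : Equiv.Perm X, ∑ u, f (π u) = ∑ u, f u := fun π => Equiv.sum_comp π f
  simp [h5]

lemma perm_diag (c a : X → ℂ) (ha : ∑ u, a u = 0) (hd : 2 ≤ Fintype.card X) :
    (Fintype.card X : ℝ) * ∑ π : Equiv.Perm X, Complex.normSq (∑ x, c x * a (π x)) ≤
      2 * Fintype.card (Equiv.Perm X) * ((∑ x, Complex.normSq (c x)) *
        (∑ u, Complex.normSq (a u))) := by
  set d : ℝ := (Fintype.card X : ℝ) with hdd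
  set P : ℝ := (Fintype.card (Equiv.Perm X) : ℝ) with hP
  set A : ℝ := ∑ u, Complex.normSq (a u) with hA
  have hd2 : (2 : ℝ) ≤ d := by rw [hdd]; exact_mod_cast hd
  have hPn : 0 ≤ P := Nat.cast_nonneg _
  have hAn : 0 ≤ A := Finset.sum_nonneg fun _ _ => Complex.normSq_nonneg _
  have hAc : ∑ u, a u * conj (a u) = (A : ℂ) := by
    rw [hA]; push_cast; simp only [Complex.mul_conj]
  have hoff : ∑ u, ∑ v, (if u = v then 0 else a u * conj (a v)) = -(A : ℂ) := by
    have : ∀ u v, (if u = v then 0 else a u * conj (a v)) = a u * conj (a v) -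
        (if u = v then a u * conj (a v) else 0) := by
      intro u v; split_ifs <;> simp
    simp only [this, Finset.sum_sub_distrib, Finset.sum_ite_eq, Finset.mem_univ, if_true, hAc,
      ← Finset.mul_sum, ← map_sum, ha]
    simp
  have hin : ∀ x y, ((d : ℂ) * (d - 1)) * ∑ π : Equiv.Perm X, a (π x) * conj (a (π y)) =
      (P : ℂ) * A * ((if x = y then (d : ℂ) else 0) - 1) := by
    intro x y
    split_ifs with e
    · subst e
      have := perm_sum_one (fun u => a u * conj (a u)) x
      rw [hAc] at this
      have e1 : (d : ℂ) = (Fintype.card X : ℂ) := by rw [hdd]; simp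
      have e2 : (P : ℂ) = (Fintype.card (Equiv.Perm X) : ℂ) := by rw [hP]; simp
      rw [e1, e2]
      linear_combination ((Fintype.card X : ℂ) - 1) * this
    · have := perm_sum_two (fun u v => a u * conj (a v)) x y e
      rw [hoff] at this
      have e1 : (d : ℂ) = (Fintype.card X : ℂ) := by rw [hdd]; simp
      have e2 : (P : ℂ) = (Fintype.card (Equiv.Perm X) : ℂ) := by rw [hP]; simp
      rw [e1, e2, this]
      ring
  have hmain : d * (d - 1) * ∑ π : Equiv.Perm X, Complex.normSq (∑ x, c x * a (π x)) =
      P * A * (d * (∑ x, Complex.normSq (c x)) - Complex.normSq (∑ x, c x)) := by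
    have : ((d * (d - 1) * ∑ π : Equiv.Perm X, Complex.normSq (∑ x, c x * a (π x)) : ℝ) : ℂ) =
      ((P * A * (d * (∑ x, Complex.normSq (c x)) - Complex.normSq (∑ x, c x)) : ℝ) : ℂ) := by
      calc _ = ∑ x, ∑ y, c x * conj (c y) *
            (((d : ℂ) * (d - 1)) * ∑ π : Equiv.Perm X, a (π x) * conj (a (π y))) := by
            push_cast
            simp only [← Complex.mul_conj, map_sum, Finset.sum_mul_sum]
            simp only [Finset.mul_sum]
            rw [Finset.sum_comm]
            refine Finset.sum_congr rfl fun x _ => ?_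
            rw [Finset.sum_comm]
            refine Finset.sum_congr rfl fun y _ => ?_
            refine Finset.sum_congr rfl fun π _ => ?_
            simp only [map_mul]
            ring
        _ = ∑ x, ∑ y, (P : ℂ) * A * ((if x = y then (d : ℂ) * (c x * conj (c y)) else 0) -
              c x * conj (c y)) := by
            refine Finset.sum_congr rfl fun x _ => Finset.sum_congr rfl fun y _ => ?_
            rw [hin]
            split_ifs <;> ring
        _ = _ := by
            push_cast
            simp only [← Complex.mul_conj, map_sum, Finset.sum_mul_sum, ← Finset.mul_sum,
              Finset.sum_sub_distrib, Finset.sum_ite_eq, Finset.mem_univ, if_true]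
    exact_mod_cast this
  have hS : 0 ≤ ∑ π : Equiv.Perm X, Complex.normSq (∑ x, c x * a (π x)) :=
    Finset.sum_nonneg fun _ _ => Complex.normSq_nonneg _
  set S := ∑ π : Equiv.Perm X, Complex.normSq (∑ x, c x * a (π x))
  set C := ∑ x, Complex.normSq (c x)
  have hn := Complex.normSq_nonneg (∑ x, c x)
  have h1 : d * (d - 1) * S ≤ P * A * (d * C) := by
    rw [hmain]
    exact mul_le_mul_of_nonneg_left (by linarith) (mul_nonneg hPn hAn)
  have h2 : (d - 1) * S ≤ P * A * C := by
    have : d * ((d - 1) * S) ≤ d * (P * A * C) := by linarith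
    exact le_of_mul_le_mul_left this (by linarith)
  nlinarith [mul_nonneg (by linarith : (0:ℝ) ≤ d - 2) hS]

/-- Second moment bound for random phases and permutations. -/
lemma scalar_moment (G a : X → X → ℂ) (ha : ∑ u, a u u = 0) :
    (Fintype.card X : ℝ) ^ 2 * ∑ π : Equiv.Perm X, ∑ s : X → ZMod 3,
      Complex.normSq (∑ x, ∑ y, ph s x * conj (ph s y) * (G x y * a (π x) (π y))) ≤
    2 * (Fintype.card (Equiv.Perm X) * Fintype.card (X → ZMod 3)) *
      ((∑ x, ∑ y, if x = y then 0 else Complex.normSq (G x y)) *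
          (∑ u, ∑ v, Complex.normSq (a u v)) +
        Fintype.card X * ((∑ x, Complex.normSq (G x x)) * (∑ u, Complex.normSq (a u u)))) := by
  set d : ℝ := (Fintype.card X : ℝ) with hdd
  set P : ℝ := (Fintype.card (Equiv.Perm X) : ℝ) with hP
  set N : ℝ := (Fintype.card (X → ZMod 3) : ℝ) with hN
  have hPn : 0 ≤ P := Nat.cast_nonneg _
  have hNn : 0 ≤ N := Nat.cast_nonneg _
  have hdn : 0 ≤ d := Nat.cast_nonneg _
  set O := ∑ x, ∑ y, if x = y then 0 else Complex.normSq (G x y) with hO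
  set C := ∑ x, Complex.normSq (G x x) with hC
  set A := ∑ u, ∑ v, Complex.normSq (a u v) with hA
  set A1 := ∑ u, Complex.normSq (a u u) with hA1
  have hOn : 0 ≤ O := Finset.sum_nonneg fun _ _ => Finset.sum_nonneg fun _ _ => by
    split_ifs
    · exact le_refl _
    · exact Complex.normSq_nonneg _
  have hCn : 0 ≤ C := Finset.sum_nonneg fun _ _ => Complex.normSq_nonneg _
  have hA1n : 0 ≤ A1 := Finset.sum_nonneg fun _ _ => Complex.normSq_nonneg _
  have hAn : 0 ≤ A := Finset.sum_nonneg fun _ _ => Finset.sum_nonneg fun _ _ =>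
    Complex.normSq_nonneg _
  by_cases hd : 2 ≤ Fintype.card X
  · have hd2 : (2 : ℝ) ≤ d := by rw [hdd]; exact_mod_cast hd
    simp only [phase_moment]
    rw [← Finset.mul_sum, Finset.sum_add_distrib]
    have hdiag := perm_diag (fun x => G x x) (fun u => a u u) ha hd
    have hoff : ∀ x y, x ≠ y → d ^ 2 * ∑ π : Equiv.Perm X, Complex.normSq (a (π x) (π y)) ≤
        2 * P * A := by
      intro x y hxy
      have h0 := perm_sum_two (fun u v => (Complex.normSq (a u v) : ℂ)) x y hxy
      have h1 : d * (d - 1) * ∑ π : Equiv.Perm X, Complex.normSq (a (π x) (π y)) =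
          P * ∑ u, ∑ v, if u = v then 0 else Complex.normSq (a u v) := by
        rw [hdd, hP]
        have : (((Fintype.card X : ℝ) * ((Fintype.card X : ℝ) - 1) *
            ∑ π : Equiv.Perm X, Complex.normSq (a (π x) (π y)) : ℝ) : ℂ) =
            (((Fintype.card (Equiv.Perm X) : ℝ) *
              ∑ u, ∑ v, if u = v then 0 else Complex.normSq (a u v) : ℝ) : ℂ) := by
          push_cast
          rw [h0]
          congr 1
          refine Finset.sum_congr rfl fun u _ => Finset.sum_congr rfl fun v _ => ?_
          split_ifs <;> simp
        exact_mod_cast this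
      have h2 : ∑ u, ∑ v, (if u = v then 0 else Complex.normSq (a u v)) ≤ A := by
        refine Finset.sum_le_sum fun u _ => Finset.sum_le_sum fun v _ => ?_
        split_ifs
        · exact Complex.normSq_nonneg _
        · exact le_refl _
      have hS : 0 ≤ ∑ π : Equiv.Perm X, Complex.normSq (a (π x) (π y)) :=
        Finset.sum_nonneg fun _ _ => Complex.normSq_nonneg _
      have h3 := mul_le_mul_of_nonneg_left h2 hPn
      have h4 : 0 ≤ d * (d - 2) * ∑ π : Equiv.Perm X, Complex.normSq (a (π x) (π y)) :=
        mul_nonneg (mul_nonneg hdn (by linarith)) hS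
      nlinarith
    have hoff2 : d ^ 2 * ∑ π : Equiv.Perm X, ∑ x, ∑ y, (if x = y then 0 else
        Complex.normSq (G x y * a (π x) (π y))) ≤ 2 * P * A * O := by
      rw [Finset.sum_comm]
      have : ∀ x, ∑ π : Equiv.Perm X, ∑ y, (if x = y then 0 else
        Complex.normSq (G x y * a (π x) (π y))) = ∑ y, if x = y then 0 else
          Complex.normSq (G x y) * ∑ π : Equiv.Perm X, Complex.normSq (a (π x) (π y)) := by
        intro x
        rw [Finset.sum_comm]
        refine Finset.sum_congr rfl fun y _ => ?_
        split_ifs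
        · simp
        · simp [Complex.normSq_mul, Finset.mul_sum]
      simp only [this]
      rw [hO]
      simp only [Finset.mul_sum]
      refine Finset.sum_le_sum fun x _ => Finset.sum_le_sum fun y _ => ?_
      split_ifs with e
      · simp
      · have := mul_le_mul_of_nonneg_left (hoff x y e) (Complex.normSq_nonneg (G x y))
        simp only [← Finset.mul_sum]
        linarith
    have h5 := mul_le_mul_of_nonneg_left hdiag hdn
    have h6 : d ^ 2 * (∑ π : Equiv.Perm X, Complex.normSq (∑ x, G x x * a (π x) (π x)) +
        ∑ π : Equiv.Perm X, ∑ x, ∑ y, (if x = y then 0 else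
        Complex.normSq (G x y * a (π x) (π y)))) ≤ 2 * P * (O * A + d * (C * A1)) := by
      nlinarith
    have h7 := mul_le_mul_of_nonneg_left h6 hNn
    linarith
  · have hz : ∀ u v, a u v = 0 := by
      intro u v
      have hs : Fintype.card X ≤ 1 := by omega
      have : Subsingleton X := Fintype.card_le_one_iff_subsingleton.mp hs
      have e : v = u := Subsingleton.elim _ _
      subst e
      rw [← ha, Finset.sum_eq_single v]
      · intro b _ hb; exact absurd (Subsingleton.elim _ _) hb
      · intro h; exact absurd (Finset.mem_univ _) h
    have : ∀ (π : Equiv.Perm X) (s : X → ZMod 3),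
        Complex.normSq (∑ x, ∑ y, ph s x * conj (ph s y) * (G x y * a (π x) (π y))) = 0 := by
      intro π s; simp [hz]
    simp only [this]
    simp only [Finset.sum_const_zero, mul_zero]
    positivity
end phases

section decoupling

lemma flat_zmod (d : ℕ) [NeZero d] : ∃ F : Matrix (ZMod d) (ZMod d) ℂ, F * Fᴴ = 1 ∧
    ∀ u v, Complex.normSq (F u v) = (d : ℝ)⁻¹ := by
  have hd : (0 : ℝ) < d := by exact_mod_cast Nat.pos_of_ne_zero (NeZero.ne d)
  have hs : ((√(d:ℝ))⁻¹ : ℝ) * (√(d:ℝ))⁻¹ = (d : ℝ)⁻¹ := by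
    rw [← mul_inv, Real.mul_self_sqrt hd.le]
  refine ⟨Matrix.of fun u v => (((√(d:ℝ))⁻¹ : ℝ) : ℂ) * ZMod.stdAddChar (u * v), ?_, ?_⟩
  · ext u v
    simp only [Matrix.mul_apply, Matrix.conjTranspose_apply, Matrix.of_apply, Complex.star_def,
      map_mul, Complex.conj_ofReal, ← AddChar.map_neg_eq_conj]
    have : ∀ x : ZMod d, (((√(d:ℝ))⁻¹ : ℝ) : ℂ) * ZMod.stdAddChar (u * x) *
        ((((√(d:ℝ))⁻¹ : ℝ) : ℂ) * ZMod.stdAddChar (-(v * x))) =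
        ((d : ℂ))⁻¹ * ZMod.stdAddChar (x * (u - v)) := by
      intro x
      have e : (ZMod.stdAddChar (x * (u - v)) : ℂ) =
        ZMod.stdAddChar (u * x) * ZMod.stdAddChar (-(v * x)) := by
        rw [← AddChar.map_add_eq_mul]; congr 1; ring
      have hs' : (((√(d:ℝ))⁻¹ : ℝ) : ℂ) * (((√(d:ℝ))⁻¹ : ℝ) : ℂ) = ((d : ℂ))⁻¹ := by
        rw [← Complex.ofReal_mul, hs]; push_cast; rfl
      rw [e, ← hs']; ring
    simp only [this, ← Finset.mul_sum]
    rw [AddChar.sum_mulShift _ (ZMod.isPrimitive_stdAddChar d), Matrix.one_apply]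
    by_cases h : u = v
    · subst h
      have : (d : ℂ) ≠ 0 := by exact_mod_cast NeZero.ne d
      simp [ZMod.card, this]
    · simp [h, sub_eq_zero]
  · intro u v
    have : Complex.normSq (ZMod.stdAddChar (u * v)) = 1 := by
      rw [Complex.normSq_eq_norm_sq, AddChar.norm_apply]; norm_num
    simp only [Matrix.of_apply, Complex.normSq_mul, Complex.normSq_ofReal, this, hs, mul_one]

lemma flat_exists (X : Type*) [Fintype X] [DecidableEq X] [Nonempty X] :
    ∃ F : Matrix X X ℂ, F * Fᴴ = 1 ∧ Fᴴ * F = 1 ∧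
    ∀ u v, Complex.normSq (F u v) = (Fintype.card X : ℝ)⁻¹ := by
  haveI : NeZero (Fintype.card X) := ⟨Fintype.card_ne_zero⟩
  obtain ⟨F, h1, h2⟩ := flat_zmod (Fintype.card X)
  have e : X ≃ ZMod (Fintype.card X) := Fintype.equivOfCardEq (by rw [ZMod.card])
  have h3 : F.submatrix e e * (F.submatrix e e)ᴴ = 1 := by
    rw [Matrix.conjTranspose_submatrix, Matrix.submatrix_mul_equiv, h1, Matrix.submatrix_one_equiv]
  exact ⟨F.submatrix e e, h3, mul_eq_one_comm.mp h3, fun u v => h2 _ _⟩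

variable {Q K : Type*} [Fintype Q] [DecidableEq Q] [Fintype K] [DecidableEq K]

/-- the random unitary -/
noncomputable def RU {X : Type*} (F : Matrix X X ℂ) (θ : X → ZMod 3) (π : Equiv.Perm X)
    (s : X → ZMod 3) : Matrix X X ℂ := Matrix.of fun x' x => ph θ x' * F x' (π x) * ph s x

lemma RU_unitary {X : Type*} [Fintype X] [DecidableEq X] (F : Matrix X X ℂ) (hF : F * Fᴴ = 1)
    (θ : X → ZMod 3) (π : Equiv.Perm X)
    (s : X → ZMod 3) : RU F θ π s * (RU F θ π s)ᴴ = 1 := by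
  ext u v
  simp only [Matrix.mul_apply, Matrix.conjTranspose_apply, RU, Matrix.of_apply, Complex.star_def,
    map_mul]
  have : ∀ x, ph θ u * F u (π x) * ph s x * (conj (ph θ v) * conj (F v (π x)) * conj (ph s x)) =
      (ph θ u * conj (ph θ v)) * (F u (π x) * conj (F v (π x))) := by
    intro x
    linear_combination (ph θ u * conj (ph θ v)) * (F u (π x) * conj (F v (π x))) * ph_conj s x
  simp only [this, ← Finset.mul_sum]
  rw [Equiv.sum_comp π (fun y => F u y * conj (F v y))]
  have h := congrFun (congrFun hF u) v
  simp only [Matrix.mul_apply, Matrix.conjTranspose_apply, Complex.star_def] at h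
  rw [h]
  by_cases e : u = v
  · subst e; simp [ph_conj]
  · simp [e]

/-- partial-trace coefficients -/
noncomputable def Tc (F : Matrix (Q × K) (Q × K) ℂ) (i i' : K) (u v : Q × K) : ℂ :=
  ∑ qq, F (qq, i) u * conj (F (qq, i') v)

noncomputable def ac (F : Matrix (Q × K) (Q × K) ℂ) (i i' : K) (u v : Q × K) : ℂ :=
  Tc F i i' u v - if u = v then (if i = i' then ((Fintype.card K : ℂ))⁻¹ else 0) else 0

lemma Tc_sq (F : Matrix (Q × K) (Q × K) ℂ) (hF : F * Fᴴ = 1) (i i' : K) :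
    ∑ u, ∑ v, Complex.normSq (Tc F i i' u v) = Fintype.card Q := by
  have h : ∀ x y, ∑ u, F x u * conj (F y u) = if x = y then 1 else 0 := by
    intro x y
    have h := congrFun (congrFun hF x) y
    simpa only [Matrix.mul_apply, Matrix.conjTranspose_apply, Complex.star_def, Matrix.one_apply] using h
  have : ((∑ u, ∑ v, Complex.normSq (Tc F i i' u v) : ℝ) : ℂ) = ((Fintype.card Q : ℝ) : ℂ) := by
    calc _ = ∑ u, ∑ v, ∑ q1, ∑ q2, (F (q1, i) u * conj (F (q2, i) u)) *
            (conj (F (q1, i') v * conj (F (q2, i') v))) := by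
          push_cast
          refine Finset.sum_congr rfl fun u _ => Finset.sum_congr rfl fun v _ => ?_
          rw [← Complex.mul_conj]
          simp only [Tc, map_sum, Finset.sum_mul_sum]
          refine Finset.sum_congr rfl fun q1 _ => Finset.sum_congr rfl fun q2 _ => ?_
          simp only [map_mul, Complex.conj_conj]
          ring
      _ = ∑ q1, ∑ q2, (∑ u, F (q1, i) u * conj (F (q2, i) u)) *
            (conj (∑ v, F (q1, i') v * conj (F (q2, i') v))) := by
          simp only [map_sum, Finset.sum_mul_sum]
          have : ∀ u, ∑ v, ∑ q1, ∑ q2, (F (q1, i) u * conj (F (q2, i) u)) *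
            (conj (F (q1, i') v * conj (F (q2, i') v))) =
            ∑ q1, ∑ q2, ∑ v, (F (q1, i) u * conj (F (q2, i) u)) *
            (conj (F (q1, i') v * conj (F (q2, i') v))) := by
            intro u
            rw [Finset.sum_comm]
            exact Finset.sum_congr rfl fun _ _ => Finset.sum_comm
          simp only [this]
          rw [Finset.sum_comm]
          exact Finset.sum_congr rfl fun _ _ => Finset.sum_comm
      _ = _ := by
          simp only [h, Prod.mk.injEq, and_true]
          simp
  exact_mod_cast this

lemma Tc_diag (F : Matrix (Q × K) (Q × K) ℂ) [Nonempty Q]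
    (hf : ∀ u v, Complex.normSq (F u v) = (Fintype.card (Q × K) : ℝ)⁻¹) (i : K) (u : Q × K) :
    Tc F i i u u = ((Fintype.card K : ℂ))⁻¹ := by
  have h1 : (Fintype.card Q : ℂ) ≠ 0 := by exact_mod_cast Fintype.card_ne_zero
  simp only [Tc, Complex.mul_conj, hf, Fintype.card_prod]
  simp
  field_simp

lemma ac_le (F : Matrix (Q × K) (Q × K) ℂ) [Nonempty Q]
    (hf : ∀ u v, Complex.normSq (F u v) = (Fintype.card (Q × K) : ℝ)⁻¹) (i i' : K) (u v : Q × K) :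
    Complex.normSq (ac F i i' u v) ≤ Complex.normSq (Tc F i i' u v) := by
  unfold ac
  split_ifs with h1 h2
  · subst h1 h2
    rw [Tc_diag F hf, sub_self, map_zero]; exact Complex.normSq_nonneg _
  · simp
  · simp

lemma ac_trace (F : Matrix (Q × K) (Q × K) ℂ) [Nonempty Q] (hF : Fᴴ * F = 1) (hF' : F * Fᴴ = 1)
    (hf : ∀ u v, Complex.normSq (F u v) = (Fintype.card (Q × K) : ℝ)⁻¹) (i i' : K) :
    ∑ u, ac F i i' u u = 0 := by
  by_cases h : i = i'
  · subst h
    refine Finset.sum_eq_zero fun u _ => ?_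
    simp [ac, Tc_diag F hf]
  · simp only [ac, h, if_false, if_true, sub_zero, Tc]
    rw [Finset.sum_comm]
    refine Finset.sum_eq_zero fun qq _ => ?_
    have := congrFun (congrFun hF' (qq, i)) (qq, i')
    simp only [Matrix.mul_apply, Matrix.conjTranspose_apply, Complex.star_def] at this
    rw [this, Matrix.one_apply_ne]
    simp [h]

/-- rows multiplied by phases -/
noncomputable def FT (F : Matrix (Q × K) (Q × K) ℂ) (θ : Q × K → ZMod 3) : Matrix (Q × K) (Q × K) ℂ :=
  Matrix.of fun x y => ph θ x * F x y

lemma FT_flat (F : Matrix (Q × K) (Q × K) ℂ)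
    (hf : ∀ u v, Complex.normSq (F u v) = (Fintype.card (Q × K) : ℝ)⁻¹) (θ) (u v) :
    Complex.normSq (FT F θ u v) = (Fintype.card (Q × K) : ℝ)⁻¹ := by
  have : Complex.normSq (ph θ u) = 1 := by
    have := ph_conj θ u
    rw [Complex.mul_conj] at this; exact_mod_cast this
  simp [FT, this, hf]

lemma FT_unit (F : Matrix (Q × K) (Q × K) ℂ) (hF : F * Fᴴ = 1) (θ) : FT F θ * (FT F θ)ᴴ = 1 := by
  have := RU_unitary F hF θ 1 0
  have e : RU F θ 1 0 = FT F θ := by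
    ext u v; simp [RU, FT, ph]
  rwa [e] at this

lemma ac_diag_avg (F : Matrix (Q × K) (Q × K) ℂ) [Nonempty Q] [Nonempty K]
    (hf : ∀ u v, Complex.normSq (F u v) = (Fintype.card (Q × K) : ℝ)⁻¹) (i i' : K) :
    ∑ θ : Q × K → ZMod 3, ∑ u, Complex.normSq (ac (FT F θ) i i' u u) ≤
      (Fintype.card (Q × K → ZMod 3) : ℝ) * (Fintype.card K : ℝ)⁻¹ := by
  by_cases h : i = i'
  · subst h
    have : ∀ θ u, ac (FT F θ) i i u u = 0 := by
      intro θ u; simp [ac, Tc_diag _ (FT_flat F hf θ)]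
    simp only [this, map_zero, Finset.sum_const_zero]
    positivity
  · rw [Finset.sum_comm]
    have key : ∀ u, ∑ θ : Q × K → ZMod 3, Complex.normSq (ac (FT F θ) i i' u u) ≤
        (Fintype.card (Q × K → ZMod 3) : ℝ) * (Fintype.card Q *
          ((Fintype.card (Q × K) : ℝ)⁻¹ * (Fintype.card (Q × K) : ℝ)⁻¹)) := by
      intro u
      let M : Q × K → Q × K → ℂ := fun x y => if x.2 = i then (if y.2 = i' then
        (if x.1 = y.1 then F x u * conj (F y u) else 0) else 0) else 0
      have e : ∀ θ : Q × K → ZMod 3, ac (FT F θ) i i' u u =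
          ∑ x, ∑ y, ph θ x * conj (ph θ y) * M x y := by
        intro θ
        simp only [ac, h, if_false, if_true, sub_zero, Tc, FT, Matrix.of_apply, M,
          Fintype.sum_prod_type, mul_ite, mul_zero, Finset.sum_ite_eq, Finset.sum_ite_eq',
          Finset.mem_univ]
        have e2 : ∀ x y, (∑ x_2, ∑ x_3, if y = i then
            if x_3 = i' then if x = x_2 then ph θ (x, y) * conj (ph θ (x_2, x_3)) *
              (F (x, y) u * conj (F (x_2, x_3) u)) else 0 else 0 else 0) =
            if y = i then ph θ (x, y) * conj (ph θ (x, i')) *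
              (F (x, y) u * conj (F (x, i') u)) else 0 := by
          intro x y
          split_ifs with hy
          · simp
          · simp
        simp only [e2, Finset.sum_ite_eq, Finset.sum_ite_eq', Finset.mem_univ, if_true, map_mul]
        refine Finset.sum_congr rfl fun x _ => ?_
        ring
      simp only [e]
      rw [phase_moment]
      refine mul_le_mul_of_nonneg_left ?_ (Nat.cast_nonneg _)
      have z : ∑ x, M x x = 0 := by
        refine Finset.sum_eq_zero fun x _ => ?_
        simp only [M]
        split_ifs with a b
        · exact absurd (a.symm.trans b) h
        all_goals rfl
      rw [z, map_zero, zero_add]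
      have b : ∀ x y, (if x = y then 0 else Complex.normSq (M x y)) ≤
          if x.2 = i then (if y.2 = i' then
        (if x.1 = y.1 then ((Fintype.card (Q × K) : ℝ)⁻¹ * (Fintype.card (Q × K) : ℝ)⁻¹) else 0) else 0) else 0 := by
        intro x y
        have hc : 0 ≤ ((Fintype.card (Q × K) : ℝ)⁻¹ * (Fintype.card (Q × K) : ℝ)⁻¹) := by positivity
        by_cases e : x = y
        · rw [if_pos e]
          split_ifs <;> first | exact hc | exact le_refl _
        · rw [if_neg e]
          simp only [M]
          split_ifs
          · rw [Complex.normSq_mul, Complex.normSq_conj, hf, hf]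
          all_goals simp
      refine (Finset.sum_le_sum fun x _ => Finset.sum_le_sum fun y _ => b x y).trans ?_
      generalize ((Fintype.card (Q × K) : ℝ)⁻¹ * (Fintype.card (Q × K) : ℝ)⁻¹) = c
      simp only [Fintype.sum_prod_type]
      have e2 : ∀ x y, (∑ x_2 : Q, ∑ x_3 : K, if y = i then
            if x_3 = i' then if x = x_2 then c else 0 else 0 else 0) =
            if y = i then c else 0 := by
          intro x y
          split_ifs with hy
          · simp
          · simp
      simp [e2]
    refine (Finset.sum_le_sum fun u _ => key u).trans ?_
    rw [Finset.sum_const, Finset.card_univ, nsmul_eq_mul, Fintype.card_prod]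
    have h1 : (Fintype.card Q : ℝ) ≠ 0 := by exact_mod_cast Fintype.card_ne_zero
    have h2 : (Fintype.card K : ℝ) ≠ 0 := by exact_mod_cast Fintype.card_ne_zero
    apply le_of_eq
    push_cast
    field_simp

/-- squared Frobenius deviation of the partial trace from maximally mixed -/
noncomputable def dev (U G : Matrix (Q × K) (Q × K) ℂ) : ℝ :=
  ∑ i : K, ∑ i' : K, Complex.normSq ((∑ qq : Q, (U * G * Uᴴ) (qq, i) (qq, i')) -
    if i = i' then (Fintype.card K : ℂ)⁻¹ * G.trace else 0)

lemma dev_eq (F G : Matrix (Q × K) (Q × K) ℂ) (θ : Q × K → ZMod 3) (π : Equiv.Perm (Q × K))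
    (s : Q × K → ZMod 3) : dev (RU F θ π s) G = ∑ i : K, ∑ i' : K, Complex.normSq
      (∑ x, ∑ y, ph s x * conj (ph s y) * (G x y * ac (FT F θ) i i' (π x) (π y))) := by
  unfold dev
  refine Finset.sum_congr rfl fun i _ => Finset.sum_congr rfl fun i' _ => ?_
  congr 1
  simp only [ac, mul_sub, Finset.sum_sub_distrib]
  congr 1
  · simp only [Matrix.mul_apply, Matrix.conjTranspose_apply, RU, FT, Matrix.of_apply, Tc,
      Finset.mul_sum, Finset.sum_mul, Complex.star_def]
    rw [Finset.sum_comm]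
    have : ∀ x y, ∑ qq, ph s x * conj (ph s y) * (G x y * (ph θ (qq, i) * F (qq, i) (π x) *
        conj (ph θ (qq, i') * F (qq, i') (π y)))) =
      ∑ qq, ph θ (qq, i) * F (qq, i) (π x) * ph s x * G x y *
        conj (ph θ (qq, i') * F (qq, i') (π y) * ph s y) := by
      intro x y
      refine Finset.sum_congr rfl fun qq _ => ?_
      simp only [map_mul]; ring
    simp only [this]
    rw [Finset.sum_comm (s := Finset.univ (α := Q × K)) (t := Finset.univ (α := Q × K))]
    refine Finset.sum_congr rfl fun y _ => ?_
    rw [Finset.sum_comm]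
  · have : ∀ x y, ph s x * conj (ph s y) * (G x y * if π x = π y then
        (if i = i' then (Fintype.card K : ℂ)⁻¹ else 0) else 0) =
        if x = y then (if i = i' then (Fintype.card K : ℂ)⁻¹ else 0) * G x x else 0 := by
      intro x y
      by_cases e : x = y
      · subst e; simp only [if_true, ph_conj, one_mul]; ring
      · simp [e]
    simp only [this, Finset.sum_ite_eq, Finset.mem_univ, if_true, ← Finset.mul_sum, Matrix.trace,
      Matrix.diag]
    split_ifs <;> simp

lemma decouple_avg [Nonempty Q] [Nonempty K] (F : Matrix (Q × K) (Q × K) ℂ) (hF : F * Fᴴ = 1)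
    (hf : ∀ u v, Complex.normSq (F u v) = (Fintype.card (Q × K) : ℝ)⁻¹)
    (G : Matrix (Q × K) (Q × K) ℂ) :
    Fintype.card Q * ∑ θ : Q × K → ZMod 3, ∑ π : Equiv.Perm (Q × K), ∑ s : Q × K → ZMod 3,
      dev (RU F θ π s) G ≤ 2 * (Fintype.card (Q × K → ZMod 3) *
        (Fintype.card (Equiv.Perm (Q × K)) * Fintype.card (Q × K → ZMod 3))) * fsq G := by
  set N : ℝ := (Fintype.card (Q × K → ZMod 3) : ℝ) with hN
  set P : ℝ := (Fintype.card (Equiv.Perm (Q × K)) : ℝ) with hP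
  set d : ℝ := (Fintype.card (Q × K) : ℝ) with hd
  set O := ∑ x, ∑ y, if x = y then 0 else Complex.normSq (G x y) with hO
  set C := ∑ x, Complex.normSq (G x x) with hC
  have hNn : 0 ≤ N := Nat.cast_nonneg _
  have hPn : 0 ≤ P := Nat.cast_nonneg _
  have hdp : 0 < d := by rw [hd]; exact_mod_cast Fintype.card_pos
  set q : ℝ := (Fintype.card Q : ℝ) with hq
  set k : ℝ := (Fintype.card K : ℝ) with hk
  have hqp : 0 < q := by rw [hq]; exact_mod_cast Fintype.card_pos
  have hkp : 0 < k := by rw [hk]; exact_mod_cast Fintype.card_pos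
  have hdqk : d = q * k := by rw [hd, hq, hk, Fintype.card_prod]; push_cast; rfl
  have hOn : 0 ≤ O := Finset.sum_nonneg fun _ _ => Finset.sum_nonneg fun _ _ => by
    split_ifs
    · exact le_refl _
    · exact Complex.normSq_nonneg _
  have hCn : 0 ≤ C := Finset.sum_nonneg fun _ _ => Complex.normSq_nonneg _
  have hG : fsq G = O + C := by
    rw [hO, hC, ← Finset.sum_add_distrib]
    refine Finset.sum_congr rfl fun x _ => ?_
    have : ∀ y, Complex.normSq (G x y) = (if x = y then 0 else Complex.normSq (G x y)) +
      if x = y then Complex.normSq (G x y) else 0 := by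
      intro y; split_ifs <;> simp
    rw [Finset.sum_congr rfl fun y _ => this y, Finset.sum_add_distrib]
    simp
  have key : ∀ θ : Q × K → ZMod 3, ∀ i i', d ^ 2 * ∑ π : Equiv.Perm (Q × K), ∑ s : Q × K → ZMod 3,
      Complex.normSq
      (∑ x, ∑ y, ph s x * conj (ph s y) * (G x y * ac (FT F θ) i i' (π x) (π y))) ≤
      2 * (P * N) * (O * q + d * (C * ∑ u, Complex.normSq (ac (FT F θ) i i' u u))) := by
    intro θ i i'
    have h1 := FT_unit F hF θ
    have h := scalar_moment G (ac (FT F θ) i i')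
      (ac_trace _ (mul_eq_one_comm.mp h1) h1 (FT_flat F hf θ) i i')
    refine h.trans ?_
    refine mul_le_mul_of_nonneg_left ?_ (by positivity)
    refine add_le_add ?_ (le_refl _)
    refine mul_le_mul_of_nonneg_left ?_ hOn
    rw [hq, ← Tc_sq (FT F θ) h1 i i']
    exact Finset.sum_le_sum fun u _ => Finset.sum_le_sum fun v _ => ac_le _ (FT_flat F hf θ) _ _ _ _
  have tot : d ^ 2 * ∑ θ : Q × K → ZMod 3, ∑ π : Equiv.Perm (Q × K), ∑ s : Q × K → ZMod 3,
      dev (RU F θ π s) G ≤ 2 * (P * N) * (k * k * N) * (O * q + d * (C * k⁻¹)) := by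
    have e1 : ∑ θ : Q × K → ZMod 3, ∑ π : Equiv.Perm (Q × K), ∑ s : Q × K → ZMod 3,
      dev (RU F θ π s) G = ∑ i : K, ∑ i' : K, ∑ θ : Q × K → ZMod 3,
        ∑ π : Equiv.Perm (Q × K), ∑ s : Q × K → ZMod 3, Complex.normSq
      (∑ x, ∑ y, ph s x * conj (ph s y) * (G x y * ac (FT F θ) i i' (π x) (π y))) := by
      simp only [dev_eq]
      have a1 : ∀ (f : (Q × K → ZMod 3) → Equiv.Perm (Q × K) → (Q × K → ZMod 3) → K → ℝ),
          ∑ θ, ∑ π, ∑ s, ∑ i, f θ π s i = ∑ i, ∑ θ, ∑ π, ∑ s, f θ π s i := by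
        intro f
        have : ∀ θ, ∑ π, ∑ s, ∑ i, f θ π s i = ∑ i, ∑ π, ∑ s, f θ π s i := by
          intro θ
          have : ∀ π, ∑ s, ∑ i, f θ π s i = ∑ i, ∑ s, f θ π s i := fun π => Finset.sum_comm
          simp only [this]
          exact Finset.sum_comm
        simp only [this]
        exact Finset.sum_comm
      rw [a1]
      exact Finset.sum_congr rfl fun i _ => a1 _
    rw [e1, Finset.mul_sum]
    have b : ∀ i i', d ^ 2 * ∑ θ : Q × K → ZMod 3,
        ∑ π : Equiv.Perm (Q × K), ∑ s : Q × K → ZMod 3, Complex.normSq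
      (∑ x, ∑ y, ph s x * conj (ph s y) * (G x y * ac (FT F θ) i i' (π x) (π y))) ≤
        2 * (P * N) * N * (O * q + d * (C * k⁻¹)) := by
      intro i i'
      rw [Finset.mul_sum]
      refine (Finset.sum_le_sum fun θ _ => key θ i i').trans ?_
      rw [← Finset.mul_sum, Finset.sum_add_distrib, ← Finset.mul_sum, ← Finset.mul_sum,
        Finset.sum_const, Finset.card_univ, nsmul_eq_mul, mul_assoc (2 * (P * N))]
      refine mul_le_mul_of_nonneg_left ?_ (by positivity)
      have := ac_diag_avg F hf i i'
      have h2 := mul_le_mul_of_nonneg_left this (mul_nonneg hdp.le hCn)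
      rw [← hN] at h2 ⊢
      rw [← Finset.mul_sum]
      rw [← hk] at h2
      linarith
    calc _ ≤ ∑ i : K, ∑ i' : K, 2 * (P * N) * N * (O * q + d * (C * k⁻¹)) := by
          refine Finset.sum_le_sum fun i _ => ?_
          rw [Finset.mul_sum]
          exact Finset.sum_le_sum fun i' _ => b i i'
      _ = _ := by
          simp only [Finset.sum_const, Finset.card_univ, nsmul_eq_mul, ← hk]; ring
  set S := ∑ θ : Q × K → ZMod 3, ∑ π : Equiv.Perm (Q × K), ∑ s : Q × K → ZMod 3,
      dev (RU F θ π s) G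
  have e : 2 * (P * N) * (k * k * N) * (O * q + d * (C * k⁻¹)) =
      (d * k) * (2 * (N * (P * N)) * fsq G) := by
    rw [hG, hdqk]; field_simp
  rw [e] at tot
  have : (d * k) * (q * S) ≤ (d * k) * (2 * (N * (P * N)) * fsq G) := by
    calc (d * k) * (q * S) = d ^ 2 * S := by rw [hdqk]; ring
      _ ≤ _ := tot
  exact le_of_mul_le_mul_left this (by positivity)

/-- decoupling: existence of a good unitary -/
lemma decouple [Nonempty Q] [Nonempty K] {ι : Type*} [Fintype ι]
    (G : ι → Matrix (Q × K) (Q × K) ℂ) :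
    ∃ U : Matrix (Q × K) (Q × K) ℂ, U * Uᴴ = 1 ∧ Uᴴ * U = 1 ∧
      Fintype.card Q * ∑ z, dev U (G z) ≤ 2 * ∑ z, fsq (G z) := by
  obtain ⟨F, hF, -, hf⟩ := flat_exists (Q × K)
  by_contra hcon
  push Not at hcon
  have h1 : ∀ θ π s, 2 * ∑ z, fsq (G z) < Fintype.card Q * ∑ z, dev (RU F θ π s) (G z) :=
    fun θ π s => hcon _ (RU_unitary F hF θ π s) (mul_eq_one_comm.mp (RU_unitary F hF θ π s))
  have h2 : ∑ θ : Q × K → ZMod 3, ∑ π : Equiv.Perm (Q × K), ∑ s : Q × K → ZMod 3,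
      2 * ∑ z, fsq (G z) < ∑ θ : Q × K → ZMod 3, ∑ π : Equiv.Perm (Q × K), ∑ s : Q × K → ZMod 3,
      Fintype.card Q * ∑ z, dev (RU F θ π s) (G z) :=
    Finset.sum_lt_sum_of_nonempty Finset.univ_nonempty fun θ _ =>
      Finset.sum_lt_sum_of_nonempty Finset.univ_nonempty fun π _ =>
      Finset.sum_lt_sum_of_nonempty Finset.univ_nonempty fun s _ => h1 θ π s
  have h3 := Finset.sum_le_sum fun z (_ : z ∈ Finset.univ) => decouple_avg F hF hf (G z)
  have e1 : ∑ θ : Q × K → ZMod 3, ∑ π : Equiv.Perm (Q × K), ∑ s : Q × K → ZMod 3,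
      (Fintype.card Q : ℝ) * ∑ z, dev (RU F θ π s) (G z) = ∑ z, (Fintype.card Q : ℝ) *
      ∑ θ : Q × K → ZMod 3, ∑ π : Equiv.Perm (Q × K), ∑ s : Q × K → ZMod 3,
      dev (RU F θ π s) (G z) := by
    simp only [← Finset.mul_sum]
    congr 1
    have : ∀ θ, ∑ π : Equiv.Perm (Q × K), ∑ s : Q × K → ZMod 3, ∑ z, dev (RU F θ π s) (G z) =
        ∑ z, ∑ π : Equiv.Perm (Q × K), ∑ s : Q × K → ZMod 3, dev (RU F θ π s) (G z) := by
      intro θ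
      have : ∀ π : Equiv.Perm (Q × K), ∑ s : Q × K → ZMod 3, ∑ z, dev (RU F θ π s) (G z) =
        ∑ z, ∑ s : Q × K → ZMod 3, dev (RU F θ π s) (G z) := fun π => Finset.sum_comm
      simp only [this]
      exact Finset.sum_comm
    simp only [this]
    exact Finset.sum_comm
  rw [e1] at h2
  have := h2.trans_le h3
  simp only [Finset.sum_const, Finset.card_univ, nsmul_eq_mul, ← Finset.mul_sum] at this
  apply lt_irrefl _ (this.trans_le (le_of_eq _))
  ring
end decoupling

section oneshot
variable {R B E A Q K : Type} [Fintype R] [Fintype B] [Fintype E] [Fintype A] [Fintype Q] [Fintype K]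
  [DecidableEq R] [DecidableEq B] [DecidableEq E] [DecidableEq A] [DecidableEq Q] [DecidableEq K]

/-- encoder followed by decoder, as a linear map -/
noncomputable def Lmap (c : ℂ) (D0 : Matrix B (Q × K) ℂ) (W : Matrix ((B × E) × K) (Q × E) ℂ)
    (η : R → B × E → ℂ) : Matrix B (R × E) ℂ :=
  Matrix.of fun b z => ∑ x : Q × K, D0 b x * (c * ∑ y, W (y, x.2) (x.1, z.2) * η z.1 y)

lemma Lmap_add (c : ℂ) (D0 : Matrix B (Q × K) ℂ) (W : Matrix ((B × E) × K) (Q × E) ℂ)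
    (η η' : R → B × E → ℂ) : Lmap c D0 W (fun r y => η r y + η' r y) = Lmap c D0 W η + Lmap c D0 W η' := by
  ext b z
  simp only [Lmap, Matrix.of_apply, Matrix.add_apply, mul_add, Finset.sum_add_distrib]

lemma fsq_reshape {m n m' n' : Type*} [Fintype m] [Fintype n] [Fintype m'] [Fintype n']
    (M : Matrix m n ℂ) (M' : Matrix m' n' ℂ) (e : m × n ≃ m' × n')
    (h : ∀ x, M x.1 x.2 = M' (e x).1 (e x).2) : fsq M = fsq M' := by
  unfold fsq
  rw [← Fintype.sum_prod_type', ← Fintype.sum_prod_type']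
  refine Fintype.sum_equiv e _ _ fun x => ?_
  rw [h]

/-- shuffling equivalence -/
def shuf (R K Q E : Type) : (Q × K) × (R × E) ≃ (R × K) × (Q × E) where
  toFun x := ((x.2.1, x.1.2), (x.1.1, x.2.2))
  invFun x := ((x.2.1, x.1.2), (x.1.1, x.2.2))
  left_inv _ := rfl
  right_inv _ := rfl

/-- entangled purification -/
def Ymat (K : Type) [DecidableEq K] (c : ℂ) (η : R → B × E → ℂ) : Matrix (R × K) ((B × E) × K) ℂ :=
  Matrix.of fun x y => if x.2 = y.2 then c * η x.1 y.1 else 0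

lemma Ymat_mul (c : ℂ) (η : R → B × E → ℂ) (W : Matrix ((B × E) × K) (Q × E) ℂ) (r i qq e) :
    (Ymat K c η * W) (r, i) (qq, e) = c * ∑ y, W (y, i) (qq, e) * η r y := by
  simp only [Matrix.mul_apply, Ymat, Matrix.of_apply]
  rw [Fintype.sum_prod_type, Finset.mul_sum]
  refine Finset.sum_congr rfl fun y _ => ?_
  simp only [ite_mul, zero_mul, Finset.sum_ite_eq, Finset.mem_univ, if_true]
  ring

lemma Ymat_fsq (c : ℂ) (η : R → B × E → ℂ) :
    fsq (Ymat K c η) = Fintype.card K * Complex.normSq c * ∑ r, ∑ y, Complex.normSq (η r y) := by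
  simp only [fsq, Ymat, Matrix.of_apply]
  have : ∀ x : R × K, ∑ y : (B × E) × K, Complex.normSq (if x.2 = y.2 then c * η x.1 y.1 else 0) =
      Complex.normSq c * ∑ y, Complex.normSq (η x.1 y) := by
    intro x
    rw [Fintype.sum_prod_type, Finset.mul_sum]
    refine Finset.sum_congr rfl fun y _ => ?_
    rw [Finset.sum_eq_single x.2]
    · simp
    · intro b _ hb; rw [if_neg (Ne.symm hb), map_zero]
    · intro h; exact absurd (Finset.mem_univ _) h
  simp only [this]
  rw [Fintype.sum_prod_type]
  simp only [Finset.sum_const, Finset.card_univ, nsmul_eq_mul, ← Finset.mul_sum]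
  ring

lemma Lmap_fsq (c : ℂ) (hc : Fintype.card K * Complex.normSq c = 1) (D0 : Matrix B (Q × K) ℂ)
    (hD : (1 - D0ᴴ * D0).PosSemidef)
    (W : Matrix ((B × E) × K) (Q × E) ℂ) (hW : (1 - W * Wᴴ).PosSemidef)
    (η : R → B × E → ℂ) : fsq (Lmap c D0 W η) ≤ ∑ r, ∑ y, Complex.normSq (η r y) := by
  let M : Matrix (Q × K) (R × E) ℂ := Matrix.of fun x z => (Ymat K c η * W) (z.1, x.2) (x.1, z.2)
  have e : Lmap c D0 W η = D0 * M := by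
    ext b z
    rw [Matrix.mul_apply]
    simp only [Lmap, M, Matrix.of_apply, Ymat_mul]
  rw [e]
  refine (fsq_mul_le _ _ hD).trans ?_
  have e2 : fsq M = fsq (Ymat K c η * W) := fsq_reshape _ _ (shuf R K Q E) fun x => rfl
  rw [e2]
  refine (fsq_mul_le' _ _ hW).trans ?_
  rw [Ymat_fsq, hc, one_mul]

lemma exists_embed (TB : Finset B) (X : Type) [Fintype X] [DecidableEq X] [Nonempty X] 
    (h : TB.card ≤ Fintype.card X) :
    ∃ J : Matrix X B ℂ, Jᴴ * J = diagonal (fun b => if b ∈ TB then (1 : ℂ) else 0) ∧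
      J * diagonal (fun b => if b ∈ TB then (1 : ℂ) else 0) = J := by
  have : Fintype.card TB ≤ Fintype.card X := by simpa using h
  obtain ⟨g⟩ := Function.Embedding.nonempty_of_card_le this
  refine ⟨Matrix.of fun x b => if h : b ∈ TB then (if x = g ⟨b, h⟩ then 1 else 0) else 0, ?_, ?_⟩
  · ext b b'
    simp only [Matrix.mul_apply, Matrix.conjTranspose_apply, Matrix.of_apply, Matrix.diagonal_apply]
    by_cases hb : b ∈ TB
    · by_cases hb' : b' ∈ TB
      · simp [hb, hb', apply_ite]
        split_ifs with e
        · exact e.symm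
        · exact fun h => e h.symm
      · have : b ≠ b' := fun e => hb' (e ▸ hb)
        simp [hb', this]
    · simp [hb]
  · ext x b
    simp only [Matrix.mul_diagonal, Matrix.of_apply]
    split_ifs <;> simp

/-- reshaping a tripartite vector -/
def mkM (η : R → B × E → ℂ) : Matrix B (R × E) ℂ := Matrix.of fun b z => η z.1 (b, z.2)

lemma mkM_fsq (η : R → B × E → ℂ) : fsq (mkM η) = ∑ r, ∑ y, Complex.normSq (η r y) := by
  simp only [fsq, mkM, Matrix.of_apply, Fintype.sum_prod_type]
  rw [Finset.sum_comm]

set_option maxHeartbeats 1000000 in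
lemma oneshot [Nonempty Q] [Nonempty K] (Vn : Matrix (B × E) A ℂ) (hV : Vnᴴ * Vn = 1)
    (ψ : R → A → ℂ) (ω ωt : R → B × E → ℂ) (hω : ∀ r y, ω r y = ∑ a, Vn y a * ψ r a)
    (TR : Finset R) (TB : Finset B) (hTR : ∀ r, r ∉ TR → ∀ y, ωt r y = 0)
    (hTB : ∀ r b e, b ∉ TB → ωt r (b, e) = 0)
    (hcard : TB.card ≤ Fintype.card Q * Fintype.card K) (lam γ1 γ2 : ℝ)
    (hlam : ∑ r, ∑ r', fsq ((Matrix.of fun b e => ωt r (b, e)) *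
      (Matrix.of fun b e => ωt r' (b, e))ᴴ) ≤ lam)
    (h1 : ∑ r, ∑ y, Complex.normSq (ω r y - ωt r y) ≤ γ1) (hγ2 : 0 ≤ γ2)
    (h2 : TR.card * Fintype.card K * (2 * lam) ≤ Fintype.card Q * γ2 ^ 2)
    (c : ℂ) (hc : c * conj c = (Fintype.card K : ℂ)⁻¹) :
    ∃ (E0 : E → Matrix Q (A × K) ℂ) (D0 : Matrix B (Q × K) ℂ),
      (1 - ∑ j, (E0 j)ᴴ * E0 j).PosSemidef ∧ (1 - D0ᴴ * D0).PosSemidef ∧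
      ∑ z : R × B, ∑ e, Complex.normSq (xv c D0 (E0 e) ψ z - ω z.1 (z.2, e)) ≤ 6 * γ1 + 4 * γ2 := by
  have hcK : (Fintype.card K : ℝ) * Complex.normSq c = 1 := by
    have h3 : ((Complex.normSq c : ℝ) : ℂ) = (((Fintype.card K : ℝ)⁻¹ : ℝ) : ℂ) := by
      rw [← Complex.mul_conj, hc]; push_cast; rfl
    have h4 : Complex.normSq c = (Fintype.card K : ℝ)⁻¹ := by exact_mod_cast h3
    rw [h4]
    exact mul_inv_cancel₀ (by exact_mod_cast Fintype.card_ne_zero)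
  obtain ⟨J, hJ1, hJ2⟩ := exists_embed TB (Q × K) (by rwa [Fintype.card_prod])
  let Om : R → Matrix B E ℂ := fun r => Matrix.of fun b e => ωt r (b, e)
  have hPO : ∀ r, Jᴴ * J * Om r = Om r := by
    intro r
    rw [hJ1]
    ext b e
    simp only [Matrix.diagonal_mul, Om, Matrix.of_apply]
    split_ifs with h
    · simp
    · rw [hTB r b e h]; simp
  have hJJ : (1 - J * Jᴴ).PosSemidef := by
    apply psd_of_idem
    · simp
    · rw [Matrix.mul_assoc, ← Matrix.mul_assoc Jᴴ, hJ1, ← Matrix.mul_assoc, hJ2]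
  have hJc : (1 - Jᴴ * J).PosSemidef := by
    apply psd_of_idem
    · simp
    · rw [hJ1, Matrix.diagonal_mul_diagonal]; congr 1; funext b; split_ifs <;> simp
  let G : TR × TR → Matrix (Q × K) (Q × K) ℂ := fun z => J * (Om z.1 * (Om z.2)ᴴ) * Jᴴ
  obtain ⟨U, hU1, hU2, hU3⟩ := decouple G
  let X : Matrix (TR × K) (Q × E) ℂ := Matrix.of fun x z => (U * J * Om x.1) (z.1, x.2) z.2
  let Y : Matrix (TR × K) ((B × E) × K) ℂ := Ymat K c (fun r : TR => ωt r)
  obtain ⟨W, hW, hWX⟩ := uhlmann X Y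
  have hGf : ∑ z, fsq (G z) ≤ lam := by
    have s1 : ∑ z, fsq (G z) ≤ ∑ z : TR × TR, fsq (Om z.1 * (Om z.2)ᴴ) := by
      refine Finset.sum_le_sum fun z _ => ?_
      refine (fsq_mul_le' _ _ (by simpa using hJc)).trans (fsq_mul_le _ _ hJc)
    refine s1.trans (le_trans ?_ hlam)
    rw [Fintype.sum_prod_type]
    have s2 : ∀ f : R → ℝ, (∀ r, 0 ≤ f r) → ∑ r : TR, f r ≤ ∑ r, f r := by
      intro f hf
      rw [Finset.sum_coe_sort TR f]
      exact Finset.sum_le_univ_sum_of_nonneg hf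
    refine le_trans (Finset.sum_le_sum fun r _ => s2 (fun r' => fsq (Om r * (Om r')ᴴ)) fun r' => fsq_nonneg _) ?_
    exact s2 (fun r => ∑ r', fsq (Om r * (Om r')ᴴ)) fun r => Finset.sum_nonneg fun _ _ => fsq_nonneg _
  have hdev : fsq (Y * Yᴴ - X * Xᴴ) = ∑ z, dev U (G z) := by
    have ent : ∀ r i r' i', (Y * Yᴴ - X * Xᴴ) (r, i) (r', i') =
        -((∑ qq : Q, (U * G (r, r') * Uᴴ) (qq, i) (qq, i')) -
    if i = i' then (Fintype.card K : ℂ)⁻¹ * (G (r, r')).trace else 0) := by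
      intro r i r' i'
      rw [neg_sub, Matrix.sub_apply]
      congr 1
      · have tr : (G (r, r')).trace = ∑ y, ωt r y * conj (ωt r' y) := by
          simp only [G]
          rw [Matrix.trace_mul_comm, ← Matrix.mul_assoc, ← Matrix.mul_assoc, hPO]
          simp only [Matrix.trace, Matrix.diag, Matrix.mul_apply, Om, Matrix.conjTranspose_apply,
            Matrix.of_apply, Complex.star_def, Fintype.sum_prod_type]
        rw [tr]
        simp only [Matrix.mul_apply, Y, Ymat, Matrix.conjTranspose_apply, Matrix.of_apply]
        rw [Fintype.sum_prod_type]
        simp only [ite_mul, zero_mul, Finset.sum_ite_eq, Finset.mem_univ, if_true, apply_ite,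
          star_zero, mul_zero, Complex.star_def, map_mul, map_zero]
        by_cases h : i = i'
        · subst h
          simp only [if_true]
          rw [Finset.mul_sum]
          refine Finset.sum_congr rfl fun y _ => ?_
          linear_combination (ωt r y * conj (ωt r' y)) * hc
        · simp [h, Ne.symm h]
      · have : U * G (r, r') * Uᴴ = (U * J * Om r) * (U * J * Om r')ᴴ := by
          simp only [G, Matrix.conjTranspose_mul, Matrix.mul_assoc]
        rw [this]
        simp only [Matrix.mul_apply (M := X), Matrix.mul_apply (M := U * J * Om r), X,
          Matrix.conjTranspose_apply, Matrix.of_apply, Fintype.sum_prod_type]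
    unfold fsq dev
    simp only [Fintype.sum_prod_type]
    refine Finset.sum_congr rfl fun r _ => ?_
    rw [Finset.sum_comm]
    refine Finset.sum_congr rfl fun r' _ => ?_
    refine Finset.sum_congr rfl fun i _ => Finset.sum_congr rfl fun i' _ => ?_
    rw [ent, Complex.normSq_neg]
  have hqpos : (0 : ℝ) < Fintype.card Q := by exact_mod_cast Fintype.card_pos
  have hYW : fsq (Y * W - X) ≤ γ2 := by
    rw [hdev, Fintype.card_prod, Fintype.card_coe] at hWX
    push_cast at hWX
    have a1 : (TR.card * Fintype.card K : ℝ) * (Fintype.card Q * ∑ z, dev U (G z)) ≤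
        (TR.card * Fintype.card K : ℝ) * (2 * lam) :=
      mul_le_mul_of_nonneg_left (hU3.trans (by linarith)) (by positivity)
    have a2 : (Fintype.card Q : ℝ) * fsq (Y * W - X) ^ 2 ≤ Fintype.card Q * γ2 ^ 2 := by
      have := mul_le_mul_of_nonneg_left hWX hqpos.le
      linarith
    have a3 := le_of_mul_le_mul_left a2 hqpos
    exact (sq_le_sq₀ (fsq_nonneg _) hγ2).mp a3
  let D0 : Matrix B (Q × K) ℂ := (U * J)ᴴ
  have hD : (1 - D0ᴴ * D0).PosSemidef := by
    have := psd_mul Jᴴ Uᴴ (by simpa using hJJ) (psd_of_isometry _ (by simpa using hU1))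
    have e : D0 = Jᴴ * Uᴴ := by simp only [D0, Matrix.conjTranspose_mul]
    rwa [e]
  have hWc := fsq_nonneg (Y * W - X)
  refine ⟨fun e => Matrix.of fun qq z => ∑ y, Vn y z.1 * W (y, z.2) (qq, e), D0, ?_, hD, ?_⟩
  · let V1 : Matrix ((B × E) × K) (A × K) ℂ := Matrix.of fun y z => if y.2 = z.2 then Vn y.1 z.1 else 0
    have hV1 : V1ᴴ * V1 = 1 := by
      ext ⟨a, i⟩ ⟨a', i'⟩
      have hv := congrFun (congrFun hV a) a'
      simp only [Matrix.mul_apply, Matrix.conjTranspose_apply, Matrix.one_apply] at hv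
      simp only [Matrix.mul_apply, V1, Matrix.conjTranspose_apply, Matrix.of_apply, Matrix.one_apply,
        Prod.mk.injEq]
      rw [Fintype.sum_prod_type]
      by_cases h : i = i'
      · subst h
        simp only [mul_ite, mul_zero, Finset.sum_ite_eq', Finset.mem_univ, if_true, and_true]
        exact hv
      · have : i' ≠ i := fun e => h e.symm
        simp [h, this, apply_ite]
    have hWT : (1 - (Wᵀ)ᴴ * Wᵀ).PosSemidef := by
      have := hW.transpose
      have e : (1 - (Wᵀ)ᴴ * Wᵀ) = (1 - W * Wᴴ)ᵀ := by
        rw [Matrix.transpose_sub, Matrix.transpose_one, Matrix.transpose_mul]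
        rfl
      rwa [e]
    have hWV := psd_mul Wᵀ V1 hWT (psd_of_isometry _ hV1)
    convert hWV using 2
    have ent : ∀ qq e z, (Wᵀ * V1) (qq, e) z = ∑ y, Vn y z.1 * W (y, z.2) (qq, e) := by
      intro qq e z
      simp only [Matrix.mul_apply, V1, Matrix.transpose_apply, Matrix.of_apply]
      rw [Fintype.sum_prod_type]
      refine Finset.sum_congr rfl fun y _ => ?_
      simp [mul_comm]
    ext z z'
    rw [Matrix.sum_apply, Matrix.mul_apply, Fintype.sum_prod_type, Finset.sum_comm]
    refine Finset.sum_congr rfl fun e _ => ?_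
    rw [Matrix.mul_apply]
    refine Finset.sum_congr rfl fun qq _ => ?_
    simp only [Matrix.conjTranspose_apply, ent, Matrix.of_apply]
  · have hsum : ∑ z : R × B, ∑ e, Complex.normSq (xv c D0 ((fun e => Matrix.of fun qq (z : A × K) =>
        ∑ y, Vn y z.1 * W (y, z.2) (qq, e)) e) ψ z - ω z.1 (z.2, e)) =
        fsq (Lmap c D0 W ω - mkM ω) := by
      unfold fsq
      rw [Fintype.sum_prod_type, Finset.sum_comm]
      refine Finset.sum_congr rfl fun b _ => ?_
      rw [Fintype.sum_prod_type]
      refine Finset.sum_congr rfl fun r _ =>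
        Finset.sum_congr rfl fun e _ => ?_
      congr 1
      simp only [Matrix.sub_apply, mkM, Lmap, Matrix.of_apply]
      congr 1
      rw [xv_eq]
      refine Finset.sum_congr rfl fun x _ => ?_
      congr 2
      simp only [Matrix.of_apply, hω, Finset.sum_mul, Finset.mul_sum]
      rw [Finset.sum_comm]
      refine Finset.sum_congr rfl fun y _ => Finset.sum_congr rfl fun a _ => ?_
      ring
    rw [hsum]
    have hdec : Lmap c D0 W ω - mkM ω = (Lmap c D0 W (fun r y => ω r y - ωt r y)) +
        ((Lmap c D0 W ωt - mkM ωt) + mkM (fun r y => ωt r y - ω r y)) := by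
      have : Lmap c D0 W ω = Lmap c D0 W (fun r y => (ω r y - ωt r y)) + Lmap c D0 W ωt := by
        rw [← Lmap_add]; simp
      rw [this]
      have : mkM (fun r y => ωt r y - ω r y) = mkM ωt - mkM ω := by ext; simp [mkM]
      rw [this]; abel
    rw [hdec]
    have b1 := (Lmap_fsq c hcK D0 hD W hW (fun r y => ω r y - ωt r y)).trans h1
    have b3 : fsq (mkM (fun r y => ωt r y - ω r y)) ≤ γ1 := by
      refine le_trans (le_of_eq (mkM_fsq _)) ?_
      refine le_trans (le_of_eq ?_) h1
      refine Finset.sum_congr rfl fun r _ => Finset.sum_congr rfl fun y _ => ?_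
      rw [← Complex.normSq_neg, neg_sub]
    have b2 : fsq (Lmap c D0 W ωt - mkM ωt) ≤ γ2 := by
      let M : Matrix (Q × K) (R × E) ℂ := Matrix.of fun x z =>
        if h : z.1 ∈ TR then (Y * W - X) (⟨z.1, h⟩, x.2) (x.1, z.2) else 0
      have e : Lmap c D0 W ωt - mkM ωt = D0 * M := by
        have hmkr : ∀ r, D0 * (U * J * Om r) = Om r := by
          intro r
          simp only [D0]
          rw [← Matrix.mul_assoc, Matrix.conjTranspose_mul, Matrix.mul_assoc Jᴴ Uᴴ,
            ← Matrix.mul_assoc Uᴴ, hU2, Matrix.one_mul, hPO]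
        ext b ⟨r, e⟩
        have h0 : mkM ωt b (r, e) = ∑ x, D0 b x * (U * J * Om r) x e := by
          rw [← Matrix.mul_apply, hmkr]; rfl
        rw [Matrix.sub_apply, h0, Matrix.mul_apply]
        simp only [Lmap, Matrix.of_apply]
        rw [← Finset.sum_sub_distrib]
        refine Finset.sum_congr rfl fun x _ => ?_
        rw [← mul_sub]
        congr 1
        simp only [M, Matrix.of_apply]
        split_ifs with h
        · rw [Matrix.sub_apply, Ymat_mul]; rfl
        · have z1 : Om r = 0 := by ext b e; simp [Om, hTR r h]
          simp [z1, hTR r h]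
      rw [e]
      refine (fsq_mul_le _ _ hD).trans (le_trans (le_of_eq ?_) hYW)
      have : ∀ x : Q × K, ∑ z : R × E, Complex.normSq (M x z) =
          ∑ r : TR, ∑ e, Complex.normSq ((Y * W - X) (r, x.2) (x.1, e)) := by
        intro x
        rw [Fintype.sum_prod_type]
        have z : ∀ r, ∑ e, Complex.normSq (M x (r, e)) = if h : r ∈ TR then
          ∑ e, Complex.normSq ((Y * W - X) (⟨r, h⟩, x.2) (x.1, e)) else 0 := by
          intro r
          simp only [M, Matrix.of_apply]
          split_ifs <;> simp
        simp only [z]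
        rw [← Finset.sum_subset (Finset.subset_univ TR)]
        · rw [← Finset.sum_attach TR]
          rw [Finset.univ_eq_attach]
          refine Finset.sum_congr rfl fun r _ => ?_
          rw [dif_pos r.2]
        · intro r _ hr; rw [dif_neg hr]
      unfold fsq
      simp only [this]
      simp only [Fintype.sum_prod_type]
      have sw : ∀ f : Q → K → TR → E → ℝ, ∑ q, ∑ i, ∑ r, ∑ e, f q i r e = ∑ r, ∑ i, ∑ q, ∑ e, f q i r e := by
        intro f
        rw [Finset.sum_comm]
        have : ∀ i, ∑ q, ∑ r, ∑ e, f q i r e = ∑ r, ∑ q, ∑ e, f q i r e := fun i => Finset.sum_comm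
        simp only [this]
        rw [Finset.sum_comm]
      exact sw _
    have c1 := fsq_add_le (Lmap c D0 W (fun r y => ω r y - ωt r y))
        ((Lmap c D0 W ωt - mkM ωt) + mkM (fun r y => ωt r y - ω r y))
    have c2 := fsq_add_le (Lmap c D0 W ωt - mkM ωt) (mkM (fun r y => ωt r y - ω r y))
    linarith
end oneshot

section typical
variable {R B E A Q K : Type} [Fintype R] [Fintype B] [Fintype E] [Fintype A] [Fintype Q] [Fintype K]
  [DecidableEq R] [DecidableEq B] [DecidableEq E] [DecidableEq A] [DecidableEq Q] [DecidableEq K]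

lemma fsq_swap (Z : Matrix R E ℂ) : fsq (Z * Zᴴ) = fsq (Zᴴ * Z) := by
  have h : ((fsq (Z * Zᴴ) : ℝ) : ℂ) = ((fsq (Zᴴ * Z) : ℝ) : ℂ) := by
    rw [fsq_trace, fsq_trace]
    simp only [Matrix.conjTranspose_mul, Matrix.conjTranspose_conjTranspose]
    rw [Matrix.trace_mul_comm (Zᴴ * Z)]
    simp only [Matrix.mul_assoc]
    rw [Matrix.trace_mul_comm Z]
    simp only [Matrix.mul_assoc]
  exact_mod_cast h

lemma core (Z : Matrix R E ℂ) (pE : E → ℝ) (hp0 : ∀ e, 0 ≤ pE e) (hp1 : ∑ e, pE e = 1)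
    (hE : ∀ e e', ∑ r, Z r e * conj (Z r e') = if e = e' then (pE e : ℂ) else 0)
    (TE : Finset E) (lam : ℝ) (hl : ∀ e ∈ TE, pE e ≤ lam) (hlam : 0 ≤ lam) :
    ∑ r, ∑ r', Complex.normSq (∑ e ∈ TE, Z r e * conj (Z r' e)) ≤ lam := by
  let Z0 : Matrix R E ℂ := Matrix.of fun r e => if e ∈ TE then Z r e else 0
  have h1 : ∑ r, ∑ r', Complex.normSq (∑ e ∈ TE, Z r e * conj (Z r' e)) = fsq (Z0 * Z0ᴴ) := by
    unfold fsq
    refine Finset.sum_congr rfl fun r _ => Finset.sum_congr rfl fun r' _ => ?_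
    congr 1
    rw [Matrix.mul_apply, ← Finset.sum_filter_add_sum_filter_not Finset.univ (fun e => e ∈ TE)]
    rw [Finset.sum_eq_zero (s := Finset.univ.filter (fun e => ¬ e ∈ TE)), add_zero]
    · have : Finset.univ.filter (fun e => e ∈ TE) = TE := by ext; simp
      rw [this]
      refine Finset.sum_congr rfl fun e he => ?_
      simp [Z0, he]
    · intro e he
      simp only [Finset.mem_filter] at he
      simp [Z0, he.2]
  rw [h1, fsq_swap]
  have h2 : ∀ e e', (Z0ᴴ * Z0) e e' = if e = e' then (if e ∈ TE then (pE e : ℂ) else 0) else 0 := by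
    intro e e'
    simp only [Matrix.mul_apply, Matrix.conjTranspose_apply, Z0, Matrix.of_apply]
    by_cases he : e ∈ TE
    · by_cases he' : e' ∈ TE
      · simp only [he, he', if_true]
        have := hE e' e
        simp only [mul_comm (Z _ e')] at this
        simp only [Complex.star_def]
        refine this.trans ?_
        by_cases h : e = e'
        · subst h; simp
        · simp [h, Ne.symm h]
      · have : e ≠ e' := fun h => he' (h ▸ he)
        simp [he', this]
    · simp [he]
  unfold fsq
  have h3 : ∀ e, ∑ e', Complex.normSq ((Z0ᴴ * Z0) e e') ≤ lam * pE e := by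
    intro e
    rw [Finset.sum_eq_single e]
    · rw [h2, if_pos rfl]
      split_ifs with he
      · rw [Complex.normSq_ofReal]; exact mul_le_mul_of_nonneg_right (hl e he) (hp0 e)
      · rw [map_zero]; exact mul_nonneg hlam (hp0 e)
    · intro e' _ h; rw [h2, if_neg (Ne.symm h), map_zero]
    · intro h; exact absurd (Finset.mem_univ _) h
  refine (Finset.sum_le_sum fun e _ => h3 e).trans ?_
  rw [← Finset.mul_sum, hp1, mul_one]

lemma core_mass (Z : Matrix R E ℂ) (pE : E → ℝ) (hp0 : ∀ e, 0 ≤ pE e) (hp1 : ∑ e, pE e = 1)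
    (hE : ∀ e e', ∑ r, Z r e * conj (Z r e') = if e = e' then (pE e : ℂ) else 0)
    (TE : Finset E) (lam : ℝ) (hl : ∀ e ∈ TE, pE e ≤ lam) (hlam : 0 ≤ lam) (T : Finset R) :
    (∑ r ∈ T, ∑ e ∈ TE, Complex.normSq (Z r e)) ^ 2 ≤ T.card * lam := by
  have h1 := sq_sum_le_card_mul_sum_sq (s := T) (f := fun r => ∑ e ∈ TE, Complex.normSq (Z r e))
  refine h1.trans (mul_le_mul_of_nonneg_left ?_ (Nat.cast_nonneg _))
  refine le_trans ?_ (core Z pE hp0 hp1 hE TE lam hl hlam)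
  refine le_trans (Finset.sum_le_univ_sum_of_nonneg fun r => sq_nonneg _) ?_
  refine Finset.sum_le_sum fun r _ => ?_
  refine le_trans (le_of_eq ?_) (Finset.single_le_sum (f := fun r' => Complex.normSq (∑ e ∈ TE, Z r e * conj (Z r' e)))
    (fun _ _ => Complex.normSq_nonneg _) (Finset.mem_univ r))
  simp only [Complex.mul_conj]
  rw [← Complex.ofReal_sum, Complex.normSq_ofReal, sq]

lemma oneshot2 [Nonempty Q] [Nonempty K] (Vn : Matrix (B × E) A ℂ) (hV : Vnᴴ * Vn = 1)
    (ψ : R → A → ℂ) (ω : R → B × E → ℂ) (hω : ∀ r y, ω r y = ∑ a, Vn y a * ψ r a)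
    (pR : R → ℝ) (pB : B → ℝ) (pE : E → ℝ)
    (hR : ∀ r, ∑ b, ∑ e, Complex.normSq (ω r (b, e)) = pR r)
    (hB : ∀ b, ∑ r, ∑ e, Complex.normSq (ω r (b, e)) = pB b)
    (hE : ∀ e e', ∑ r, ∑ b, ω r (b, e) * conj (ω r (b, e')) = if e = e' then (pE e : ℂ) else 0)
    (hp0 : ∀ e, 0 ≤ pE e) (hp1 : ∑ e, pE e = 1)
    (TR : Finset R) (TB : Finset B) (TE : Finset E)
    (hcard : TB.card ≤ Fintype.card Q * Fintype.card K) (lam γ γ2 : ℝ) (hlam : 0 ≤ lam)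
    (hl : ∀ e ∈ TE, pE e ≤ lam)
    (mR : ∑ r ∈ TRᶜ, pR r ≤ γ) (mB : ∑ b ∈ TBᶜ, pB b ≤ γ) (mE : ∑ e ∈ TEᶜ, pE e ≤ γ)
    (hγ2 : 0 ≤ γ2)
    (h2 : TR.card * Fintype.card K * (2 * lam) ≤ Fintype.card Q * γ2 ^ 2)
    (c : ℂ) (hc : c * conj c = (Fintype.card K : ℂ)⁻¹) :
    ∃ (E0 : E → Matrix Q (A × K) ℂ) (D0 : Matrix B (Q × K) ℂ),
      (1 - ∑ j, (E0 j)ᴴ * E0 j).PosSemidef ∧ (1 - D0ᴴ * D0).PosSemidef ∧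
      ∑ z : R × B, ∑ e, Complex.normSq (xv c D0 (E0 e) ψ z - ω z.1 (z.2, e)) ≤ 18 * γ + 4 * γ2 := by
  have hE' : ∀ e, ∑ r, ∑ b, Complex.normSq (ω r (b, e)) = pE e := by
    intro e
    have := hE e e
    simp only [Complex.mul_conj, if_true] at this
    exact_mod_cast this
  let ωt : R → B × E → ℂ := fun r y => if r ∈ TR ∧ y.1 ∈ TB ∧ y.2 ∈ TE then ω r y else 0
  have key := oneshot Vn hV ψ ω ωt hω TR TB (fun r hr y => by simp [ωt, hr])
    (fun r b e hb => by simp [ωt, hb]) hcard lam (3 * γ) γ2 ?_ ?_ hγ2 h2 c hc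
  · obtain ⟨E0, D0, a, b, h⟩ := key
    exact ⟨E0, D0, a, b, h.trans (by linarith)⟩
  · let Z : Matrix (R × B) E ℂ := Matrix.of fun x e => ω x.1 (x.2, e)
    have hc := core Z pE hp0 hp1 (fun e e' => by
      rw [← hE e e', Fintype.sum_prod_type]; rfl) TE lam hl hlam
    refine le_trans ?_ hc
    simp only [fsq, Fintype.sum_prod_type]
    refine Finset.sum_le_sum fun r _ => ?_
    rw [Finset.sum_comm]
    refine Finset.sum_le_sum fun b _ => Finset.sum_le_sum fun r' _ => Finset.sum_le_sum fun b' _ => ?_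
    simp only [Matrix.mul_apply, Matrix.conjTranspose_apply, Matrix.of_apply, ωt]
    by_cases h : r ∈ TR ∧ b ∈ TB
    · by_cases h' : r' ∈ TR ∧ b' ∈ TB
      · apply le_of_eq
        congr 1
        simp only [h.1, h.2, h'.1, h'.2, true_and]
        rw [← Finset.sum_filter_add_sum_filter_not Finset.univ (fun e => e ∈ TE)]
        rw [Finset.sum_eq_zero (s := Finset.univ.filter (fun e => ¬ e ∈ TE)), add_zero]
        · have : Finset.univ.filter (fun e => e ∈ TE) = TE := by ext; simp
          rw [this]
          refine Finset.sum_congr rfl fun e he => ?_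
          simp [Z, he]
        · intro e he
          simp only [Finset.mem_filter] at he
          simp [he.2]
      · rw [Finset.sum_eq_zero]
        · rw [map_zero]; exact Complex.normSq_nonneg _
        · intro e _
          rw [if_neg (fun h => h' ⟨h.1, h.2.1⟩ : ¬ (r' ∈ TR ∧ b' ∈ TB ∧ e ∈ TE))]; simp
    · rw [Finset.sum_eq_zero]
      · rw [map_zero]; exact Complex.normSq_nonneg _
      · intro e _
        rw [if_neg (fun h' => h ⟨h'.1, h'.2.1⟩ : ¬ (r ∈ TR ∧ b ∈ TB ∧ e ∈ TE))]; simp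
  · have pt : ∀ r b e, Complex.normSq (ω r (b, e) - ωt r (b, e)) ≤
        (if r ∈ TR then 0 else Complex.normSq (ω r (b, e))) +
        (if b ∈ TB then 0 else Complex.normSq (ω r (b, e))) +
        (if e ∈ TE then 0 else Complex.normSq (ω r (b, e))) := by
      intro r b e
      have := Complex.normSq_nonneg (ω r (b, e))
      simp only [ωt]
      by_cases h1 : r ∈ TR <;> by_cases h2 : b ∈ TB <;> by_cases h3 : e ∈ TE <;>
        simp [h1, h2, h3] <;> linarith
    have aux : ∀ {ι : Type} [Fintype ι] [DecidableEq ι] (T : Finset ι) (f : ι → ℝ),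
        ∑ i, (if i ∈ T then 0 else f i) = ∑ i ∈ Tᶜ, f i := by
      intro ι _ _ T f
      rw [← Finset.sum_filter_add_sum_filter_not Finset.univ (fun e => e ∈ T)]
      rw [Finset.sum_eq_zero (s := Finset.univ.filter (fun e => e ∈ T)), zero_add]
      · have : Finset.univ.filter (fun e => ¬ e ∈ T) = Tᶜ := by ext; simp
        rw [this]
        refine Finset.sum_congr rfl fun e he => ?_
        rw [if_neg (by simpa using he)]
      · intro e he
        simp only [Finset.mem_filter] at he
        simp [he.2]
    calc _ ≤ ∑ r, ∑ b, ∑ e, ((if r ∈ TR then 0 else Complex.normSq (ω r (b, e))) +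
        (if b ∈ TB then 0 else Complex.normSq (ω r (b, e))) +
        (if e ∈ TE then 0 else Complex.normSq (ω r (b, e)))) := by
          refine Finset.sum_le_sum fun r _ => ?_
          rw [Fintype.sum_prod_type]
          exact Finset.sum_le_sum fun b _ => Finset.sum_le_sum fun e _ => pt r b e
      _ = ∑ r ∈ TRᶜ, pR r + ∑ b ∈ TBᶜ, pB b + ∑ e ∈ TEᶜ, pE e := by
          simp only [Finset.sum_add_distrib]
          congr 1
          · congr 1
            · rw [← aux]
              refine Finset.sum_congr rfl fun r _ => ?_
              rw [← hR]
              split_ifs <;> simp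
            · rw [← aux, Finset.sum_comm]
              refine Finset.sum_congr rfl fun r _ => ?_
              rw [← hB]
              split_ifs <;> simp
          · rw [← aux]
            have : ∀ r, ∑ b, ∑ e, (if e ∈ TE then 0 else Complex.normSq (ω r (b, e))) =
              ∑ e, ∑ b, (if e ∈ TE then 0 else Complex.normSq (ω r (b, e))) := fun r => Finset.sum_comm
            simp only [this]
            rw [Finset.sum_comm]
            refine Finset.sum_congr rfl fun r _ => ?_
            rw [← hE']
            split_ifs <;> simp
      _ ≤ 3 * γ := by linarith

/-- total-mass bound -/
lemma mass_low (ω : R → B × E → ℂ) (pR : R → ℝ) (pB : B → ℝ) (pE : E → ℝ)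
    (hR : ∀ r, ∑ b, ∑ e, Complex.normSq (ω r (b, e)) = pR r)
    (hB : ∀ b, ∑ r, ∑ e, Complex.normSq (ω r (b, e)) = pB b)
    (hE : ∀ e e', ∑ r, ∑ b, ω r (b, e) * conj (ω r (b, e')) = if e = e' then (pE e : ℂ) else 0)
    (hp0 : ∀ e, 0 ≤ pE e) (hp1 : ∑ e, pE e = 1)
    (TR : Finset R) (TB : Finset B) (TE : Finset E) (lam γ : ℝ) (hlam : 0 ≤ lam)
    (hl : ∀ e ∈ TE, pE e ≤ lam)
    (mR : ∑ r ∈ TRᶜ, pR r ≤ γ) (mB : ∑ b ∈ TBᶜ, pB b ≤ γ) (mE : ∑ e ∈ TEᶜ, pE e ≤ γ)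
    (hγ : γ ≤ 1 / 6) : 1 / 4 ≤ TR.card * TB.card * lam := by
  have hE' : ∀ e, ∑ r, ∑ b, Complex.normSq (ω r (b, e)) = pE e := by
    intro e
    have := hE e e
    simp only [Complex.mul_conj, if_true] at this
    exact_mod_cast this
  let Z : Matrix (R × B) E ℂ := Matrix.of fun x e => ω x.1 (x.2, e)
  have h1 := core_mass Z pE hp0 hp1 (fun e e' => by
      rw [← hE e e', Fintype.sum_prod_type]; rfl) TE lam hl hlam (TR ×ˢ TB)
  rw [Finset.card_product] at h1
  push_cast at h1
  refine le_trans ?_ h1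
  set S := ∑ r ∈ TR ×ˢ TB, ∑ e ∈ TE, Complex.normSq (Z r e)
  have hS : 1 ≤ S + (∑ r ∈ TRᶜ, pR r + ∑ b ∈ TBᶜ, pB b + ∑ e ∈ TEᶜ, pE e) := by
    have t1 : ∑ e ∈ TE, pE e + ∑ e ∈ TEᶜ, pE e = 1 := by rw [Finset.sum_add_sum_compl, hp1]
    have n0 : ∀ x, 0 ≤ ∑ e ∈ TE, Complex.normSq (Z x e) := fun x =>
      Finset.sum_nonneg fun _ _ => Complex.normSq_nonneg _
    have t2 : ∑ e ∈ TE, pE e = ∑ x, ∑ e ∈ TE, Complex.normSq (Z x e) := by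
      rw [Finset.sum_comm]
      refine Finset.sum_congr rfl fun e _ => ?_
      rw [← hE' e, Fintype.sum_prod_type]; rfl
    have t3 : ∑ x, ∑ e ∈ TE, Complex.normSq (Z x e) ≤ S + (∑ r ∈ TRᶜ, pR r + ∑ b ∈ TBᶜ, pB b) := by
      rw [← Finset.sum_add_sum_compl (TR ×ˢ TB)]
      refine add_le_add (le_refl _) ?_
      have sub : (TR ×ˢ TB)ᶜ ⊆ (TRᶜ ×ˢ Finset.univ) ∪ (Finset.univ ×ˢ TBᶜ) := by
        intro x hx
        simp only [Finset.mem_compl, Finset.mem_product, Finset.mem_union, Finset.mem_univ, true_and,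
          and_true] at hx ⊢
        tauto
      refine (Finset.sum_le_sum_of_subset_of_nonneg sub fun x _ _ => n0 x).trans ?_
      refine le_trans (le_of_le_of_eq (le_add_of_nonneg_right (Finset.sum_nonneg fun x _ => n0 x))
        (Finset.sum_union_inter)) ?_
      have n1 : ∀ x, ∑ e ∈ TE, Complex.normSq (Z x e) ≤ ∑ e, Complex.normSq (Z x e) := fun x =>
        Finset.sum_le_univ_sum_of_nonneg fun _ => Complex.normSq_nonneg _
      refine add_le_add ?_ ?_
      · refine (Finset.sum_le_sum fun x _ => n1 x).trans (le_of_eq ?_)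
        rw [Finset.sum_product]
        exact Finset.sum_congr rfl fun r _ => hR r
      · refine (Finset.sum_le_sum fun x _ => n1 x).trans (le_of_eq ?_)
        rw [Finset.sum_product, Finset.sum_comm]
        exact Finset.sum_congr rfl fun r _ => hB r
    linarith
  have : 1 / 2 ≤ S := by linarith
  nlinarith
end typical

section aep
variable {ι : Type} [Fintype ι] [DecidableEq ι]

lemma sum_cons {n : ℕ} (F : (Fin (n + 1) → ι) → ℝ) :
    ∑ x, F x = ∑ i, ∑ y : Fin n → ι, F (Fin.cons i y) := by
  rw [← Fintype.sum_prod_type']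
  exact (Fintype.sum_equiv (Fin.consEquiv (fun _ => ι)) _ _ fun x => rfl).symm

lemma iid_moments (p f : ι → ℝ) (h1 : ∑ i, p i = 1) (h0 : ∑ i, p i * f i = 0) (n : ℕ) :
    (∑ x : Fin n → ι, ∏ t, p (x t)) = 1 ∧
    (∑ x : Fin n → ι, (∏ t, p (x t)) * ∑ t, f (x t)) = 0 ∧
    (∑ x : Fin n → ι, (∏ t, p (x t)) * (∑ t, f (x t)) ^ 2) = n * ∑ i, p i * f i ^ 2 := by
  induction n with
  | zero => simp
  | succ n ih =>
    obtain ⟨a, b, c⟩ := ih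
    refine ⟨?_, ?_, ?_⟩
    · rw [sum_cons]
      simp only [Fin.prod_univ_succ, Fin.cons_zero, Fin.cons_succ, ← Finset.mul_sum, a, mul_one, h1]
    · rw [sum_cons]
      have : ∀ i (y : Fin n → ι), (∏ t, p ((Fin.cons i y : Fin (n+1) → ι) t)) * ∑ t, f ((Fin.cons i y : Fin (n+1) → ι) t)
          = (p i * f i) * (∏ t, p (y t)) + p i * ((∏ t, p (y t)) * ∑ t, f (y t)) := by
        intro i y
        simp only [Fin.prod_univ_succ, Fin.sum_univ_succ, Fin.cons_zero, Fin.cons_succ]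
        ring
      simp only [this, Finset.sum_add_distrib, ← Finset.mul_sum, a, b, mul_one, mul_zero, h0,
        Finset.sum_const_zero, add_zero]
    · rw [sum_cons]
      have : ∀ i (y : Fin n → ι), (∏ t, p ((Fin.cons i y : Fin (n+1) → ι) t)) * (∑ t, f ((Fin.cons i y : Fin (n+1) → ι) t)) ^ 2
          = (p i * f i ^ 2) * (∏ t, p (y t)) + (2 * (p i * f i)) * ((∏ t, p (y t)) * ∑ t, f (y t))
            + p i * ((∏ t, p (y t)) * (∑ t, f (y t)) ^ 2) := by
        intro i y
        simp only [Fin.prod_univ_succ, Fin.sum_univ_succ, Fin.cons_zero, Fin.cons_succ]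
        ring
      simp only [this, Finset.sum_add_distrib, ← Finset.mul_sum, a, b, c, mul_one, mul_zero,
        Finset.sum_const_zero, add_zero, ← Finset.sum_mul, h1]
      push_cast
      ring

lemma typical (p : ι → ℝ) (hp : ∀ i, 0 ≤ p i) (h1 : ∑ i, p i = 1) (η γ : ℝ) (hη : 0 < η)
    (hγ : 0 < γ) : ∃ N : ℕ, ∀ n, N ≤ n → ∃ T : Finset (Fin n → ι),
      (T.card : ℝ) ≤ 2 ^ ((n : ℝ) * ((∑ i, -(p i * Real.logb 2 (p i))) + η)) ∧
      (∀ x ∈ T, ∏ t, p (x t) ≤ 2 ^ (-(n : ℝ) * ((∑ i, -(p i * Real.logb 2 (p i))) - η))) ∧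
      ∑ x ∈ Tᶜ, ∏ t, p (x t) ≤ γ := by
  set H := ∑ i, -(p i * Real.logb 2 (p i)) with hH
  let f : ι → ℝ := fun i => -Real.logb 2 (p i) - H
  have h0 : ∑ i, p i * f i = 0 := by
    have : ∀ i, p i * f i = -(p i * Real.logb 2 (p i)) - p i * H := by intro i; simp only [f]; ring
    simp only [this, Finset.sum_sub_distrib, ← Finset.sum_mul, h1, one_mul]
    rw [hH, sub_self]
  set v := ∑ i, p i * f i ^ 2 with hv
  have hv0 : 0 ≤ v := Finset.sum_nonneg fun i _ => mul_nonneg (hp i) (sq_nonneg _)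
  obtain ⟨N, hN⟩ := exists_nat_ge (v / (γ * η ^ 2))
  refine ⟨N + 1, fun n hn => ?_⟩
  have hnpos : (0 : ℝ) < n := by exact_mod_cast (by omega : 0 < n)
  have hnN : v / (γ * η ^ 2) ≤ n := hN.trans (by exact_mod_cast (by omega : N ≤ n))
  obtain ⟨m0, -, m2⟩ := iid_moments p f h1 h0 n
  classical
  let T : Finset (Fin n → ι) := Finset.univ.filter fun x => (∀ t, 0 < p (x t)) ∧ |∑ t, f (x t)| ≤ n * η
  have hpn : ∀ x : Fin n → ι, 0 ≤ ∏ t, p (x t) := fun x => Finset.prod_nonneg fun t _ => hp _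
  have hval : ∀ x ∈ T, ∏ t, p (x t) = (2 : ℝ) ^ (-(∑ t, f (x t)) - n * H) := by
    intro x hx
    simp only [T, Finset.mem_filter] at hx
    have e : -(∑ t, f (x t)) - n * H = ∑ t, Real.logb 2 (p (x t)) := by
      simp only [f, Finset.sum_sub_distrib, Finset.sum_neg_distrib, Finset.sum_const,
        Finset.card_univ, Fintype.card_fin, nsmul_eq_mul]
      ring
    rw [e, Real.rpow_sum_of_pos (by norm_num)]
    refine Finset.prod_congr rfl fun t _ => ?_
    rw [Real.rpow_logb (by norm_num) (by norm_num) (hx.2.1 t)]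
  refine ⟨T, ?_, ?_, ?_⟩
  · have hlow : ∀ x ∈ T, (2 : ℝ) ^ (-((n : ℝ) * (H + η))) ≤ ∏ t, p (x t) := by
      intro x hx
      rw [hval x hx]
      refine Real.rpow_le_rpow_of_exponent_le (by norm_num) ?_
      simp only [T, Finset.mem_filter] at hx
      have := (abs_le.mp hx.2.2).2
      linarith
    have hs : (T.card : ℝ) * (2 : ℝ) ^ (-((n : ℝ) * (H + η))) ≤ 1 := by
      rw [← m0, ← nsmul_eq_mul]
      exact (Finset.card_nsmul_le_sum T _ _ hlow).trans (Finset.sum_le_univ_sum_of_nonneg hpn)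
    rw [Real.rpow_neg (by norm_num)] at hs
    have hp2 : (0 : ℝ) < 2 ^ ((n : ℝ) * (H + η)) := by positivity
    rwa [← div_eq_mul_inv, div_le_one hp2] at hs
  · intro x hx
    rw [hval x hx]
    refine Real.rpow_le_rpow_of_exponent_le (by norm_num) ?_
    simp only [T, Finset.mem_filter] at hx
    have := (abs_le.mp hx.2.2).1
    linarith
  · have hb : (∑ x ∈ Tᶜ, ∏ t, p (x t)) * (n * η) ^ 2 ≤ n * v := by
      rw [← m2, Finset.sum_mul]
      refine le_trans ?_ (Finset.sum_le_univ_sum_of_nonneg (s := Tᶜ) fun x => mul_nonneg (hpn x) (sq_nonneg _))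
      refine Finset.sum_le_sum fun x hx => ?_
      simp only [T, Finset.mem_compl, Finset.mem_filter, Finset.mem_univ, true_and, not_and_or] at hx
      rcases hx with hx | hx
      · push Not at hx
        obtain ⟨t, ht⟩ := hx
        have : ∏ t, p (x t) = 0 := Finset.prod_eq_zero (Finset.mem_univ t) (le_antisymm ht (hp _))
        simp [this]
      · refine mul_le_mul_of_nonneg_left ?_ (hpn x)
        rw [← sq_abs (∑ t, f (x t))]
        exact pow_le_pow_left₀ (by positivity) (le_of_lt (not_le.mp hx)) 2
    rw [div_le_iff₀ (by positivity)] at hnN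
    have : (∑ x ∈ Tᶜ, ∏ t, p (x t)) * (n * η) ^ 2 ≤ γ * (n * η) ^ 2 := by
      refine hb.trans ?_
      nlinarith
    exact le_of_mul_le_mul_right this (by positivity)
end aep

section P8

lemma vnEnt_roots {m : Type*} [Fintype m] [DecidableEq m] (ρ : Matrix m m ℂ)
    (h : ρ.IsHermitian) :
    vnEnt ρ = ((ρ.charpoly.roots).map (fun z : ℂ => -(z.re * Real.logb 2 z.re))).sum := by
  rw [h.roots_charpoly_eq_eigenvalues, vnEnt, dif_pos h, Multiset.map_map]
  simp only [Function.comp_def]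
  rfl

lemma vnEnt_dual {m n : Type*} [Fintype m] [DecidableEq m] [Fintype n] [DecidableEq n]
    (Z : Matrix m n ℂ) : vnEnt (Z * Zᴴ) = vnEnt ((Zᴴ * Z)ᵀ) := by
  have h1 : (Z * Zᴴ).IsHermitian := Matrix.isHermitian_mul_conjTranspose_self Z
  have h2 : ((Zᴴ * Z)ᵀ).IsHermitian := (Matrix.isHermitian_conjTranspose_mul_self Z).transpose
  rw [vnEnt_roots _ h1, vnEnt_roots _ h2, charpoly_transpose]
  have hc := Matrix.charpoly_mul_comm' Z Zᴴ
  have hr := congrArg (fun p : Polynomial ℂ =>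
    (p.roots.map (fun z : ℂ => -(z.re * Real.logb 2 z.re))).sum) hc
  rw [Polynomial.roots_mul (mul_ne_zero (pow_ne_zero _ Polynomial.X_ne_zero)
      (Matrix.charpoly_monic _).ne_zero),
    Polynomial.roots_mul (mul_ne_zero (pow_ne_zero _ Polynomial.X_ne_zero)
      (Matrix.charpoly_monic _).ne_zero)] at hr
  simpa [Polynomial.roots_pow, Multiset.map_nsmul, Multiset.sum_nsmul] using hr

lemma prod_sum_pi {n : ℕ} {ι : Type*} [Fintype ι] {S : Type*} [CommSemiring S]
    (f : Fin n → ι → S) :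
    ∏ t, ∑ i, f t i = ∑ x : Fin n → ι, ∏ t, f t (x t) := by
  rw [Finset.prod_univ_sum, Fintype.piFinset_univ]

lemma prod_sum_pi2 {n : ℕ} {ι κ : Type*} [Fintype ι] [Fintype κ] {S : Type*} [CommSemiring S]
    (f : Fin n → ι → κ → S) :
    ∏ t, ∑ i, ∑ j, f t i j = ∑ x : Fin n → ι, ∑ y : Fin n → κ, ∏ t, f t (x t) (y t) := by
  rw [prod_sum_pi]
  exact Finset.sum_congr rfl fun x _ => prod_sum_pi _

lemma prod_delta {n : ℕ} {ι : Type*} [DecidableEq ι] (p : ι → ℂ) (x y : Fin n → ι) :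
    ∏ t, (if x t = y t then p (x t) else 0) = if x = y then ∏ t, p (x t) else 0 := by
  by_cases h : x = y
  · subst h; simp
  · rw [if_neg h]
    obtain ⟨t, ht⟩ := Function.ne_iff.mp h
    exact Finset.prod_eq_zero (Finset.mem_univ t) (if_neg ht)

/-- tensor power of an isometry -/
lemma iso_pow {n : ℕ} {ι κ : Type*} [Fintype ι] [Fintype κ] [DecidableEq κ]
    (u : Matrix ι κ ℂ) (hu : uᴴ * u = 1) :
    (Matrix.of fun (x : Fin n → ι) (y : Fin n → κ) => ∏ t, u (x t) (y t))ᴴ *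
      (Matrix.of fun (x : Fin n → ι) (y : Fin n → κ) => ∏ t, u (x t) (y t)) = 1 := by
  ext x y
  simp only [Matrix.mul_apply, conjTranspose_apply, of_apply, star_prod, ← Finset.prod_mul_distrib]
  rw [← prod_sum_pi (fun t i => star (u i (x t)) * u i (y t))]
  have : ∀ t, ∑ i, star (u i (x t)) * u i (y t) = if x t = y t then (1:ℂ) else 0 := by
    intro t
    have := congrFun (congrFun hu (x t)) (y t)
    simpa [Matrix.mul_apply, Matrix.one_apply] using this
  rw [Finset.prod_congr rfl fun t _ => this t, prod_delta (fun _ => (1:ℂ)), Matrix.one_apply]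
  simp

lemma iso_pow2 {n : ℕ} {ι κ A : Type*} [Fintype ι] [Fintype κ] [Fintype A] [DecidableEq A]
    (u : Matrix (ι × κ) A ℂ) (hu : uᴴ * u = 1) :
    (Matrix.of fun (x : (Fin n → ι) × (Fin n → κ)) (y : Fin n → A) =>
        ∏ t, u (x.1 t, x.2 t) (y t))ᴴ *
      (Matrix.of fun (x : (Fin n → ι) × (Fin n → κ)) (y : Fin n → A) =>
        ∏ t, u (x.1 t, x.2 t) (y t)) = 1 := by
  ext x y
  simp only [Matrix.mul_apply, conjTranspose_apply, of_apply, star_prod, ← Finset.prod_mul_distrib]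
  rw [Fintype.sum_prod_type]
  rw [← prod_sum_pi2 (fun t i j => star (u (i, j) (x t)) * u (i, j) (y t))]
  have : ∀ t, ∑ i, ∑ j, star (u (i, j) (x t)) * u (i, j) (y t) =
      if x t = y t then (1:ℂ) else 0 := by
    intro t
    have := congrFun (congrFun hu (x t)) (y t)
    simpa [Matrix.mul_apply, Matrix.one_apply, Fintype.sum_prod_type] using this
  rw [Finset.prod_congr rfl fun t _ => this t, prod_delta (fun _ => (1:ℂ)), Matrix.one_apply]
  simp

/-- inner products are preserved by isometries -/
lemma gram_rot {ι κ : Type*} [Fintype ι] [Fintype κ] [DecidableEq κ]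
    (u : Matrix ι κ ℂ) (hu : uᴴ * u = 1) (f g : κ → ℂ) :
    ∑ i, (∑ j, u i j * f j) * conj (∑ j, u i j * g j) = ∑ j, f j * conj (g j) := by
  have h : star (u *ᵥ g) ⬝ᵥ (u *ᵥ f) = star g ⬝ᵥ f := by
    rw [Matrix.star_mulVec, ← Matrix.dotProduct_mulVec, Matrix.mulVec_mulVec, hu, Matrix.one_mulVec]
  simp only [dotProduct, Matrix.mulVec, Pi.star_apply] at h
  calc _ = _ := Finset.sum_congr rfl fun i _ => mul_comm _ _
    _ = _ := h
    _ = _ := Finset.sum_congr rfl fun i _ => mul_comm _ _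

lemma rot_norm1 {ι κ : Type*} [Fintype ι] [Fintype κ] [DecidableEq κ]
    (u : Matrix ι κ ℂ) (hu : uᴴ * u = 1) (f : κ → ℂ) :
    ∑ i, Complex.normSq (∑ j, u i j * f j) = ∑ j, Complex.normSq (f j) := by
  have h := gram_rot u hu f f
  simp only [Complex.mul_conj] at h
  exact_mod_cast h

lemma gram_diag {ι : Type*} {Y : Type*} [Fintype ι] [DecidableEq ι] [Fintype Y]
    (U : Matrix ι ι ℂ) (hU : Uᴴ * U = 1) (p : ι → ℝ) (f : ι → Y → ℂ)
    (hM : (Matrix.of fun i j => ∑ y, f i y * conj (f j y)) =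
      U * diagonal (fun i => (p i : ℂ)) * Uᴴ) (i j : ι) :
    ∑ y, (∑ i', Uᴴ i i' * f i' y) * conj (∑ i', Uᴴ j i' * f i' y) =
      if i = j then (p i : ℂ) else 0 := by
  let X : Matrix ι Y ℂ := Matrix.of f
  have h1 : X * Xᴴ = U * diagonal (fun i => (p i : ℂ)) * Uᴴ := by
    rw [← hM]; ext a b; simp [X, Matrix.mul_apply]
  have h2 : (Uᴴ * X) * (Uᴴ * X)ᴴ = diagonal (fun i => (p i : ℂ)) := by
    rw [Matrix.conjTranspose_mul, Matrix.conjTranspose_conjTranspose]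
    calc Uᴴ * X * (Xᴴ * U) = Uᴴ * (X * Xᴴ) * U := by simp only [Matrix.mul_assoc]
      _ = (Uᴴ * U) * diagonal (fun i => (p i : ℂ)) * (Uᴴ * U) := by
          rw [h1]; simp only [Matrix.mul_assoc]
      _ = _ := by rw [hU]; simp
  have h3 := congrFun (congrFun h2 i) j
  rw [Matrix.diagonal_apply] at h3
  rw [← h3]
  simp only [X, Matrix.mul_apply, Matrix.conjTranspose_apply, of_apply]
  rfl

/-- one-shot simulability with error γ -/
def Sim (Q K : Type) [Fintype Q] [Fintype K] [DecidableEq K] {R A B E : Type} [Fintype R] [Fintype A] [Fintype B]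
    [Fintype E] [DecidableEq A] [DecidableEq Q] (c : ℂ)
    (ψ : R → A → ℂ) (ω : R → B → E → ℂ) (γ : ℝ) : Prop :=
  ∃ (E0 : E → Matrix Q (A × K) ℂ) (D0 : Matrix B (Q × K) ℂ),
      (1 - ∑ j, (E0 j)ᴴ * E0 j).PosSemidef ∧ (1 - D0ᴴ * D0).PosSemidef ∧
      ∑ r, ∑ b, ∑ e, Complex.normSq (xv c D0 (E0 e) ψ (r, b) - ω r b e) ≤ γ

section rot
variable {Q K : Type} [Fintype Q] [Fintype K] [DecidableEq K] {R A B E : Type} [Fintype R]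
  [Fintype A] [Fintype B] [Fintype E] [DecidableEq A] [DecidableEq Q] [DecidableEq R]
  [DecidableEq B] [DecidableEq E]

lemma Sim.rotE {c : ℂ} {ψ : R → A → ℂ} {ω : R → B → E → ℂ} {γ : ℝ} (h : Sim Q K c ψ ω γ)
    (u : Matrix E E ℂ) (hu : uᴴ * u = 1) :
    Sim Q K c ψ (fun r b e => ∑ e', u e e' * ω r b e') γ := by
  obtain ⟨E0, D0, h1, h2, h3⟩ := h
  refine ⟨fun e => ∑ e', u e e' • E0 e', D0, ?_, h2, ?_⟩
  · have : ∑ j, (∑ e', u j e' • E0 e')ᴴ * (∑ e', u j e' • E0 e') = ∑ j, (E0 j)ᴴ * E0 j := by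
      ext x y
      have := fun q => gram_rot u hu (fun e => E0 e q y) (fun e => E0 e q x)
      simp only [Matrix.sum_apply, Matrix.mul_apply, conjTranspose_apply, Matrix.smul_apply, smul_eq_mul]
      rw [Finset.sum_comm]
      conv_rhs => rw [Finset.sum_comm]
      refine Finset.sum_congr rfl fun q _ => ?_
      calc _ = _ := Finset.sum_congr rfl fun i _ => mul_comm _ _
        _ = _ := this q
        _ = _ := Finset.sum_congr rfl fun i _ => mul_comm _ _
    rw [this]; exact h1
  · refine le_trans (le_of_eq ?_) h3
    refine Finset.sum_congr rfl fun r _ => Finset.sum_congr rfl fun b _ => ?_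
    refine Eq.trans ?_ (rot_norm1 u hu _)
    refine Finset.sum_congr rfl fun e _ => ?_
    congr 1
    simp only [mul_sub, Finset.sum_sub_distrib]
    congr 1
    simp only [xv, Matrix.sum_apply, Matrix.smul_apply, smul_eq_mul, Finset.mul_sum, Finset.sum_mul]
    conv_rhs => rw [Finset.sum_comm]
    refine Finset.sum_congr rfl fun a _ => ?_
    conv_rhs => rw [Finset.sum_comm]
    refine Finset.sum_congr rfl fun q _ => ?_
    conv_rhs => rw [Finset.sum_comm]
    refine Finset.sum_congr rfl fun i _ => ?_
    refine Finset.sum_congr rfl fun e' _ => ?_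
    ring

lemma Sim.rotB {c : ℂ} {ψ : R → A → ℂ} {ω : R → B → E → ℂ} {γ : ℝ} (h : Sim Q K c ψ ω γ)
    (u : Matrix B B ℂ) (hu : uᴴ * u = 1) :
    Sim Q K c ψ (fun r b e => ∑ b', u b b' * ω r b' e) γ := by
  obtain ⟨E0, D0, h1, h2, h3⟩ := h
  refine ⟨E0, u * D0, h1, ?_, ?_⟩
  · rw [Matrix.conjTranspose_mul]
    have : D0ᴴ * uᴴ * (u * D0) = D0ᴴ * D0 := by
      calc _ = D0ᴴ * (uᴴ * u) * D0 := by simp only [Matrix.mul_assoc]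
        _ = _ := by rw [hu]; simp
    rw [this]; exact h2
  · refine le_trans (le_of_eq ?_) h3
    refine Finset.sum_congr rfl fun r _ => ?_
    rw [Finset.sum_comm]
    conv_rhs => rw [Finset.sum_comm]
    refine Finset.sum_congr rfl fun e _ => ?_
    refine Eq.trans ?_ (rot_norm1 u hu _)
    refine Finset.sum_congr rfl fun b _ => ?_
    congr 1
    simp only [mul_sub, Finset.sum_sub_distrib]
    congr 1
    simp only [xv, Matrix.mul_apply, Finset.mul_sum, Finset.sum_mul]
    conv_rhs => rw [Finset.sum_comm]
    refine Finset.sum_congr rfl fun a _ => ?_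
    conv_rhs => rw [Finset.sum_comm]
    refine Finset.sum_congr rfl fun q _ => ?_
    conv_rhs => rw [Finset.sum_comm]
    refine Finset.sum_congr rfl fun i _ => ?_
    refine Finset.sum_congr rfl fun e' _ => ?_
    ring

lemma Sim.rotR {c : ℂ} {ψ : R → A → ℂ} {ω : R → B → E → ℂ} {γ : ℝ} (h : Sim Q K c ψ ω γ)
    (u : Matrix R R ℂ) (hu : uᴴ * u = 1) :
    Sim Q K c (fun r a => ∑ r', u r r' * ψ r' a) (fun r b e => ∑ r', u r r' * ω r' b e) γ := by
  obtain ⟨E0, D0, h1, h2, h3⟩ := h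
  refine ⟨E0, D0, h1, h2, ?_⟩
  refine le_trans (le_of_eq ?_) h3
  rw [Finset.sum_comm]
  conv_rhs => rw [Finset.sum_comm]
  refine Finset.sum_congr rfl fun b _ => ?_
  rw [Finset.sum_comm]
  conv_rhs => rw [Finset.sum_comm]
  refine Finset.sum_congr rfl fun e _ => ?_
  refine Eq.trans ?_ (rot_norm1 u hu _)
  refine Finset.sum_congr rfl fun r _ => ?_
  congr 1
  simp only [mul_sub, Finset.sum_sub_distrib]
  congr 1
  simp only [xv]
  conv_rhs => enter [2, r']; rw [Finset.mul_sum]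
  conv_rhs => rw [Finset.sum_comm]
  refine Finset.sum_congr rfl fun a _ => ?_
  rw [Finset.mul_sum]
  refine Finset.sum_congr rfl fun r' _ => ?_
  ring

end rot

end P8

section P9
variable {R A B E : Type} [Fintype R] [Fintype A] [Fintype B] [Fintype E] [DecidableEq A]
  [DecidableEq R] [DecidableEq B] [DecidableEq E]

/-- marginal on R -/
noncomputable def mR (ω : R → B → E → ℂ) : Matrix R R ℂ :=
  Matrix.of fun r r' => ∑ b, ∑ e, ω r b e * conj (ω r' b e)
/-- marginal on B -/
noncomputable def mB (ω : R → B → E → ℂ) : Matrix B B ℂ :=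
  Matrix.of fun b b' => ∑ r, ∑ e, ω r b e * conj (ω r b' e)
/-- marginal on E -/
noncomputable def mE (ω : R → B → E → ℂ) : Matrix E E ℂ :=
  Matrix.of fun e e' => ∑ r, ∑ b, ω r b e * conj (ω r b e')
/-- rotation on R -/
noncomputable def rR (u : Matrix R R ℂ) (ω : R → B → E → ℂ) : R → B → E → ℂ :=
  fun r b e => ∑ r', u r r' * ω r' b e
/-- rotation on B -/
noncomputable def rB (u : Matrix B B ℂ) (ω : R → B → E → ℂ) : R → B → E → ℂ :=
  fun r b e => ∑ b', u b b' * ω r b' e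
/-- rotation on E -/
noncomputable def rE (u : Matrix E E ℂ) (ω : R → B → E → ℂ) : R → B → E → ℂ :=
  fun r b e => ∑ e', u e e' * ω r b e'

lemma mE_rB (u : Matrix B B ℂ) (hu : uᴴ * u = 1) (ω : R → B → E → ℂ) : mE (rB u ω) = mE ω := by
  ext e e'
  exact Finset.sum_congr rfl fun r _ => gram_rot u hu (fun b => ω r b e) (fun b => ω r b e')

lemma mE_rR (u : Matrix R R ℂ) (hu : uᴴ * u = 1) (ω : R → B → E → ℂ) : mE (rR u ω) = mE ω := by
  ext e e'
  simp only [mE, of_apply]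
  rw [Finset.sum_comm]
  conv_rhs => rw [Finset.sum_comm]
  exact Finset.sum_congr rfl fun b _ => gram_rot u hu (fun r => ω r b e) (fun r => ω r b e')

lemma mB_rE (u : Matrix E E ℂ) (hu : uᴴ * u = 1) (ω : R → B → E → ℂ) : mB (rE u ω) = mB ω := by
  ext b b'
  exact Finset.sum_congr rfl fun r _ => gram_rot u hu (fun e => ω r b e) (fun e => ω r b' e)

lemma mB_rR (u : Matrix R R ℂ) (hu : uᴴ * u = 1) (ω : R → B → E → ℂ) : mB (rR u ω) = mB ω := by
  ext b b'
  simp only [mB, of_apply]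
  rw [Finset.sum_comm]
  conv_rhs => rw [Finset.sum_comm]
  exact Finset.sum_congr rfl fun e _ => gram_rot u hu (fun r => ω r b e) (fun r => ω r b' e)

lemma mR_rE (u : Matrix E E ℂ) (hu : uᴴ * u = 1) (ω : R → B → E → ℂ) : mR (rE u ω) = mR ω := by
  ext r r'
  exact Finset.sum_congr rfl fun b _ => gram_rot u hu (fun e => ω r b e) (fun e => ω r' b e)

lemma mR_rB (u : Matrix B B ℂ) (hu : uᴴ * u = 1) (ω : R → B → E → ℂ) : mR (rB u ω) = mR ω := by
  ext r r'
  simp only [mR, of_apply]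
  rw [Finset.sum_comm]
  conv_rhs => rw [Finset.sum_comm]
  exact Finset.sum_congr rfl fun e _ => gram_rot u hu (fun b => ω r b e) (fun b => ω r' b e)

lemma mR_diag (U : Matrix R R ℂ) (hU : Uᴴ * U = 1) (p : R → ℝ) (ω : R → B → E → ℂ)
    (h : mR ω = U * diagonal (fun i => (p i : ℂ)) * Uᴴ) (i j : R) :
    mR (rR Uᴴ ω) i j = if i = j then (p i : ℂ) else 0 := by
  rw [← gram_diag U hU p (fun r (y : B × E) => ω r y.1 y.2)
    (by rw [← h]; ext r r'; simp [mR, Fintype.sum_prod_type]) i j]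
  simp only [mR, rR, of_apply, Fintype.sum_prod_type]

lemma mB_diag (U : Matrix B B ℂ) (hU : Uᴴ * U = 1) (p : B → ℝ) (ω : R → B → E → ℂ)
    (h : mB ω = U * diagonal (fun i => (p i : ℂ)) * Uᴴ) (i j : B) :
    mB (rB Uᴴ ω) i j = if i = j then (p i : ℂ) else 0 := by
  rw [← gram_diag U hU p (fun b (y : R × E) => ω y.1 b y.2)
    (by rw [← h]; ext r r'; simp [mB, Fintype.sum_prod_type]) i j]
  simp only [mB, rB, of_apply, Fintype.sum_prod_type]

lemma mE_diag (U : Matrix E E ℂ) (hU : Uᴴ * U = 1) (p : E → ℝ) (ω : R → B → E → ℂ)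
    (h : mE ω = U * diagonal (fun i => (p i : ℂ)) * Uᴴ) (i j : E) :
    mE (rE Uᴴ ω) i j = if i = j then (p i : ℂ) else 0 := by
  rw [← gram_diag U hU p (fun e (y : R × B) => ω y.1 y.2 e)
    (by rw [← h]; ext r r'; simp [mE, Fintype.sum_prod_type]) i j]
  simp only [mE, rE, of_apply, Fintype.sum_prod_type]

lemma rE_rE (u v : Matrix E E ℂ) (h : u * v = 1) (ω : R → B → E → ℂ) : rE u (rE v ω) = ω := by
  ext r b e
  have : u *ᵥ (v *ᵥ (fun e => ω r b e)) = fun e => ω r b e := by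
    rw [Matrix.mulVec_mulVec, h, Matrix.one_mulVec]
  exact congrFun this e

lemma rB_rB (u v : Matrix B B ℂ) (h : u * v = 1) (ω : R → B → E → ℂ) : rB u (rB v ω) = ω := by
  ext r b e
  have : u *ᵥ (v *ᵥ (fun b => ω r b e)) = fun b => ω r b e := by
    rw [Matrix.mulVec_mulVec, h, Matrix.one_mulVec]
  exact congrFun this b

lemma rR_rR (u v : Matrix R R ℂ) (h : u * v = 1) (ω : R → B → E → ℂ) : rR u (rR v ω) = ω := by
  ext r b e
  have : u *ᵥ (v *ᵥ (fun r => ω r b e)) = fun r => ω r b e := by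
    rw [Matrix.mulVec_mulVec, h, Matrix.one_mulVec]
  exact congrFun this r

/-- diagonalisation of all marginals -/
lemma single (V : Matrix (B × E) A ℂ) (hV : Vᴴ * V = 1) (ψ : R → A → ℂ) (ω : R → B → E → ℂ)
    (hω : ∀ r b e, ω r b e = ∑ a, V (b, e) a * ψ r a) :
    ∃ (uR : Matrix R R ℂ) (uB : Matrix B B ℂ) (uE : Matrix E E ℂ) (pR : R → ℝ) (pB : B → ℝ)
      (pE : E → ℝ) (V' : Matrix (B × E) A ℂ) (ψ' : R → A → ℂ) (ω' : R → B → E → ℂ),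
      uRᴴ * uR = 1 ∧ uBᴴ * uB = 1 ∧ uEᴴ * uE = 1 ∧ V'ᴴ * V' = 1 ∧
      (∀ r b e, ω' r b e = ∑ a, V' (b, e) a * ψ' r a) ∧
      (∀ r a, ψ r a = ∑ r', uR r r' * ψ' r' a) ∧
      ω = rR uR (rB uB (rE uE ω')) ∧
      (∀ i j, mR ω' i j = if i = j then (pR i : ℂ) else 0) ∧
      (∀ i j, mB ω' i j = if i = j then (pB i : ℂ) else 0) ∧
      (∀ i j, mE ω' i j = if i = j then (pE i : ℂ) else 0) ∧
      vnEnt (mR ω) = ∑ i, -(pR i * Real.logb 2 (pR i)) ∧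
      vnEnt (mB ω) = ∑ i, -(pB i * Real.logb 2 (pB i)) ∧
      vnEnt (mE ω) = ∑ i, -(pE i * Real.logb 2 (pE i)) := by
  have hR : (mR ω).IsHermitian := by
    ext i j; simp [mR, mul_comm]
  have hB : (mB ω).IsHermitian := by
    ext i j; simp [mB, mul_comm]
  have hE : (mE ω).IsHermitian := by
    ext i j; simp [mE, mul_comm]
  obtain ⟨uR, r1, r2, r3⟩ := spec _ hR
  obtain ⟨uB, b1, b2, b3⟩ := spec _ hB
  obtain ⟨uE, e1, e2, e3⟩ := spec _ hE
  refine ⟨uR, uB, uE, hR.eigenvalues, hB.eigenvalues, hE.eigenvalues,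
    Matrix.kroneckerMap (· * ·) uBᴴ uEᴴ * V, fun r a => ∑ r', uRᴴ r r' * ψ r' a,
    rE uEᴴ (rB uBᴴ (rR uRᴴ ω)), r1, b1, e1, ?_, ?_, ?_, ?_, ?_, ?_, ?_, ?_, ?_, ?_⟩
  · rw [Matrix.conjTranspose_mul]
    have : (Matrix.kroneckerMap (· * ·) uBᴴ uEᴴ)ᴴ * (Matrix.kroneckerMap (· * ·) uBᴴ uEᴴ) = 1 := by
      rw [Matrix.conjTranspose_kronecker, ← Matrix.mul_kronecker_mul]
      simp [b2, e2]
    calc _ = Vᴴ * ((Matrix.kroneckerMap (· * ·) uBᴴ uEᴴ)ᴴ * (Matrix.kroneckerMap (· * ·) uBᴴ uEᴴ)) * V := by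
          simp only [Matrix.mul_assoc]
      _ = 1 := by rw [this, Matrix.mul_one, hV]
  · intro r b e
    have h1 : ∀ b e, rR uRᴴ ω r b e = ∑ a, V (b, e) a * ∑ r', uRᴴ r r' * ψ r' a := by
      intro b e
      simp only [rR, hω, Finset.mul_sum]
      rw [Finset.sum_comm]
      exact Finset.sum_congr rfl fun a _ => Finset.sum_congr rfl fun r' _ => by ring
    simp only [rE, rB, h1, Matrix.mul_apply, kroneckerMap_apply, Fintype.sum_prod_type]
    have h2 : ∀ φ : A → ℂ, (∑ e', uEᴴ e e' * ∑ b', uBᴴ b b' * ∑ a, V (b', e') a * φ a) =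
        ∑ a, (∑ b', ∑ e', uBᴴ b b' * uEᴴ e e' * V (b', e') a) * φ a := by
      intro φ
      simp only [Finset.mul_sum, Finset.sum_mul]
      rw [Finset.sum_comm]
      conv_rhs => rw [Finset.sum_comm]
      refine Finset.sum_congr rfl fun b' _ => ?_
      rw [Finset.sum_comm]
      exact Finset.sum_congr rfl fun a _ => Finset.sum_congr rfl fun r' _ => by ring
    exact h2 _
  · intro r a
    have : uR *ᵥ (uRᴴ *ᵥ (fun r => ψ r a)) = fun r => ψ r a := by
      rw [Matrix.mulVec_mulVec, r2, Matrix.one_mulVec]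
    exact (congrFun this r).symm
  · rw [rE_rE _ _ e2, rB_rB _ _ b2, rR_rR _ _ r2]
  · have e2' : (uEᴴ)ᴴ * uEᴴ = 1 := by simpa using e2
    have b2' : (uBᴴ)ᴴ * uBᴴ = 1 := by simpa using b2
    rw [mR_rE _ e2', mR_rB _ b2']
    exact mR_diag _ r1 _ _ r3
  · have e2' : (uEᴴ)ᴴ * uEᴴ = 1 := by simpa using e2
    have r2' : (uRᴴ)ᴴ * uRᴴ = 1 := by simpa using r2
    rw [mB_rE _ e2']
    exact mB_diag _ b1 _ _ (by rw [mB_rR _ r2']; exact b3)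
  · have b2' : (uBᴴ)ᴴ * uBᴴ = 1 := by simpa using b2
    have r2' : (uRᴴ)ᴴ * uRᴴ = 1 := by simpa using r2
    exact mE_diag _ e1 _ _ (by rw [mE_rB _ b2', mE_rR _ r2']; exact e3)
  · rw [vnEnt, dif_pos hR]
  · rw [vnEnt, dif_pos hB]
  · rw [vnEnt, dif_pos hE]

/-- tensor power of a tripartite vector -/
noncomputable def tp (n : ℕ) (ω : R → B → E → ℂ) : (Fin n → R) → (Fin n → B) → (Fin n → E) → ℂ :=
  fun r b e => ∏ t, ω (r t) (b t) (e t)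

/-- tensor power of a matrix -/
noncomputable def mp {ι κ : Type} (n : ℕ) (u : Matrix ι κ ℂ) : Matrix (Fin n → ι) (Fin n → κ) ℂ :=
  Matrix.of fun x y => ∏ t, u (x t) (y t)

lemma tp_rR (n : ℕ) (u : Matrix R R ℂ) (ω : R → B → E → ℂ) :
    tp n (rR u ω) = rR (mp n u) (tp n ω) := by
  ext r b e
  simp only [tp, rR, mp, of_apply, ← Finset.prod_mul_distrib]
  exact prod_sum_pi _

lemma tp_rB (n : ℕ) (u : Matrix B B ℂ) (ω : R → B → E → ℂ) :
    tp n (rB u ω) = rB (mp n u) (tp n ω) := by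
  ext r b e
  simp only [tp, rB, mp, of_apply, ← Finset.prod_mul_distrib]
  exact prod_sum_pi _

lemma tp_rE (n : ℕ) (u : Matrix E E ℂ) (ω : R → B → E → ℂ) :
    tp n (rE u ω) = rE (mp n u) (tp n ω) := by
  ext r b e
  simp only [tp, rE, mp, of_apply, ← Finset.prod_mul_distrib]
  exact prod_sum_pi _

lemma mR_tp (n : ℕ) (ω : R → B → E → ℂ) : mR (tp n ω) = mp n (mR ω) := by
  ext r r'
  simp only [tp, mR, mp, of_apply, map_prod, ← Finset.prod_mul_distrib]
  symm
  exact prod_sum_pi2 _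

lemma mB_tp (n : ℕ) (ω : R → B → E → ℂ) : mB (tp n ω) = mp n (mB ω) := by
  ext r r'
  simp only [tp, mB, mp, of_apply, map_prod, ← Finset.prod_mul_distrib]
  symm
  exact prod_sum_pi2 _

lemma mE_tp (n : ℕ) (ω : R → B → E → ℂ) : mE (tp n ω) = mp n (mE ω) := by
  ext r r'
  simp only [tp, mE, mp, of_apply, map_prod, ← Finset.prod_mul_distrib]
  symm
  exact prod_sum_pi2 _

lemma mp_diag {ι : Type} [DecidableEq ι] (n : ℕ) (M : Matrix ι ι ℂ) (p : ι → ℝ)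
    (h : ∀ i j, M i j = if i = j then (p i : ℂ) else 0) (x y : Fin n → ι) :
    mp n M x y = if x = y then ((∏ t, p (x t) : ℝ) : ℂ) else 0 := by
  simp only [mp, of_apply, h]
  rw [prod_delta (fun i => (p i : ℂ))]
  push_cast
  rfl

lemma diag_real {ι κ : Type} [Fintype ι] [Fintype κ] (f : ι → κ → ℂ) (p : ℝ)
    (h : ∑ i, ∑ j, f i j * conj (f i j) = (p : ℂ)) : ∑ i, ∑ j, Complex.normSq (f i j) = p := by
  simp only [Complex.mul_conj] at h
  exact_mod_cast h

end P9

section P10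
variable {R A B E : Type} [Fintype R] [Fintype A] [Fintype B] [Fintype E] [DecidableEq A]
  [DecidableEq R] [DecidableEq B] [DecidableEq E]

lemma nfold (V : Matrix (B × E) A ℂ) (hV : Vᴴ * V = 1) (ψ : R → A → ℂ)
    (hψ : ∑ r, ∑ a, Complex.normSq (ψ r a) = 1) (ω : R → B → E → ℂ)
    (hω : ∀ r b e, ω r b e = ∑ a, V (b, e) a * ψ r a) :
    ∃ (pR : R → ℝ) (pB : B → ℝ) (pE : E → ℝ),
      (∀ i, 0 ≤ pR i) ∧ (∀ i, 0 ≤ pB i) ∧ (∀ i, 0 ≤ pE i) ∧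
      ∑ i, pR i = 1 ∧ ∑ i, pB i = 1 ∧ ∑ i, pE i = 1 ∧
      vnEnt (mR ω) = ∑ i, -(pR i * Real.logb 2 (pR i)) ∧
      vnEnt (mB ω) = ∑ i, -(pB i * Real.logb 2 (pB i)) ∧
      vnEnt (mE ω) = ∑ i, -(pE i * Real.logb 2 (pE i)) ∧
      ∀ (n : ℕ) (TR : Finset (Fin n → R)) (TB : Finset (Fin n → B)) (TE : Finset (Fin n → E))
        (lR lE γ : ℝ), 0 ≤ lR → 0 ≤ lE →
        (∀ x ∈ TR, ∏ t, pR (x t) ≤ lR) → (∀ x ∈ TE, ∏ t, pE (x t) ≤ lE) →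
        (∑ x ∈ TRᶜ, ∏ t, pR (x t) ≤ γ) → (∑ x ∈ TBᶜ, ∏ t, pB (x t) ≤ γ) →
        (∑ x ∈ TEᶜ, ∏ t, pE (x t) ≤ γ) →
        (γ ≤ 1 / 6 → (1 / 4 : ℝ) ≤ TR.card * TB.card * lE ∧
          (1 / 4 : ℝ) ≤ TE.card * TB.card * lR) ∧
        (∀ (q k : ℕ) (γ2 : ℝ), 0 < q → 0 < k → TB.card ≤ q * k → 0 ≤ γ2 →
          TR.card * k * (2 * lE) ≤ q * γ2 ^ 2 →
          Sim (Fin q) (Fin k) (((Real.sqrt k)⁻¹ : ℝ) : ℂ) (fun (r : Fin n → R) (a : Fin n → A) => ∏ t : Fin n, ψ (r t) (a t))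
            (tp n ω) (18 * γ + 4 * γ2)) := by
  obtain ⟨uR, uB, uE, pR, pB, pE, V', ψ', ω', h1, h2, h3, h4, h5, h6, h7, h8, h9, h10,
    h11, h12, h13⟩ := single V hV ψ ω hω
  have dR : ∀ i, ∑ b, ∑ e, Complex.normSq (ω' i b e) = pR i := fun i =>
    diag_real (fun b e => ω' i b e) _ (by simpa [mR] using h8 i i)
  have dB : ∀ i, ∑ r, ∑ e, Complex.normSq (ω' r i e) = pB i := fun i =>
    diag_real (fun r e => ω' r i e) _ (by simpa [mB] using h9 i i)
  have dE : ∀ i, ∑ r, ∑ b, Complex.normSq (ω' r b i) = pE i := fun i =>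
    diag_real (fun r b => ω' r b i) _ (by simpa [mE] using h10 i i)
  have tot : ∑ r, ∑ b, ∑ e, Complex.normSq (ω' r b e) = 1 := by
    rw [← hψ]
    have a1 : ∀ r, ∑ b, ∑ e, Complex.normSq (ω' r b e) = ∑ a, Complex.normSq (ψ' r a) := by
      intro r
      rw [← rot_norm1 V' h4, Fintype.sum_prod_type]
      simp only [h5]
    simp only [a1]
    rw [Finset.sum_comm]
    conv_rhs => rw [Finset.sum_comm]
    refine Finset.sum_congr rfl fun a _ => ?_
    rw [← rot_norm1 uR h1]
    simp only [← h6]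
  have nn : ∀ r b e, 0 ≤ Complex.normSq (ω' r b e) := fun _ _ _ => Complex.normSq_nonneg _
  have pR0 : ∀ i, 0 ≤ pR i := fun i => by
    rw [← dR]; exact Finset.sum_nonneg fun _ _ => Finset.sum_nonneg fun _ _ => nn _ _ _
  have pB0 : ∀ i, 0 ≤ pB i := fun i => by
    rw [← dB]; exact Finset.sum_nonneg fun _ _ => Finset.sum_nonneg fun _ _ => nn _ _ _
  have pE0 : ∀ i, 0 ≤ pE i := fun i => by
    rw [← dE]; exact Finset.sum_nonneg fun _ _ => Finset.sum_nonneg fun _ _ => nn _ _ _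
  have pR1 : ∑ i, pR i = 1 := by simp only [← dR]; exact tot
  have pB1 : ∑ i, pB i = 1 := by
    simp only [← dB]; rw [← tot, Finset.sum_comm]
  have pE1 : ∑ i, pE i = 1 := by
    simp only [← dE]; rw [← tot, Finset.sum_comm]
    refine Finset.sum_congr rfl fun r _ => ?_
    rw [Finset.sum_comm]
  refine ⟨pR, pB, pE, pR0, pB0, pE0, pR1, pB1, pE1, h11, h12, h13, ?_⟩
  intro n TR TB TE lR lE γ hlR hlE hTR hTE gR gB gE
  have nR := mp_diag n _ _ h8
  have nB := mp_diag n _ _ h9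
  have nE := mp_diag n _ _ h10
  rw [← mR_tp] at nR
  rw [← mB_tp] at nB
  rw [← mE_tp] at nE
  have ndR : ∀ i, ∑ b, ∑ e, Complex.normSq (tp n ω' i b e) = ∏ t, pR (i t) := fun i =>
    diag_real (fun b e => tp n ω' i b e) _ (by simpa [mR] using nR i i)
  have ndB : ∀ i, ∑ r, ∑ e, Complex.normSq (tp n ω' r i e) = ∏ t, pB (i t) := fun i =>
    diag_real (fun r e => tp n ω' r i e) _ (by simpa [mB] using nB i i)
  have ndE : ∀ i, ∑ r, ∑ b, Complex.normSq (tp n ω' r b i) = ∏ t, pE (i t) := fun i =>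
    diag_real (fun r b => tp n ω' r b i) _ (by simpa [mE] using nE i i)
  have nR1 : ∑ x : Fin n → R, ∏ t, pR (x t) = 1 := by
    rw [← prod_sum_pi (fun _ i => pR i)]; simp [pR1]
  have nE1 : ∑ x : Fin n → E, ∏ t, pE (x t) = 1 := by
    rw [← prod_sum_pi (fun _ i => pE i)]; simp [pE1]
  have nR0 : ∀ x : Fin n → R, 0 ≤ ∏ t, pR (x t) := fun x => Finset.prod_nonneg fun _ _ => pR0 _
  have nE0 : ∀ x : Fin n → E, 0 ≤ ∏ t, pE (x t) := fun x => Finset.prod_nonneg fun _ _ => pE0 _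
  refine ⟨fun hγ => ⟨?_, ?_⟩, ?_⟩
  · exact mass_low (fun r y => tp n ω' r y.1 y.2) _ _ _ ndR ndB nE nE0 nE1 TR TB TE lE γ hlE hTE
      gR gB gE hγ
  · refine mass_low (fun e (y : (Fin n → B) × (Fin n → R)) => tp n ω' y.2 y.1 e)
      (fun x => ∏ t, pE (x t)) (fun x => ∏ t, pB (x t)) (fun x => ∏ t, pR (x t)) ?_ ?_ ?_ nR0 nR1
      TE TB TR lR γ hlR hTR gE gB gR hγ
    · intro e; rw [← ndE, Finset.sum_comm]
    · intro b; rw [← ndB, Finset.sum_comm]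
    · intro r r'; rw [← nR, Finset.sum_comm]; rfl
  · intro q k γ2 hq hk hc hγ2 hh
    have : Nonempty (Fin q) := ⟨⟨0, hq⟩⟩
    have : Nonempty (Fin k) := ⟨⟨0, hk⟩⟩
    have key := oneshot2 (Q := Fin q) (K := Fin k)
      (Matrix.of fun (x : (Fin n → B) × (Fin n → E)) (y : Fin n → A) =>
        ∏ t, V' (x.1 t, x.2 t) (y t)) (iso_pow2 V' h4)
      (fun r a => ∏ t, ψ' (r t) (a t)) (fun r y => tp n ω' r y.1 y.2) (by
        intro r y
        simp only [tp, h5, of_apply, ← Finset.prod_mul_distrib]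
        exact prod_sum_pi _) _ _ _ ndR ndB nE nE0 nE1 TR TB TE (by simpa using hc)
      lE γ γ2 hlE hTE gR gB gE hγ2 (by simpa using hh) (((Real.sqrt k)⁻¹ : ℝ) : ℂ) (by
        rw [Complex.conj_ofReal, ← Complex.ofReal_mul, ← mul_inv, Real.mul_self_sqrt (by positivity)]
        simp)
    have key2 : Sim (Fin q) (Fin k) (((Real.sqrt k)⁻¹ : ℝ) : ℂ)
        (fun (r : Fin n → R) (a : Fin n → A) => ∏ t : Fin n, ψ' (r t) (a t)) (tp n ω') (18 * γ + 4 * γ2) := by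
      obtain ⟨E0, D0, a, b, c⟩ := key
      refine ⟨E0, D0, a, b, ?_⟩
      rw [Fintype.sum_prod_type] at c
      exact c
    have key3 := ((key2.rotE (mp n uE) (iso_pow uE h3)).rotB (mp n uB) (iso_pow uB h2)).rotR
      (mp n uR) (iso_pow uR h1)
    have e1 : tp n ω = rR (mp n uR) (rB (mp n uB) (rE (mp n uE) (tp n ω'))) := by
      rw [h7, tp_rR, tp_rB, tp_rE]
    have e2 : (fun (r : Fin n → R) (a : Fin n → A) => ∏ t : Fin n, ψ (r t) (a t)) =
        fun r a => ∑ r', mp n uR r r' * ∏ t : Fin n, ψ' (r' t) (a t) := by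
      ext r a
      simp only [h6, mp, of_apply, ← Finset.prod_mul_distrib]
      exact prod_sum_pi _
    rw [e1, e2]
    exact key3

end P10

section P11

lemma floor_half (x : ℝ) (hx : 1 ≤ x) : 0 < ⌊x⌋₊ ∧ (⌊x⌋₊ : ℝ) ≤ x ∧ x / 2 ≤ ⌊x⌋₊ := by
  have h1 : 1 ≤ ⌊x⌋₊ := Nat.one_le_floor_iff x |>.mpr hx
  have h2 := Nat.lt_floor_add_one x
  have h3 : (1 : ℝ) ≤ ⌊x⌋₊ := by exact_mod_cast h1
  exact ⟨h1, Nat.floor_le (by linarith), by linarith⟩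

lemma numeric (HR HB HE δ γ2 : ℝ) (hδ : 0 < δ) (hγ2 : 0 < γ2) :
    ∃ N : ℕ, ∀ n : ℕ, N ≤ n → ∀ tR tB tE : ℕ,
      (tR : ℝ) ≤ 2 ^ ((n : ℝ) * (HR + δ / 16)) → (tB : ℝ) ≤ 2 ^ ((n : ℝ) * (HB + δ / 16)) →
      (tE : ℝ) ≤ 2 ^ ((n : ℝ) * (HE + δ / 16)) →
      (1 / 4 : ℝ) ≤ tR * tB * 2 ^ (-(n : ℝ) * (HE - δ / 16)) →
      (1 / 4 : ℝ) ≤ tE * tB * 2 ^ (-(n : ℝ) * (HR - δ / 16)) →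
      ∃ k q : ℕ, 0 < k ∧ 0 < q ∧ (k : ℝ) ≤ 2 ^ ((n : ℝ) * ((HE + HB - HR) / 2 + δ)) ∧
        (q : ℝ) ≤ 2 ^ ((n : ℝ) * ((HR + HB - HE) / 2 + δ)) ∧ tB ≤ q * k ∧
        tR * k * (2 * (2 : ℝ) ^ (-(n : ℝ) * (HE - δ / 16))) ≤ q * γ2 ^ 2 := by
  set L := Real.logb 2 (γ2 ^ 2) with hL
  have hγL : (2 : ℝ) ^ L = γ2 ^ 2 := Real.rpow_logb (by norm_num) (by norm_num) (by positivity)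
  refine ⟨⌈3 * (|L| + 2) / δ⌉₊, fun n hn tR tB tE hR hB hE h1 h2 => ?_⟩
  have hnd : 3 * (|L| + 2) ≤ n * δ := by
    have := Nat.ceil_le.mp hn
    rwa [div_le_iff₀ hδ] at this
  have hLa := neg_abs_le L
  have hLn := abs_nonneg L
  have two : (0 : ℝ) < 2 := by norm_num
  have one2 : (1 : ℝ) < 2 := by norm_num
  have q4 : (1 / 4 : ℝ) = 2 ^ (-2 : ℝ) := by
    rw [Real.rpow_neg two.le]; norm_num
  have pos : ∀ x : ℝ, (0 : ℝ) < 2 ^ x := fun x => Real.rpow_pos_of_pos two x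
  have b1 : -2 ≤ n * (HR + HB - HE + 3 * (δ / 16)) := by
    have : (1 / 4 : ℝ) ≤ 2 ^ (n * (HR + HB - HE + 3 * (δ / 16))) := by
      refine h1.trans ?_
      calc _ ≤ (2 : ℝ) ^ ((n : ℝ) * (HR + δ / 16)) * 2 ^ ((n : ℝ) * (HB + δ / 16)) *
            2 ^ (-(n : ℝ) * (HE - δ / 16)) := by gcongr
        _ = _ := by rw [← Real.rpow_add two, ← Real.rpow_add two]; congr 1; ring
    rw [q4] at this
    exact (Real.rpow_le_rpow_left_iff one2).mp this
  have b2 : -2 ≤ n * (HE + HB - HR + 3 * (δ / 16)) := by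
    have : (1 / 4 : ℝ) ≤ 2 ^ (n * (HE + HB - HR + 3 * (δ / 16))) := by
      refine h2.trans ?_
      calc _ ≤ (2 : ℝ) ^ ((n : ℝ) * (HE + δ / 16)) * 2 ^ ((n : ℝ) * (HB + δ / 16)) *
            2 ^ (-(n : ℝ) * (HR - δ / 16)) := by gcongr
        _ = _ := by rw [← Real.rpow_add two, ← Real.rpow_add two]; congr 1; ring
    rw [q4] at this
    exact (Real.rpow_le_rpow_left_iff one2).mp this
  have xq1 : (1 : ℝ) ≤ 2 ^ ((n : ℝ) * ((HR + HB - HE) / 2 + δ)) :=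
    Real.one_le_rpow one2.le (by nlinarith)
  have xk1 : (1 : ℝ) ≤ 2 ^ ((n : ℝ) * ((HE + HB - HR) / 2 + δ / 2)) :=
    Real.one_le_rpow one2.le (by nlinarith)
  obtain ⟨q0, qle, qge⟩ := floor_half _ xq1
  obtain ⟨k0, kle, kge⟩ := floor_half _ xk1
  set q := ⌊(2 : ℝ) ^ ((n : ℝ) * ((HR + HB - HE) / 2 + δ))⌋₊
  set k := ⌊(2 : ℝ) ^ ((n : ℝ) * ((HE + HB - HR) / 2 + δ / 2))⌋₊
  refine ⟨k, q, k0, q0, kle.trans ?_, qle, ?_, ?_⟩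
  · exact Real.rpow_le_rpow_of_exponent_le one2.le (by nlinarith)
  · have : (tB : ℝ) ≤ q * k := by
      calc (tB : ℝ) ≤ 2 ^ ((n : ℝ) * (HB + δ / 16)) := hB
        _ ≤ 2 ^ ((n : ℝ) * ((HR + HB - HE) / 2 + δ) + (n : ℝ) * ((HE + HB - HR) / 2 + δ / 2)
              + (-2)) := Real.rpow_le_rpow_of_exponent_le one2.le (by nlinarith)
        _ = (2 ^ ((n : ℝ) * ((HR + HB - HE) / 2 + δ)) / 2) *
              (2 ^ ((n : ℝ) * ((HE + HB - HR) / 2 + δ / 2)) / 2) := by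
            rw [Real.rpow_add two, Real.rpow_add two, ← q4]; ring
        _ ≤ q * k := by gcongr
    exact_mod_cast this
  · calc tR * k * (2 * (2 : ℝ) ^ (-(n : ℝ) * (HE - δ / 16)))
        ≤ 2 ^ ((n : ℝ) * (HR + δ / 16)) * 2 ^ ((n : ℝ) * ((HE + HB - HR) / 2 + δ / 2)) *
          (2 * (2 : ℝ) ^ (-(n : ℝ) * (HE - δ / 16))) := by gcongr
      _ = 2 ^ ((n : ℝ) * (HR + δ / 16) + (n : ℝ) * ((HE + HB - HR) / 2 + δ / 2) +
          (-(n : ℝ) * (HE - δ / 16)) + 1) := by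
          rw [Real.rpow_add two, Real.rpow_add two, Real.rpow_add two, Real.rpow_one]; ring
      _ ≤ 2 ^ ((n : ℝ) * ((HR + HB - HE) / 2 + δ) + L + (-1)) :=
          Real.rpow_le_rpow_of_exponent_le one2.le (by nlinarith)
      _ = (2 ^ ((n : ℝ) * ((HR + HB - HE) / 2 + δ)) / 2) * γ2 ^ 2 := by
          rw [Real.rpow_add two, Real.rpow_add two, hγL, Real.rpow_neg two.le, Real.rpow_one]; ring
      _ ≤ q * γ2 ^ 2 := by gcongr

end P11

end mainDev

section P12

lemma mutRB_eq {dA dB dE dR : ℕ} (V : Matrix (Fin dB × Fin dE) (Fin dA) ℂ)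
    (ψ : Fin dR × Fin dA → ℂ) :
    mutRB V ψ = vnEnt (mR fun r b e => stateRBE V ψ (r, b, e)) +
      vnEnt (mB fun r b e => stateRBE V ψ (r, b, e)) -
      vnEnt (mE fun r b e => stateRBE V ψ (r, b, e)) := by
  let Z : Matrix (Fin dR × Fin dB) (Fin dE) ℂ :=
    Matrix.of fun x e => stateRBE V ψ (x.1, x.2, e)
  have h := vnEnt_dual Z
  have h1 : Z * Zᴴ = Matrix.of fun x y : Fin dR × Fin dB =>
      ∑ e, stateRBE V ψ (x.1, x.2, e) * conj (stateRBE V ψ (y.1, y.2, e)) := by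
    ext x y; simp [Z, Matrix.mul_apply]
  have h2 : (Zᴴ * Z)ᵀ = mE fun r b e => stateRBE V ψ (r, b, e) := by
    ext x y; simp [Z, Matrix.mul_apply, mE, Fintype.sum_prod_type, mul_comm]
  rw [h1, h2] at h
  rw [← h]
  rfl

lemma mutEB_eq {dA dB dE dR : ℕ} (V : Matrix (Fin dB × Fin dE) (Fin dA) ℂ)
    (ψ : Fin dR × Fin dA → ℂ) :
    mutEB V ψ = vnEnt (mE fun r b e => stateRBE V ψ (r, b, e)) +
      vnEnt (mB fun r b e => stateRBE V ψ (r, b, e)) -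
      vnEnt (mR fun r b e => stateRBE V ψ (r, b, e)) := by
  let Z : Matrix (Fin dB × Fin dE) (Fin dR) ℂ :=
    Matrix.of fun x r => stateRBE V ψ (r, x.1, x.2)
  have h := vnEnt_dual Z
  have h1 : Z * Zᴴ = Matrix.of fun x y : Fin dB × Fin dE =>
      ∑ r, stateRBE V ψ (r, x.1, x.2) * conj (stateRBE V ψ (r, y.1, y.2)) := by
    ext x y; simp [Z, Matrix.mul_apply]
  have h2 : (Zᴴ * Z)ᵀ = mR fun r b e => stateRBE V ψ (r, b, e) := by
    ext x y; simp [Z, Matrix.mul_apply, mR, Fintype.sum_prod_type, mul_comm]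
  rw [h1, h2] at h
  rw [← h]
  rfl

end P12

/-- Quantum reverse Shannon theorem with entanglement assistance (achievability). -/
theorem qrst_direct {dA dB dE dR : ℕ}
    (V : Matrix (Fin dB × Fin dE) (Fin dA) ℂ) (hV : Vᴴ * V = 1)
    (ψ : Fin dR × Fin dA → ℂ) (hψ : ∑ z, Complex.normSq (ψ z) = 1)
    (δ ε : ℝ) (hδ : 0 < δ) (hε : 0 < ε) :
    ∃ N : ℕ, ∀ n, N ≤ n →
      ∃ (k q : ℕ), 0 < k ∧ 0 < q ∧
        (k : ℝ) ≤ 2 ^ ((n : ℝ) * (mutEB V ψ / 2 + δ)) ∧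
        (q : ℝ) ≤ 2 ^ ((n : ℝ) * (mutRB V ψ / 2 + δ)) ∧
        ∃ (JE JD : Type) (_ : Fintype JE) (_ : Fintype JD)
          (E : JE → Matrix (Fin q) ((Fin n → Fin dA) × Fin k) ℂ)
          (D : JD → Matrix (Fin n → Fin dB) (Fin q × Fin k) ℂ),
          (∑ j, (E j)ᴴ * E j = 1) ∧
          (∑ j, (D j)ᴴ * D j = 1) ∧
          traceNorm
            (Matrix.of fun z z' : (Fin n → Fin dR) × (Fin n → Fin dB) =>
              (∑ j1 : JE, ∑ j2 : JD,
                (∑ a : Fin n → Fin dA,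
                    (((Real.sqrt k)⁻¹ : ℝ) : ℂ) *
                      (∑ qq : Fin q, ∑ i : Fin k, D j2 z.2 (qq, i) * E j1 qq (a, i)) *
                      (∏ t, ψ (z.1 t, a t))) *
                  conj (∑ a : Fin n → Fin dA,
                    (((Real.sqrt k)⁻¹ : ℝ) : ℂ) *
                      (∑ qq : Fin q, ∑ i : Fin k, D j2 z'.2 (qq, i) * E j1 qq (a, i)) *
                      (∏ t, ψ (z'.1 t, a t)))) -
                ∑ e : Fin n → Fin dE,
                  (∏ t, stateRBE V ψ (z.1 t, z.2 t, e t)) *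
                    conj (∏ t, stateRBE V ψ (z'.1 t, z'.2 t, e t)))
            ≤ ε := by
  classical
  have hψ' : ∑ r, ∑ a, Complex.normSq (ψ (r, a)) = 1 := by
    rw [← hψ, Fintype.sum_prod_type]
  obtain ⟨pR, pB, pE, pR0, pB0, pE0, pR1, pB1, pE1, eR, eB, eE, main⟩ :=
    nfold V hV (fun r a => ψ (r, a)) hψ' (fun r b e => stateRBE V ψ (r, b, e)) (fun r b e => rfl)
  have tot : ∑ r, ∑ b, ∑ e, Complex.normSq (stateRBE V ψ (r, b, e)) = 1 := by
    rw [← hψ']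
    refine Finset.sum_congr rfl fun r _ => ?_
    rw [← rot_norm1 V hV, Fintype.sum_prod_type]
    rfl
  set t : ℝ := ε ^ 2 / 8 with ht
  have ht0 : 0 < t := by positivity
  set C : ℝ := 4 * (2 + 1 / t) with hC
  have hC0 : 0 < C := by positivity
  set s : ℝ := ε ^ 2 / (44 * C) with hs
  have hs0 : 0 < s := by positivity
  set γ : ℝ := min (1 / 6) s with hγ
  have hγ0 : 0 < γ := lt_min (by norm_num) hs0
  obtain ⟨N1, H1⟩ := typical pR pR0 pR1 (δ / 16) γ (by positivity) hγ0
  obtain ⟨N2, H2⟩ := typical pB pB0 pB1 (δ / 16) γ (by positivity) hγ0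
  obtain ⟨N3, H3⟩ := typical pE pE0 pE1 (δ / 16) γ (by positivity) hγ0
  rw [← eR] at H1
  rw [← eB] at H2
  rw [← eE] at H3
  rw [mutRB_eq, mutEB_eq]
  set HR := vnEnt (mR fun r b e => stateRBE V ψ (r, b, e))
  set HB := vnEnt (mB fun r b e => stateRBE V ψ (r, b, e))
  set HE := vnEnt (mE fun r b e => stateRBE V ψ (r, b, e))
  obtain ⟨N4, H4⟩ := numeric HR HB HE δ s hδ hs0
  refine ⟨max (max N1 N2) (max N3 N4), fun n hn => ?_⟩
  simp only [max_le_iff] at hn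
  obtain ⟨⟨n1, n2⟩, n3, n4⟩ := hn
  obtain ⟨TR, cR, lR, gR⟩ := H1 n n1
  obtain ⟨TB, cB, lB, gB⟩ := H2 n n2
  obtain ⟨TE, cE, lE, gE⟩ := H3 n n3
  obtain ⟨M1, M2⟩ := main n TR TB TE _ _ γ (by positivity) (by positivity) lR lE gR gB gE
  obtain ⟨m1, m2⟩ := M1 (min_le_left _ _)
  obtain ⟨k, q, k0, q0, kle, qle, hc, hh⟩ := H4 n n4 _ _ _ cR cB cE m1 m2
  obtain ⟨E0, D0, hE0, hD0, hsum⟩ := M2 q k s q0 k0 hc hs0.le hh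
  refine ⟨k, q, k0, q0, kle, qle, ?_⟩
  have hne : Nonempty (Fin n → Fin dB) := by
    by_contra hemp
    have : IsEmpty (Fin n → Fin dB) := not_nonempty_iff.mp hemp
    have h0 : IsEmpty (Fin dB) := by
      by_contra hb
      rw [not_isEmpty_iff] at hb
      exact hemp ⟨fun _ => hb.some⟩
    simp at pB1
  have hψn : ∑ r : Fin n → Fin dR, ∑ a : Fin n → Fin dA,
      Complex.normSq (∏ t, ψ (r t, a t)) = 1 := by
    simp only [map_prod]
    rw [← prod_sum_pi2 (fun _ r a => Complex.normSq (ψ (r, a)))]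
    simp [hψ']
  have hwn : ∑ z : (Fin n → Fin dR) × (Fin n → Fin dB), ∑ e : Fin n → Fin dE,
      Complex.normSq (∏ t, stateRBE V ψ (z.1 t, z.2 t, e t)) = 1 := by
    rw [Fintype.sum_prod_type]
    simp only [map_prod]
    have : ∀ r : Fin n → Fin dR, ∑ b : Fin n → Fin dB, ∑ e : Fin n → Fin dE,
        ∏ t, Complex.normSq (stateRBE V ψ (r t, b t, e t)) =
        ∏ t, ∑ b, ∑ e, Complex.normSq (stateRBE V ψ (r t, b, e)) := fun r =>
      (prod_sum_pi2 (fun t b e => Complex.normSq (stateRBE V ψ (r t, b, e)))).symm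
    simp only [this]
    rw [← prod_sum_pi (fun _ r => ∑ b, ∑ e, Complex.normSq (stateRBE V ψ (r, b, e)))]
    simp [tot]
  obtain ⟨JE, JD, i1, i2, E, D, hE, hD, hfin⟩ := assemble k0 q0 E0 D0 hE0 hD0
    (fun (r : Fin n → Fin dR) (a : Fin n → Fin dA) => ∏ t, ψ (r t, a t)) hψn
    (fun z e => ∏ t, stateRBE V ψ (z.1 t, z.2 t, e t)) hwn (18 * γ + 4 * s) t ht0
    (by rw [Fintype.sum_prod_type]; exact hsum)
  refine ⟨JE, JD, i1, i2, E, D, hE, hD, ?_⟩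
  refine (abs_le_of_sq_le_sq' ?_ hε.le).2
  refine le_trans hfin ?_
  have hγs : γ ≤ s := min_le_right _ _
  have hCs : C * s = ε ^ 2 / 44 := by rw [hs]; field_simp
  have : C * (18 * γ + 4 * s) ≤ C * (22 * s) := by gcongr; linarith
  have e1 : 4 * (t + (2 + 1 / t) * (18 * γ + 4 * s)) = 4 * t + C * (18 * γ + 4 * s) := by
    rw [hC]; ring
  rw [e1]
  have : 4 * t = ε ^ 2 / 2 := by rw [ht]; ring
  linarith
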